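/- Let k be a field, V a finite-dimensional k-vector space, and G ≤ GL(V) a finite group such that V is an irreducible kG-representation. Then the action of G on V is coregular if and only if G is generated by pseudo-reflections and the action has the direct summand property. -/

import Mathlib

open MvPolynomial Matrix

set_option synthInstance.maxHeartbeats 1000000
set_option maxHeartbeats 1000000

variable {k : Type} [Field k] {ι : Type} [Fintype ι] [DecidableEq ι]

/-- Substitution of the variables by the linear forms determined by the matrix `g`. -/
noncomputable def polySub (g : Matrix ι ι k) :
    MvPolynomial ι k →ₐ[k] MvPolynomial ι k :=
  aeval fun i => ∑ j, C (g i j) * X j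

/-- The (left) action of an invertible matrix `g` on polynomial functions,
`(g • f)(v) = f (g⁻¹ *ᵥ v)`. -/
noncomputable def polyAct (g : Matrix ι ι k) :
    MvPolynomial ι k →ₐ[k] MvPolynomial ι k :=
  polySub g⁻¹

/-- The ring of invariants of a set of (invertible) matrices. -/
noncomputable def invariantRing (S : Set (Matrix ι ι k)) :
    Subalgebra k (MvPolynomial ι k) :=
  ⨅ g ∈ S, AlgHom.equalizer (polyAct g) (AlgHom.id k _)

/-- The direct summand property: there is a surjective `k[V]^G`-linear map
`k[V] → k[V]^G` respecting the gradings. -/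
noncomputable def DirectSummand (S : Set (Matrix ι ι k)) : Prop :=
  ∃ π : MvPolynomial ι k →ₗ[invariantRing S] invariantRing S,
    Function.Surjective π ∧
    ∀ (d : ℕ) (f : MvPolynomial ι k),
      f.IsHomogeneous d → ((π f : MvPolynomial ι k)).IsHomogeneous d

/-- Coregularity: the invariant ring is generated by `dim V` algebraically
independent homogeneous invariants. -/
noncomputable def Coregular (S : Set (Matrix ι ι k)) : Prop :=
  ∃ f : ι → MvPolynomial ι k,
    (∀ i, ∃ d, (f i).IsHomogeneous d) ∧
    AlgebraicIndependent k f ∧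
    Algebra.adjoin k (Set.range f) = invariantRing S

/-- A pseudo-reflection: fixed-point space of codimension one. -/
def IsPseudoReflection (g : Matrix ι ι k) : Prop :=
  Module.finrank k (LinearMap.ker (g.mulVecLin - LinearMap.id)) + 1 = Fintype.card ι

/-- The set of matrices underlying a subgroup of `GL`. -/
def matSet {n : ℕ} (G : Subgroup (GL (Fin n) k)) : Set (Matrix (Fin n) (Fin n) k) :=
  (fun g : GL (Fin n) k => (g : Matrix (Fin n) (Fin n) k)) '' (G : Set (GL (Fin n) k))

/-- The point stabilizer of a subspace `U`. -/
def pointStabilizer {n : ℕ} (G : Subgroup (GL (Fin n) k)) (U : Submodule k (Fin n → k)) :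
    Subgroup (GL (Fin n) k) where
  carrier := {g | g ∈ G ∧ ∀ u ∈ U, (g : Matrix (Fin n) (Fin n) k) *ᵥ u = u}
  one_mem' := ⟨G.one_mem, fun u _ => by simp⟩
  mul_mem' := fun {a b} ha hb => ⟨G.mul_mem ha.1 hb.1, fun u hu => by
    have h1 := ha.2 u hu
    have h2 := hb.2 u hu
    rw [Units.val_mul, ← Matrix.mulVec_mulVec, h2, h1]⟩
  inv_mem' := fun {a} ha => ⟨G.inv_mem ha.1, fun u hu => by
    conv_lhs => rw [← ha.2 u hu]
    rw [Matrix.mulVec_mulVec, Units.inv_mul, Matrix.one_mulVec]⟩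

section SeparatingFunctions

variable {Γ S : Type} [Group Γ] [CommRing S] [MulSemiringAction Γ S]

/-- The subring of elements fixed by a subgroup. -/
def fixedRing (H : Subgroup Γ) (S : Type) [CommRing S] [MulSemiringAction Γ S] : Subring S where
  carrier := {s | ∀ h ∈ H, h • s = s}
  mul_mem' ha hb h hh := by rw [smul_mul', ha h hh, hb h hh]
  one_mem' h _ := smul_one h
  add_mem' ha hb h hh := by rw [smul_add, ha h hh, hb h hh]
  zero_mem' h _ := smul_zero h
  neg_mem' ha h hh := by rw [smul_neg, ha h hh]

theorem mem_fixedRing {H : Subgroup Γ} {s : S} : s ∈ fixedRing H S ↔ ∀ h ∈ H, h • s = s := Iff.rfl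

theorem fixedRing_anti {H K : Subgroup Γ} (h : H ≤ K) : fixedRing K S ≤ fixedRing H S :=
  fun _ hs g hg => hs g (h hg)

/-- Functions on the group of the form `γ ↦ ∑ uᵢ γ(vᵢ)` with `uᵢ`, `vᵢ` fixed by `H`. -/
def IsSep (H : Subgroup Γ) (F : Γ → S) : Prop :=
  ∃ (κ : Type) (_ : Fintype κ) (u v : κ → S), (∀ i, u i ∈ fixedRing H S) ∧
    (∀ i, v i ∈ fixedRing H S) ∧ ∀ γ, F γ = ∑ i, u i * γ • v i

theorem IsSep.one (H : Subgroup Γ) : IsSep H (fun _ => (1 : S)) :=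
  ⟨Unit, inferInstance, fun _ => 1, fun _ => 1, fun _ => one_mem _, fun _ => one_mem _,
    fun γ => by simp⟩

theorem IsSep.mul {H : Subgroup Γ} {F F' : Γ → S} (hF : IsSep H F) (hF' : IsSep H F') :
    IsSep H (fun γ => F γ * F' γ) := by
  obtain ⟨κ, _, u, v, hu, hv, h⟩ := hF
  obtain ⟨κ', _, u', v', hu', hv', h'⟩ := hF'
  refine ⟨κ × κ', inferInstance, fun i => u i.1 * u' i.2, fun i => v i.1 * v' i.2,
    fun i => mul_mem (hu _) (hu' _), fun i => mul_mem (hv _) (hv' _), fun γ => ?_⟩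
  simp only [h, h', Finset.sum_mul_sum, Fintype.sum_prod_type]
  refine Finset.sum_congr rfl fun i _ => Finset.sum_congr rfl fun j _ => ?_
  rw [smul_mul']; ring

theorem IsSep.prod {H : Subgroup Γ} {α : Type} (s : Finset α) (F : α → Γ → S)
    (hF : ∀ a ∈ s, IsSep H (F a)) : IsSep H (fun γ => ∏ a ∈ s, F a γ) := by
  classical
  induction s using Finset.induction_on with
  | empty => simpa using IsSep.one H
  | insert a s ha ih =>
    simp only [Finset.prod_insert ha]
    exact (hF a (by simp)).mul (ih fun b hb => hF b (by simp [hb]))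

theorem IsSep.coeff {H : Subgroup Γ} {F : Γ → Polynomial S} (hF : IsSep H F) (N : ℕ) :
    IsSep H (fun γ => (F γ).coeff N) := by
  obtain ⟨κ, _, u, v, hu, hv, h⟩ := hF
  refine ⟨κ × Finset.HasAntidiagonal.antidiagonal N, inferInstance, fun i => (u i.1).coeff i.2.1.1,
    fun i => (v i.1).coeff i.2.1.2, fun i g hg => ?_, fun i g hg => ?_, fun γ => ?_⟩
  · rw [← Polynomial.coeff_smul, hu _ g hg]
  · rw [← Polynomial.coeff_smul, hv _ g hg]
  · simp only [h, Polynomial.finsetSum_coeff, Polynomial.coeff_mul, Polynomial.coeff_smul]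
    rw [Fintype.sum_prod_type]
    refine Finset.sum_congr rfl fun i _ => ?_
    rw [← Finset.sum_coe_sort]

theorem exists_isSep_of_polynomial {H : Subgroup Γ} (q : Ideal S) {g : Γ}
    (h : ∃ F : Γ → Polynomial S, IsSep H F ∧ F g = 0 ∧ F 1 ∉ q.map Polynomial.C) :
    ∃ F : Γ → S, IsSep H F ∧ F g = 0 ∧ F 1 ∉ q := by
  obtain ⟨F, hF, hg, h1⟩ := h
  rw [Ideal.mem_map_C_iff] at h1
  push Not at h1
  obtain ⟨N, hN⟩ := h1
  exact ⟨_, hF.coeff N, by simp [hg], hN⟩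

theorem exists_isSep_of_forall_notMem (H : Subgroup Γ) [Finite H] (q : Ideal S) [q.IsPrime] (g : Γ)
    (s : S) (hs : ∀ h ∈ H, ∀ h' ∈ H, (h * g * h') • s - s ∉ q) :
    ∃ F : Γ → Polynomial S, IsSep H F ∧ F g = 0 ∧ F 1 ∉ q.map Polynomial.C := by
  classical
  have := Fintype.ofFinite H
  set c : Polynomial S := MulSemiringAction.charpoly H s with hc
  have hcfix : ∀ h ∈ H, h • c = c := fun h hh =>
    MulSemiringAction.smul_charpoly (G := H) s ⟨h, hh⟩
  set D := MulSemiringAction.charpoly H (g • c) with hD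
  have hDfix : ∀ (m : ℕ), D.coeff m ∈ fixedRing H (Polynomial S) := fun m h hh =>
    MulSemiringAction.smul_coeff_charpoly (G := H) (g • c) m ⟨h, hh⟩
  have heval : ∀ γ : Γ, D.eval (γ • c) = ∑ i : Fin (D.natDegree + 1), D.coeff i * γ • c ^ (i : ℕ) := by
    intro γ
    rw [Polynomial.eval_eq_sum_range, ← Fin.sum_univ_eq_sum_range
      (fun i => D.coeff i * (γ • c) ^ i)]
    simp only [smul_pow']
  refine ⟨fun γ => D.eval (γ • c), ⟨Fin (D.natDegree + 1), inferInstance, fun i => D.coeff i,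
    fun i => c ^ (i : ℕ), fun i => hDfix i, fun i => pow_mem (mem_fixedRing.2 hcfix) _, heval⟩, ?_, ?_⟩
  · exact MulSemiringAction.eval_charpoly H (g • c)
  · intro hmem
    simp only [one_smul] at hmem
    rw [hD, MulSemiringAction.charpoly_eq, Polynomial.eval_prod, Ideal.IsPrime.prod_mem_iff] at hmem
    obtain ⟨h, -, hh⟩ := hmem
    simp only [Polynomial.eval_sub, Polynomial.eval_X, Polynomial.eval_C] at hh
    have h2 : (c - h • g • c).eval s ∈ q := by
      have := Ideal.mem_map_of_mem (Polynomial.evalRingHom s) hh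
      rw [Ideal.map_map] at this
      have he : (Polynomial.evalRingHom s).comp Polynomial.C = RingHom.id S := by ext; simp
      rw [he, Ideal.map_id] at this
      exact this
    rw [Polynomial.eval_sub, show c.eval s = 0 from MulSemiringAction.eval_charpoly H s, zero_sub,
      neg_mem_iff, hc, MulSemiringAction.charpoly_eq] at h2
    have h3 : (h • g • ∏ h' : H, (Polynomial.X - Polynomial.C (h' • s))) =
        ∏ h' : H, (Polynomial.X - Polynomial.C (((h : Γ) * g * h') • s)) := by
      rw [Finset.smul_prod', Finset.smul_prod']
      refine Finset.prod_congr rfl fun h' _ => ?_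
      rw [smul_sub, smul_sub, Polynomial.smul_X, Polynomial.smul_X, Polynomial.smul_C,
        Polynomial.smul_C, mul_smul, mul_smul]
      rfl
    rw [h3, Polynomial.eval_prod, Ideal.IsPrime.prod_mem_iff] at h2
    obtain ⟨h', -, hh'⟩ := h2
    apply hs h h.2 h' h'.2
    rw [← neg_mem_iff]
    simpa using hh'

theorem exists_isSep_of_inertia_le (G H : Subgroup Γ) [Finite H] (hHG : H ≤ G) (q : Ideal S)
    [q.IsPrime] (hI : ∀ g ∈ G, (∀ s : S, g • s - s ∈ q) → g ∈ H) {g : Γ} (hg : g ∈ G)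
    (hgH : g ∉ H) : ∃ F : Γ → S, IsSep H F ∧ F g = 0 ∧ F 1 ∉ q := by
  classical
  have := Fintype.ofFinite H
  apply exists_isSep_of_polynomial
  apply exists_isSep_of_polynomial
  have key : ∀ x : H × H, ∃ s : S, ((x.1 : Γ) * g * x.2) • s - s ∉ q := by
    intro x
    by_contra hcon
    push Not at hcon
    have h1 : (x.1 : Γ) * g * x.2 ∈ G :=
      G.mul_mem (G.mul_mem (hHG x.1.2) hg) (hHG x.2.2)
    have h2 := hI _ h1 hcon
    rw [H.mul_mem_cancel_right x.2.2, H.mul_mem_cancel_left x.1.2] at h2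
    exact hgH h2
  choose s hs using key
  let e := Fintype.equivFin (H × H)
  let t : Polynomial S := ∑ x : H × H, Polynomial.monomial (e x : ℕ) (s x)
  have ht : ∀ x : H × H, t.coeff (e x : ℕ) = s x := by
    intro x
    simp only [t, Polynomial.finsetSum_coeff, Polynomial.coeff_monomial]
    rw [Finset.sum_eq_single x]
    · simp
    · intro b _ hb
      rw [if_neg]
      intro h
      exact hb (e.injective (Fin.ext h))
    · simp
  apply exists_isSep_of_forall_notMem H (q.map Polynomial.C) g t
  intro h hh h' hh' hmem
  rw [Ideal.mem_map_C_iff] at hmem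
  have := hmem (e (⟨h, hh⟩, ⟨h', hh'⟩) : ℕ)
  rw [Polynomial.coeff_sub, Polynomial.coeff_smul, ht] at this
  exact hs (⟨h, hh⟩, ⟨h', hh'⟩) this

/-- If the inertia group of the prime `q` lies in `H`, the diagonal is separated from the cosets
outside `H` by functions with invariant coefficients, locally at `q`. -/
theorem exists_separating_system (G H : Subgroup Γ) [Finite G] (hHG : H ≤ G) (q : Ideal S)
    [q.IsPrime] (hI : ∀ g ∈ G, (∀ s : S, g • s - s ∈ q) → g ∈ H) :
    ∃ (κ : Type) (_ : Fintype κ) (u v : κ → S), (∀ i, u i ∈ fixedRing H S) ∧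
      (∀ i, v i ∈ fixedRing H S) ∧ (∀ g ∈ G, g ∉ H → ∑ i, u i * g • v i = 0) ∧
      ∑ i, u i * v i ∉ q := by
  classical
  have : Finite H := Finite.of_injective _ (Subgroup.inclusion_injective hHG)
  have := Fintype.ofFinite G
  have hF : ∀ g : G, ∃ F : Γ → S, IsSep H F ∧ ((g : Γ) ∉ H → F g = 0) ∧ F 1 ∉ q := by
    intro g
    by_cases hg : (g : Γ) ∈ H
    · exact ⟨_, IsSep.one H, fun h => absurd hg h, (Ideal.ne_top_iff_one q).1 Ideal.IsPrime.ne_top'⟩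
    · obtain ⟨F, h1, h2, h3⟩ := exists_isSep_of_inertia_le G H hHG q hI g.2 hg
      exact ⟨F, h1, fun _ => h2, h3⟩
  choose F h1 h2 h3 using hF
  obtain ⟨κ, i, u, v, hu, hv, h⟩ := IsSep.prod Finset.univ F fun a _ => h1 a
  refine ⟨κ, i, u, v, hu, hv, fun g hg hgH => ?_, ?_⟩
  · rw [← h]
    exact Finset.prod_eq_zero (Finset.mem_univ ⟨g, hg⟩) (h2 ⟨g, hg⟩ hgH)
  · have h4 := h 1
    simp only [one_smul] at h4
    rw [← h4, Ideal.IsPrime.prod_mem_iff]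
    simpa using h3

end SeparatingFunctions

section RelativeTrace

variable {Γ S : Type} [Group Γ] [CommRing S] [MulSemiringAction Γ S]

/-- The relative trace from the `H`-invariants to the `G`-invariants. -/
noncomputable def relTr (G H : Subgroup Γ) (s : S) : S :=
  ∑ᶠ q : G ⧸ H.subgroupOf G, ((q.out : G) : Γ) • s

theorem relTr_eq_sum (G H : Subgroup Γ) [Fintype (G ⧸ H.subgroupOf G)] (s : S) :
    relTr G H s = ∑ q : G ⧸ H.subgroupOf G, ((q.out : G) : Γ) • s :=
  finsum_eq_sum_of_fintype _

variable {G H : Subgroup Γ} [Finite G]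

theorem relTr_add (s t : S) : relTr G H (s + t) = relTr G H s + relTr G H t := by
  classical
  have := Fintype.ofFinite (G ⧸ H.subgroupOf G)
  simp [relTr_eq_sum, Finset.sum_add_distrib]

/-- The relative trace as an additive map. -/
noncomputable def relTrHom (G H : Subgroup Γ) [Finite G] : S →+ S :=
  AddMonoidHom.mk' (relTr G H) relTr_add

theorem relTr_sum {α : Type} (t : Finset α) (f : α → S) :
    relTr G H (∑ i ∈ t, f i) = ∑ i ∈ t, relTr G H (f i) :=
  map_sum (relTrHom G H) f t

theorem relTr_mul {a : S} (ha : a ∈ fixedRing G S) (s : S) :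
    relTr G H (a * s) = a * relTr G H s := by
  classical
  have := Fintype.ofFinite (G ⧸ H.subgroupOf G)
  simp only [relTr_eq_sum, Finset.mul_sum, smul_mul']
  exact Finset.sum_congr rfl fun q _ => by rw [ha _ q.out.2]

theorem smul_eq_smul_of_mk_eq {s : S} (hs : s ∈ fixedRing H S) {x y : G}
    (h : (QuotientGroup.mk x : G ⧸ H.subgroupOf G) = QuotientGroup.mk y) :
    (x : Γ) • s = (y : Γ) • s := by
  rw [QuotientGroup.eq, Subgroup.mem_subgroupOf] at h
  have := hs _ h
  simp only [Subgroup.coe_mul, Subgroup.coe_inv, mul_smul] at this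
  rw [inv_smul_eq_iff] at this
  exact this.symm

theorem relTr_mem {s : S} (hs : s ∈ fixedRing H S) : relTr G H s ∈ fixedRing G S := by
  classical
  have := Fintype.ofFinite (G ⧸ H.subgroupOf G)
  intro g hg
  rw [relTr_eq_sum, Finset.smul_sum]
  rw [← Equiv.sum_comp (MulAction.toPerm (⟨g, hg⟩ : G))
    (fun q : G ⧸ H.subgroupOf G => ((q.out : G) : Γ) • s)]
  refine Finset.sum_congr rfl fun q _ => ?_
  have h : (QuotientGroup.mk (⟨g, hg⟩ * q.out) : G ⧸ H.subgroupOf G) =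
      QuotientGroup.mk (MulAction.toPerm (⟨g, hg⟩ : G) q).out := by
    rw [QuotientGroup.out_eq', MulAction.toPerm_apply]
    conv_rhs => rw [← QuotientGroup.out_eq' q]
    rfl
  have := smul_eq_smul_of_mk_eq hs h
  rw [← this, Subgroup.coe_mul, mul_smul]

theorem relTr_congr_mod (Q : Ideal S) {s t b : S} (hQ : ∀ g ∈ G, ∀ x ∈ Q, g • x ∈ Q)
    (hs : ∀ g ∈ G, g • s - t ∈ Q) :
    relTr G H (b * s) - relTr G H b * t ∈ Q := by
  classical
  have := Fintype.ofFinite (G ⧸ H.subgroupOf G)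
  rw [relTr_eq_sum, relTr_eq_sum, Finset.sum_mul, ← Finset.sum_sub_distrib]
  refine sum_mem fun q _ => ?_
  rw [smul_mul', ← mul_sub]
  exact Q.mul_mem_left _ (hs _ q.out.2)

/-- Systems `(u, v)` of `H`-invariants separating `H` from the rest of `G`. -/
structure IsSystem (G H : Subgroup Γ) {κ : Type} [Fintype κ] (u v : κ → S) : Prop where
  left : ∀ i, u i ∈ fixedRing H S
  right : ∀ i, v i ∈ fixedRing H S
  eq_zero : ∀ g ∈ G, g ∉ H → ∑ i, u i * g • v i = 0

namespace IsSystem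

variable {κ : Type} [Fintype κ] {u v : κ → S}

theorem value_mem (h : IsSystem G H u v) : ∑ i, u i * v i ∈ fixedRing H S :=
  sum_mem fun i _ => mul_mem (h.left i) (h.right i)

theorem symm (h : IsSystem G H u v) : IsSystem G H v u where
  left := h.right
  right := h.left
  eq_zero g hg hgH := by
    have := h.eq_zero g⁻¹ (G.inv_mem hg) (fun h => hgH (by simpa using H.inv_mem h))
    have h2 := congrArg (g • ·) this
    simp only [Finset.smul_sum, smul_mul', smul_inv_smul, smul_zero] at h2
    rw [← h2]
    exact Finset.sum_congr rfl fun i _ => mul_comm _ _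

theorem sum_mul_relTr (h : IsSystem G H u v) {w : S} (hw : w ∈ fixedRing H S) :
    ∑ i, u i * relTr G H (w * v i) = (∑ i, u i * v i) * w := by
  classical
  have := Fintype.ofFinite (G ⧸ H.subgroupOf G)
  have h1 : ∑ i, u i * relTr G H (w * v i) = ∑ q : G ⧸ H.subgroupOf G,
      (((q.out : G) : Γ) • w) * ∑ i, u i * ((q.out : G) : Γ) • v i := by
    simp only [relTr_eq_sum, Finset.mul_sum]
    rw [Finset.sum_comm]
    refine Finset.sum_congr rfl fun q _ => Finset.sum_congr rfl fun i _ => ?_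
    rw [smul_mul']; ring
  rw [h1, Finset.sum_eq_single (QuotientGroup.mk (1 : G))]
  · have h2 : ((QuotientGroup.mk (1 : G) : G ⧸ H.subgroupOf G).out : Γ) ∈ H := by
      have := QuotientGroup.out_eq' (QuotientGroup.mk (1 : G) : G ⧸ H.subgroupOf G)
      rw [eq_comm, QuotientGroup.eq, Subgroup.mem_subgroupOf] at this
      simpa using this
    rw [hw _ h2, mul_comm]
    congr 1
    exact Finset.sum_congr rfl fun i _ => by rw [h.right i _ h2]
  · intro q _ hq
    rw [h.eq_zero _ q.out.2, mul_zero]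
    intro hmem
    apply hq
    rw [← QuotientGroup.out_eq' q, eq_comm, QuotientGroup.eq, Subgroup.mem_subgroupOf]
    simpa using hmem
  · simp

theorem sum_relTr_mul (h : IsSystem G H u v) {w : S} (hw : w ∈ fixedRing H S) :
    ∑ i, relTr G H (w * u i) * v i = (∑ i, u i * v i) * w := by
  have := h.symm.sum_mul_relTr hw
  simp only [mul_comm (v _)] at this
  exact this

end IsSystem

/-- Additive maps to the invariant ring that are linear over it. -/
structure IsInvLin (G : Subgroup Γ) (ψ : S →+ S) : Prop where
  mem : ∀ s, ψ s ∈ fixedRing G S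
  map_mul : ∀ a ∈ fixedRing G S, ∀ s, ψ (a * s) = a * ψ s

/-- The map `s ↦ ∑ uᵢ ψ(vᵢ s)`. -/
noncomputable def twist {κ : Type} [Fintype κ] (u v : κ → S) (ψ : S →+ S) : S →+ S :=
  ∑ i, (AddMonoidHom.mulLeft (u i)).comp (ψ.comp (AddMonoidHom.mulLeft (v i)))

theorem twist_apply {κ : Type} [Fintype κ] (u v : κ → S) (ψ : S →+ S) (s : S) :
    twist u v ψ s = ∑ i, u i * ψ (v i * s) := by
  simp [twist]

section

variable {κ : Type} [Fintype κ] {u v : κ → S} {ψ : S →+ S}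

theorem twist_mem (hHG : H ≤ G) (h : IsSystem G H u v) (hψ : IsInvLin G ψ) (s : S) :
    twist u v ψ s ∈ fixedRing H S := by
  rw [twist_apply]
  exact sum_mem fun i _ => mul_mem (h.left i) (fixedRing_anti hHG (hψ.mem _))

theorem twist_map_mul (hψ : IsInvLin G ψ) {a : S} (ha : a ∈ fixedRing G S) (s : S) :
    twist u v ψ (a * s) = a * twist u v ψ s := by
  simp only [twist_apply, Finset.mul_sum]
  refine Finset.sum_congr rfl fun i _ => ?_
  rw [mul_left_comm, hψ.map_mul a ha, mul_left_comm]

theorem twist_value_mul (h : IsSystem G H u v) (hψ : IsInvLin G ψ) {w : S}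
    (hw : w ∈ fixedRing H S) (s : S) :
    twist u v ψ ((∑ i, u i * v i) * w * s) = (∑ i, u i * v i) * w * twist u v ψ s := by
  have h1 : ∀ i, v i * ((∑ i, u i * v i) * w * s) =
      ∑ j, relTr G H (w * v i * u j) * (v j * s) := by
    intro i
    have := h.sum_relTr_mul (mul_mem hw (h.right i))
    calc v i * ((∑ i, u i * v i) * w * s) = ((∑ i, u i * v i) * (w * v i)) * s := by ring
      _ = _ := by
        rw [← this, Finset.sum_mul]
        exact Finset.sum_congr rfl fun j _ => by ring
  rw [twist_apply, twist_apply]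
  simp only [h1, map_sum]
  calc ∑ i, u i * ∑ j, ψ (relTr G H (w * v i * u j) * (v j * s))
      = ∑ i, ∑ j, u i * (relTr G H (w * u j * v i) * ψ (v j * s)) := by
        refine Finset.sum_congr rfl fun i _ => ?_
        rw [Finset.mul_sum]
        refine Finset.sum_congr rfl fun j _ => ?_
        rw [hψ.map_mul _ (relTr_mem (mul_mem (mul_mem hw (h.right i)) (h.left j)))]
        rw [mul_right_comm w]
    _ = ∑ j, (∑ i, u i * relTr G H (w * u j * v i)) * ψ (v j * s) := by
        rw [Finset.sum_comm]
        refine Finset.sum_congr rfl fun j _ => ?_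
        rw [Finset.sum_mul]
        exact Finset.sum_congr rfl fun i _ => by ring
    _ = _ := by
        rw [Finset.mul_sum]
        refine Finset.sum_congr rfl fun j _ => ?_
        rw [h.sum_mul_relTr (mul_mem hw (h.left j))]
        ring

/-- Every invariant divides a norm. -/
theorem exists_mul_mem_fixedRing [IsDomain S] (G : Subgroup Γ) [Finite G] {a : S} (ha : a ≠ 0) :
    ∃ c, c ≠ 0 ∧ c * a ∈ fixedRing G S ∧ ∀ K : Subgroup Γ, K ≤ G → a ∈ fixedRing K S →
      c ∈ fixedRing K S := by
  classical
  have := Fintype.ofFinite G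
  have hprod : ∏ g : G, g • a ∈ fixedRing G S := by
    intro h hh
    have : (⟨h, hh⟩ : G) • ∏ g : G, g • a = ∏ g : G, g • a := by
      rw [Finset.smul_prod']
      simp only [smul_smul]
      exact Equiv.prod_comp (Equiv.mulLeft (⟨h, hh⟩ : G)) fun g : G => g • a
    exact this
  have hsplit : (∏ g ∈ Finset.univ.erase (1 : G), g • a) * a = ∏ g : G, g • a := by
    have := Finset.prod_erase_mul Finset.univ (fun g : G => g • a) (Finset.mem_univ 1)
    simpa using this
  have hne : ∏ g ∈ Finset.univ.erase (1 : G), g • a ≠ 0 :=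
    Finset.prod_ne_zero_iff.2 fun g _ => (smul_ne_zero_iff_ne g).2 ha
  refine ⟨_, hne, hsplit ▸ hprod, fun K hK haK h hh => ?_⟩
  have h1 := hprod h (hK hh)
  rw [← hsplit, smul_mul', haK h hh] at h1
  exact mul_right_cancel₀ ha h1

theorem twist_isInvLin [IsDomain S] (hHG : H ≤ G) (h : IsSystem G H u v) (hψ : IsInvLin G ψ)
    (hne : ∑ i, u i * v i ≠ 0) : IsInvLin H (twist u v ψ) where
  mem := twist_mem hHG h hψ
  map_mul w hw s := by
    obtain ⟨c, hc, hca, -⟩ := exists_mul_mem_fixedRing G hne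
    apply mul_left_cancel₀ (mul_ne_zero hc hne)
    rw [← twist_map_mul hψ hca]
    have h1 := twist_value_mul h hψ hw (c * s)
    have h2 := twist_value_mul h hψ (one_mem _) (c * s)
    have h3 := twist_map_mul (u := u) (v := v) hψ hca s
    rw [show c * (∑ i, u i * v i) * (w * s) = (∑ i, u i * v i) * w * (c * s) by ring, h1]
    rw [show (∑ i, u i * v i) * 1 * (c * s) = c * (∑ i, u i * v i) * s by ring, h3] at h2
    linear_combination (-w) * h2

theorem relTr_twist (hHG : H ≤ G) (h : IsSystem G H u v) (hψ : IsInvLin G ψ) (s : S) :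
    relTr G H (twist u v ψ s) = ψ ((∑ i, u i * v i) * s) := by
  have h1 := h.sum_relTr_mul (one_mem _)
  rw [mul_one] at h1
  rw [twist_apply, relTr_sum, ← h1, Finset.sum_mul, map_sum]
  refine Finset.sum_congr rfl fun i _ => ?_
  rw [one_mul, mul_assoc, hψ.map_mul _ (relTr_mem (h.left i)), mul_comm (u i),
    relTr_mul (hψ.mem _), mul_comm]

theorem twist_comm [IsDomain S] (hHG : H ≤ G) (h : IsSystem G H u v) {κ' : Type} [Fintype κ']
    {u' v' : κ' → S} (h' : IsSystem G H u' v') (hψ : IsInvLin G ψ)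
    (hne : ∑ i, u i * v i ≠ 0) (s : S) :
    (∑ i, u i * v i) * twist u' v' ψ s = (∑ i, u' i * v' i) * twist u v ψ s := by
  rw [← (twist_isInvLin hHG h hψ hne).map_mul _ h'.value_mem, twist_apply, twist_apply,
    Finset.mul_sum]
  calc ∑ j, (∑ i, u i * v i) * (u' j * ψ (v' j * s))
      = ∑ j, ∑ i, u i * (relTr G H (v i * u' j) * ψ (v' j * s)) := by
        refine Finset.sum_congr rfl fun j _ => ?_
        rw [← mul_assoc, ← h.sum_mul_relTr (h'.left j), Finset.sum_mul]
        exact Finset.sum_congr rfl fun i _ => by rw [mul_comm (v i)]; ring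
    _ = ∑ i, u i * ψ (∑ j, relTr G H (v i * u' j) * (v' j * s)) := by
        rw [Finset.sum_comm]
        refine Finset.sum_congr rfl fun i _ => ?_
        rw [← Finset.mul_sum, map_sum]
        congr 1
        exact Finset.sum_congr rfl fun j _ =>
          (hψ.map_mul _ (relTr_mem (mul_mem (h.right i) (h'.left j))) _).symm
    _ = _ := by
        refine Finset.sum_congr rfl fun i _ => ?_
        congr 2
        simp only [← mul_assoc]
        rw [← Finset.sum_mul, h'.sum_relTr_mul (h.right i)]
        ring

theorem comp_relTr_isInvLin (hψ : IsInvLin G ψ) : IsInvLin G (ψ.comp (relTrHom G H)) where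
  mem s := hψ.mem _
  map_mul a ha s := by
    change ψ (relTr G H (a * s)) = a * ψ (relTr G H s)
    rw [relTr_mul ha, hψ.map_mul a ha]

theorem twist_comp_relTr_one (h : IsSystem G H u v) (hψ : IsInvLin G ψ) :
    twist u v (ψ.comp (relTrHom G H)) 1 = (∑ i, u i * v i) * ψ 1 := by
  have h1 := h.sum_mul_relTr (one_mem _)
  rw [mul_one] at h1
  rw [twist_apply, ← h1, Finset.sum_mul]
  refine Finset.sum_congr rfl fun i _ => ?_
  change u i * ψ (relTr G H (v i * 1)) = _
  rw [mul_one, one_mul, ← mul_one (relTr G H (v i)), hψ.map_mul _ (relTr_mem (h.right i)), mul_one,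
    mul_assoc]

end

theorem dvd_of_forall_prime [IsDomain S] [UniqueFactorizationMonoid S] {a : S} (ha : a ≠ 0) :
    ∀ {x : S}, (∀ p : S, Prime p → ∃ b, ¬ p ∣ b ∧ a ∣ b * x) → a ∣ x := by
  induction a using UniqueFactorizationMonoid.induction_on_prime with
  | h₁ => exact absurd rfl ha
  | h₂ a hu => intro x _; exact hu.dvd
  | h₃ a p ha' hp ih =>
    intro x hx
    obtain ⟨b, hb, hd⟩ := hx p hp
    obtain ⟨y, rfl⟩ := (hp.dvd_or_dvd ((Dvd.intro _ rfl).trans hd)).resolve_left hb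
    refine mul_dvd_mul_left p (ih ha' fun p' hp' => ?_)
    obtain ⟨b', hb', hd'⟩ := hx p' hp'
    refine ⟨b', hb', ?_⟩
    rw [mul_left_comm] at hd'
    exact (mul_dvd_mul_iff_left hp.ne_zero).1 hd'

/-- If `H` contains all inertia groups of principal primes, linear forms over the `G`-invariants
factor through the relative trace. -/
theorem exists_linear_factor [IsDomain S] [UniqueFactorizationMonoid S] (hHG : H ≤ G)
    (hbot : ∀ g ∈ G, (∀ s : S, g • s = s) → g ∈ H)
    (hprime : ∀ p : S, Prime p → ∀ g ∈ G, (∀ s : S, p ∣ g • s - s) → g ∈ H)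
    {ψ : S →+ S} (hψ : IsInvLin G ψ) :
    ∃ τ : S →+ S, IsInvLin H τ ∧ (∀ s, relTr G H (τ s) = ψ s) ∧
      ∃ (κ : Type) (_ : Fintype κ) (u v : κ → S), IsSystem G H u v ∧ ∑ i, u i * v i ≠ 0 ∧
        ∀ s, (∑ i, u i * v i) * τ s = twist u v ψ s := by
  have : (⊥ : Ideal S).IsPrime := Ideal.isPrime_bot
  obtain ⟨κ, _, u, v, hu, hv, h0, hne⟩ := exists_separating_system G H hHG (⊥ : Ideal S)
    (fun g hg hs => hbot g hg fun s => by simpa [sub_eq_zero] using hs s)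
  have hsys : IsSystem G H u v := ⟨hu, hv, h0⟩
  rw [Ideal.mem_bot] at hne
  set a := ∑ i, u i * v i with ha
  have hdvd : ∀ s, a ∣ twist u v ψ s := by
    intro s
    refine dvd_of_forall_prime hne fun p hp => ?_
    have : (Ideal.span {p}).IsPrime := (Ideal.span_singleton_prime hp.ne_zero).2 hp
    obtain ⟨κ', _, u', v', hu', hv', h0', hne'⟩ := exists_separating_system G H hHG (Ideal.span {p})
      (fun g hg hs => hprime p hp g hg fun s => Ideal.mem_span_singleton.1 (hs s))
    refine ⟨∑ i, u' i * v' i, fun h => hne' (Ideal.mem_span_singleton.2 h), ?_⟩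
    rw [← twist_comm hHG hsys ⟨hu', hv', h0'⟩ hψ hne]
    exact Dvd.intro _ rfl
  choose τ hτ using hdvd
  have hlin := twist_isInvLin hHG hsys hψ hne
  let τ' : S →+ S := AddMonoidHom.mk' τ fun s t => by
    apply mul_left_cancel₀ hne
    rw [mul_add, ← hτ, ← hτ, ← hτ, map_add]
  have hτ' : IsInvLin H τ' := by
    refine ⟨fun s h hh => ?_, fun w hw s => ?_⟩
    · apply mul_left_cancel₀ hne
      change a * h • τ s = a * τ s
      have h1 := hlin.mem s h hh
      rw [hτ s, smul_mul', hsys.value_mem h hh] at h1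
      exact h1
    · apply mul_left_cancel₀ hne
      change a * τ (w * s) = a * (w * τ s)
      rw [← hτ, hlin.map_mul w hw, hτ, mul_left_comm]
  refine ⟨τ', hτ', fun s => ?_, κ, _, u, v, hsys, hne, fun s => (hτ s).symm⟩
  obtain ⟨c, hc, hca, hcH⟩ := exists_mul_mem_fixedRing G hne
  have hcm : c ∈ fixedRing H S := hcH H hHG hsys.value_mem
  apply mul_left_cancel₀ (mul_ne_zero hc hne)
  rw [← relTr_mul hca, ← hψ.map_mul _ hca]
  have h1 := relTr_twist hHG hsys hψ (c * s)
  rw [show c * a * s = a * (c * s) by ring, ← h1, show c * a * τ' s = a * (c * τ' s) by ring,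
    ← hτ'.map_mul c hcm]
  congr 1
  exact (hτ (c * s)).symm

/-- The splitting property passes to such subgroups. -/
theorem exists_isInvLin_of_le [IsDomain S] [UniqueFactorizationMonoid S] (hHG : H ≤ G)
    (hbot : ∀ g ∈ G, (∀ s : S, g • s = s) → g ∈ H)
    (hprime : ∀ p : S, Prime p → ∀ g ∈ G, (∀ s : S, p ∣ g • s - s) → g ∈ H)
    {π : S →+ S} (hπ : IsInvLin G π) (h1 : π 1 = 1) :
    ∃ τ : S →+ S, IsInvLin H τ ∧ τ 1 = 1 := by
  obtain ⟨τ, hτ, -, κ, _, u, v, hsys, hne, h⟩ :=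
    exists_linear_factor hHG hbot hprime (comp_relTr_isInvLin (H := H) hπ)
  refine ⟨τ, hτ, mul_left_cancel₀ hne ?_⟩
  rw [h, twist_comp_relTr_one hsys hπ, h1]

end RelativeTrace

section Homogeneous

variable {σ : Type}

theorem homogeneousComponent_mul_of_isHomogeneous {m : MvPolynomial σ k} {e : ℕ}
    (hm : m.IsHomogeneous e) (c : MvPolynomial σ k) (d : ℕ) :
    homogeneousComponent d (c * m) =
      if e ≤ d then homogeneousComponent (d - e) c * m else 0 := by
  classical
  conv_lhs => rw [← sum_homogeneousComponent c, Finset.sum_mul, map_sum]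
  have h : ∀ i, homogeneousComponent d (homogeneousComponent i c * m) =
      if i + e = d then homogeneousComponent i c * m else 0 := fun i => by
    rw [homogeneousComponent_of_mem
      ((mem_homogeneousSubmodule _ _).2 ((homogeneousComponent_isHomogeneous i c).mul hm))]
    simp only [eq_comm]
  simp only [h]
  split_ifs with hed
  · have : ∀ i, (if i + e = d then homogeneousComponent i c * m else 0) =
        if i = d - e then homogeneousComponent i c * m else 0 := fun i => by
      congr 1; apply propext; omega
    simp only [this]
    rw [Finset.sum_ite_eq']
    split_ifs with hmem
    · rfl
    · rw [homogeneousComponent_eq_zero, zero_mul]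
      simp only [Finset.mem_range] at hmem
      omega
  · exact Finset.sum_eq_zero fun i _ => if_neg (by omega)

/-- An ideal of a polynomial ring that contains the homogeneous components of its elements. -/
def IsHomog (I : Ideal (MvPolynomial σ k)) : Prop :=
  ∀ s ∈ I, ∀ d, homogeneousComponent d s ∈ I

theorem exists_homogeneous_coeffs {τ : Type} [Fintype τ] {m : τ → MvPolynomial σ k} {δ : τ → ℕ}
    (hm : ∀ t, (m t).IsHomogeneous (δ t)) {s : MvPolynomial σ k}
    (hs : s ∈ Ideal.span (Set.range m)) (d : ℕ) :
    ∃ c : τ → MvPolynomial σ k, homogeneousComponent d s = ∑ t, c t * m t ∧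
      ∀ t, (c t).IsHomogeneous (d - δ t) ∧ (d < δ t → c t = 0) := by
  obtain ⟨c, rfl⟩ := (Ideal.mem_span_range_iff_exists_fun).1 hs
  refine ⟨fun t => if δ t ≤ d then homogeneousComponent (d - δ t) (c t) else 0, ?_, fun t => ?_⟩
  · rw [map_sum]
    refine Finset.sum_congr rfl fun t _ => ?_
    rw [homogeneousComponent_mul_of_isHomogeneous (hm t)]
    dsimp only
    split_ifs
    · rfl
    · rw [zero_mul]
  · refine ⟨?_, fun h => if_neg (by omega)⟩
    dsimp only
    split_ifs
    · exact homogeneousComponent_isHomogeneous _ _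
    · exact isHomogeneous_zero _ _ _

theorem IsHomog.span {X : Set (MvPolynomial σ k)} (hX : ∀ x ∈ X, ∃ e, x.IsHomogeneous e) :
    IsHomog (Ideal.span X) := by
  intro s hs d
  induction hs using Submodule.span_induction generalizing d with
  | mem x hx =>
    obtain ⟨e, he⟩ := hX x hx
    classical
    rw [homogeneousComponent_of_mem ((mem_homogeneousSubmodule _ _).2 he)]
    split_ifs
    · exact Ideal.subset_span hx
    · exact zero_mem _
  | zero => simp
  | add x y _ _ hx hy => rw [map_add]; exact add_mem (hx d) (hy d)
  | smul a x _ hx =>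
    rw [smul_eq_mul, ← sum_homogeneousComponent a, Finset.sum_mul, map_sum]
    refine sum_mem fun i _ => ?_
    rw [mul_comm, homogeneousComponent_mul_of_isHomogeneous (homogeneousComponent_isHomogeneous i a)]
    split_ifs
    · exact Ideal.mul_mem_right _ _ (hx _)
    · exact zero_mem _

theorem IsHomog.eq_span {I : Ideal (MvPolynomial σ k)} (hI : IsHomog I) :
    I = Ideal.span {x | x ∈ I ∧ ∃ e, x.IsHomogeneous e} := by
  refine le_antisymm (fun x hx => ?_) (Ideal.span_le.2 fun x hx => hx.1)
  rw [← sum_homogeneousComponent x]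
  exact sum_mem fun i _ => Ideal.subset_span ⟨hI x hx i, i, homogeneousComponent_isHomogeneous _ _⟩

theorem IsHomog.sSup {𝒮 : Set (Ideal (MvPolynomial σ k))} (h : ∀ I ∈ 𝒮, IsHomog I) :
    IsHomog (sSup 𝒮) := by
  intro s hs d
  rw [sSup_eq_iSup', ← SetLike.mem_coe] at hs
  refine Submodule.iSup_induction (fun I : 𝒮 => (I : Ideal (MvPolynomial σ k)))
    (motive := fun s => homogeneousComponent d s ∈ SupSet.sSup 𝒮) hs ?_ ?_ ?_
  · exact fun I x hx => (le_sSup I.2 : (I : Ideal (MvPolynomial σ k)) ≤ _) (h I I.2 x hx d)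
  · simp
  · intro x y hx hy
    rw [map_add]
    exact add_mem hx hy

/-- The ideal of polynomials without constant term. -/
noncomputable def irrel (σ k : Type) [Field k] : Ideal (MvPolynomial σ k) :=
  RingHom.ker (constantCoeff : MvPolynomial σ k →+* k)

theorem mem_irrel {s : MvPolynomial σ k} : s ∈ irrel σ k ↔ coeff 0 s = 0 := by
  rw [irrel, RingHom.mem_ker, constantCoeff_eq]

theorem irrel_ne_top : irrel σ k ≠ ⊤ := RingHom.ker_ne_top _

theorem MvPolynomial.IsHomogeneous.mem_irrel {s : MvPolynomial σ k} {d : ℕ} (hs : s.IsHomogeneous d)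
    (hd : 0 < d) : s ∈ irrel σ k :=
  _root_.mem_irrel.2 (hs.coeff_eq_zero (by simpa using hd.ne))

theorem IsHomog.le_irrel {I : Ideal (MvPolynomial σ k)} (hI : IsHomog I) (h : I ≠ ⊤) :
    I ≤ irrel σ k := by
  intro s hs
  have h0 := hI s hs 0
  rw [homogeneousComponent_zero] at h0
  by_contra hne
  rw [mem_irrel] at hne
  exact h (Ideal.eq_top_of_isUnit_mem _ h0 ((isUnit_iff_ne_zero.2 hne).map C))

/-- Homogeneous elements of an ideal spanned by forms of degrees `δ` with `0 < δ`. -/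
theorem homogeneousComponent_mem_span_of_lt {τ : Type} [Fintype τ] {m : τ → MvPolynomial σ k}
    {δ : τ → ℕ} (hm : ∀ t, (m t).IsHomogeneous (δ t)) {s : MvPolynomial σ k}
    (hs : s ∈ Ideal.span (Set.range m)) (d : ℕ) :
    homogeneousComponent d s ∈ Ideal.span (m '' {t | δ t ≤ d}) := by
  obtain ⟨c, hc, hc'⟩ := exists_homogeneous_coeffs hm hs d
  rw [hc]
  refine sum_mem fun t _ => ?_
  by_cases h : δ t ≤ d
  · exact Ideal.mul_mem_left _ _ (Ideal.subset_span ⟨t, h, rfl⟩)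
  · rw [(hc' t).2 (by omega), zero_mul]
    exact zero_mem _

end Homogeneous

section LechIndependence

variable {S : Type} [CommRing S] {τ : Type} [Fintype τ]

/-- Independence in the sense of Lech: the coefficients of every relation lie in the ideal
generated by the family. -/
def LInd (m : τ → S) : Prop :=
  ∀ s : τ → S, ∑ t, s t * m t = 0 → ∀ t, s t ∈ Ideal.span (Set.range m)

/-- All families of positive powers are independent. -/
def LIndPow (m : τ → S) : Prop :=
  ∀ a : τ → ℕ, (∀ t, 0 < a t) → LInd fun t => m t ^ a t

theorem LIndPow.pow {m : τ → S} (hm : LIndPow m) {a : τ → ℕ} (ha : ∀ t, 0 < a t) :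
    LIndPow fun t => m t ^ a t := fun b hb => by
  simp only [← pow_mul]
  exact hm _ fun t => Nat.mul_pos (ha t) (hb t)

theorem LInd.of_mul [DecidableEq τ] {m : τ → S} {t₀ : τ} {g h : S}
    (hm : LInd (Function.update m t₀ (g * h))) : LInd (Function.update m t₀ g) := by
  have hsplit : ∀ (x : S) (s : τ → S), ∑ t, s t * Function.update m t₀ x t =
      s t₀ * x + ∑ t ∈ Finset.univ.erase t₀, s t * m t := fun x s => by
    rw [← Finset.add_sum_erase _ _ (Finset.mem_univ t₀), Function.update_self]
    congr 1
    refine Finset.sum_congr rfl fun t ht => ?_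
    rw [Function.update_of_ne (Finset.ne_of_mem_erase ht)]
  have hle : Ideal.span (Set.range (Function.update m t₀ (g * h))) ≤
      Ideal.span (Set.range (Function.update m t₀ g)) := by
    rw [Ideal.span_le]
    rintro _ ⟨t, rfl⟩
    by_cases ht : t = t₀
    · subst ht
      rw [Function.update_self]
      exact Ideal.mul_mem_right _ _ (Ideal.subset_span ⟨t, Function.update_self ..⟩)
    · rw [Function.update_of_ne ht]
      exact Ideal.subset_span ⟨t, Function.update_of_ne ht ..⟩
  have hg : g ∈ Ideal.span (Set.range (Function.update m t₀ g)) :=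
    Ideal.subset_span ⟨t₀, Function.update_self ..⟩
  intro s hs
  rw [hsplit] at hs
  have h0 := hm (Function.update (fun t => h * s t) t₀ (s t₀)) (by
    rw [hsplit, Function.update_self]
    have : ∑ t ∈ Finset.univ.erase t₀, Function.update (fun t => h * s t) t₀ (s t₀) t * m t =
        h * ∑ t ∈ Finset.univ.erase t₀, s t * m t := by
      rw [Finset.mul_sum]
      refine Finset.sum_congr rfl fun t ht => ?_
      rw [Function.update_of_ne (Finset.ne_of_mem_erase ht), mul_assoc]
    rw [this]
    linear_combination h * hs) t₀
  rw [Function.update_self] at h0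
  obtain ⟨a, ha⟩ := Ideal.mem_span_range_iff_exists_fun.1 h0
  rw [hsplit] at ha
  have h1 := hm (Function.update (fun t => s t + a t * g) t₀ (a t₀ * g)) (by
    rw [hsplit, Function.update_self]
    have : ∑ t ∈ Finset.univ.erase t₀, Function.update (fun t => s t + a t * g) t₀ (a t₀ * g) t * m t
        = ∑ t ∈ Finset.univ.erase t₀, s t * m t +
          g * ∑ t ∈ Finset.univ.erase t₀, a t * m t := by
      rw [Finset.mul_sum, ← Finset.sum_add_distrib]
      refine Finset.sum_congr rfl fun t ht => ?_
      rw [Function.update_of_ne (Finset.ne_of_mem_erase ht)]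
      ring
    rw [this]
    linear_combination hs + g * ha)
  intro t
  by_cases ht : t = t₀
  · subst ht
    exact hle h0
  · have h2 := hle (h1 t)
    rw [Function.update_of_ne ht] at h2
    have h3 := sub_mem h2 (Ideal.mul_mem_left _ (a t) hg)
    rwa [add_sub_cancel_right] at h3

theorem LIndPow.of_frequently {m : τ → S} (h : ∀ N, ∃ M, N ≤ M ∧ LInd fun t => m t ^ M) :
    LIndPow m := by
  classical
  intro a ha
  obtain ⟨M, hM, hind⟩ := h (∑ t, a t)
  suffices H : ∀ F : Finset τ, LInd fun t => if t ∈ F then m t ^ a t else m t ^ M by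
    simpa using H Finset.univ
  intro F
  induction F using Finset.induction_on with
  | empty => simpa using hind
  | insert t₀ F ht₀ ih =>
    have hle : a t₀ ≤ M := (Finset.single_le_sum (fun t _ => Nat.zero_le (a t))
      (Finset.mem_univ t₀)).trans hM
    have e1 : (fun t => if t ∈ F then m t ^ a t else m t ^ M) =
        Function.update (fun t => if t ∈ F then m t ^ a t else m t ^ M) t₀
          (m t₀ ^ a t₀ * m t₀ ^ (M - a t₀)) := by
      rw [← pow_add, Nat.add_sub_cancel' hle]
      refine (Function.update_eq_self_iff.2 ?_).symm
      simp [ht₀]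
    rw [e1] at ih
    convert ih.of_mul using 1
    funext t
    by_cases ht : t = t₀
    · subst ht; simp
    · simp [ht]

end LechIndependence

section LechGraded

variable {σ : Type} {τ : Type} [Fintype τ]

/-- Forms of positive degree all of whose powers are independent behave like a permutable regular
sequence. -/
theorem LIndPow.mem_span_of_mul_pow_mem {m : τ → MvPolynomial σ k} {δ : τ → ℕ}
    (hind : LIndPow m) (hm : ∀ t, (m t).IsHomogeneous (δ t)) (hδ : ∀ t, 0 < δ t) {U : Set τ}
    {r : τ} (hr : r ∉ U) {N : ℕ} {x : MvPolynomial σ k}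
    (hx : x * m r ^ N ∈ Ideal.span (m '' U)) : x ∈ Ideal.span (m '' U) := by
  classical
  set D := x.totalDegree + 1 + N
  have hN : x * m r ^ D ∈ Ideal.span (m '' U) := by
    rw [show D = N + (x.totalDegree + 1) by omega, pow_add, ← mul_assoc]
    exact Ideal.mul_mem_right _ _ hx
  let a : τ → ℕ := fun t => if t ∈ U then 1 else D
  have ha : ∀ t, 0 < a t := fun t => by dsimp only [a]; split_ifs <;> omega
  obtain ⟨c, hc, hc'⟩ : ∃ c : τ → MvPolynomial σ k, x * m r ^ D = ∑ t, c t * m t ^ a t ∧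
      ∀ t, t ∉ U → c t = 0 := by
    rw [Ideal.span, Finsupp.mem_span_image_iff_linearCombination] at hN
    obtain ⟨l, hl, h⟩ := hN
    refine ⟨l, ?_, fun t ht => ?_⟩
    · rw [← h, Finsupp.linearCombination_apply, Finsupp.sum_fintype _ _ (by simp)]
      refine Finset.sum_congr rfl fun t _ => ?_
      by_cases ht : t ∈ U
      · simp [a, ht]
      · have : l t = 0 := by
          by_contra h0
          exact ht ((Finsupp.mem_supported _ _).1 hl (by simpa using h0))
        simp [this]
    · by_contra h0
      exact ht ((Finsupp.mem_supported _ _).1 hl (by simpa using h0))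
  have hxr := hind a ha (Function.update (fun t => - c t) r x) (by
    have hcr := hc' r hr
    rw [← Finset.add_sum_erase _ _ (Finset.mem_univ r)] at hc ⊢
    rw [hcr, zero_mul, zero_add] at hc
    dsimp only
    rw [Function.update_self, show a r = D from if_neg hr, hc, ← Finset.sum_add_distrib]
    refine Finset.sum_eq_zero fun t ht => ?_
    rw [Function.update_of_ne (Finset.ne_of_mem_erase ht)]
    ring) r
  rw [Function.update_self] at hxr
  rw [← sum_homogeneousComponent x]
  refine sum_mem fun d hd => ?_
  have h1 := homogeneousComponent_mem_span_of_lt (δ := fun t => δ t * a t)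
    (fun t => (hm t).pow (a t)) hxr d
  refine Ideal.span_mono ?_ h1
  rintro _ ⟨t, ht, rfl⟩
  have htU : t ∈ U := by
    by_contra hne
    simp only [Set.mem_ofPred_eq, a, if_neg hne] at ht
    have := Nat.le_mul_of_pos_left D (hδ t)
    rw [Finset.mem_range] at hd
    omega
  exact ⟨t, htU, by simp [a, htU]⟩

/-- An additive map to a polynomial ring is injective as soon as division by the members of an
independent family is possible in its source. -/
theorem LIndPow.eq_zero_of_map_eq_zero {m : τ → MvPolynomial σ k} {δ : τ → ℕ}
    (hind : LIndPow m) (hm : ∀ t, (m t).IsHomogeneous (δ t)) (hδ : ∀ t, 0 < δ t)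
    {M : Type} [AddCommGroup M] (φ : τ → M →+ M) (L : M →+ MvPolynomial σ k)
    (hL : ∀ t x, L (φ t x) = L x * m t) (F : ℕ → AddSubgroup M) (hF0 : ∀ x ∈ F 0, x = 0)
    {w : τ → ℕ} (hw : ∀ t, 0 < w t) (hφF : ∀ t D x, x ∈ F D → φ t x ∈ F (D + w t))
    (hφ : ∀ s t x, φ s (φ t x) = φ t (φ s x))
    (h : ∀ D, ∀ x ∈ F D, L x ∈ Ideal.span (Set.range m) →
      ∃ c : τ → M, (∀ t, c t ∈ F (D - w t)) ∧ x = ∑ t, φ t (c t))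
    {D : ℕ} {x : M} (hx : x ∈ F D) (hLx : L x = 0) : x = 0 := by
  classical
  suffices H : ∀ U V : Finset τ, (∀ t, t ∈ V ↔ t ∉ U) → ∀ D, ∀ x ∈ F D,
      L x ∈ Ideal.span (m '' (V : Set τ)) →
      ∃ c : τ → M, (∀ t, c t ∈ F (D - w t)) ∧ x = ∑ t ∈ V, φ t (c t) by
    obtain ⟨c, -, hc⟩ := H Finset.univ ∅ (by simp) D x hx (by simp [hLx])
    simpa using hc
  intro U
  induction U using Finset.induction_on with
  | empty =>
    intro V hV
    obtain rfl : V = Finset.univ := by ext; simp [hV]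
    simpa using h
  | insert u U hu ih =>
    intro V hV D
    have huV : u ∉ V := by simp [hV]
    induction D using Nat.strong_induction_on with
    | _ D ihD =>
    intro x hx hLx
    obtain ⟨c, hc, hxc⟩ := ih (insert u V) (fun t => by
      rw [Finset.mem_insert, hV, Finset.mem_insert]
      by_cases ht : t = u
      · subst ht; simp [hu]
      · simp [ht]) D x hx (Ideal.span_mono (Set.image_mono (by simp)) hLx)
    rw [Finset.sum_insert huV] at hxc
    by_cases hD : D = 0
    · have hx0 := hF0 x (hD ▸ hx)
      exact ⟨0, fun t => zero_mem _, by simp [hx0]⟩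
    have hLc : L (c u) ∈ Ideal.span (m '' (V : Set τ)) := by
      refine hind.mem_span_of_mul_pow_mem hm hδ (U := V) (r := u) (N := 1) (by simpa using huV) ?_
      have h2 : L (c u) * m u ^ 1 = L x - ∑ t ∈ V, L (c t) * m t := by
        rw [hxc, map_add, map_sum, hL]
        simp only [hL]
        ring
      rw [h2]
      exact sub_mem hLx (sum_mem fun t ht =>
        Ideal.mul_mem_left _ _ (Ideal.subset_span ⟨t, by simpa using ht, rfl⟩))
    obtain ⟨c', hc', hcu⟩ := ihD (D - w u) (by have := hw u; omega) (c u) (hc u) hLc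
    refine ⟨fun t => φ u (c' t) + c t, fun t => add_mem ?_ (hc t), ?_⟩
    · by_cases hlt : D - w u - w t = 0
      · have h3 := hc' t
        rw [hlt] at h3
        rw [hF0 _ h3, map_zero]
        exact zero_mem _
      · have h3 := hφF u _ _ (hc' t)
        rwa [show D - w u - w t + w u = D - w t by omega] at h3
    · rw [hxc, hcu, map_sum, ← Finset.sum_add_distrib]
      refine Finset.sum_congr rfl fun t _ => ?_
      rw [map_add, hφ]

end LechGraded

section CoefficientOperators

variable {σ : Type} {K L : Type} [Field K] [Field L]

theorem exists_coordinates (φ : L →+* K) :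
    ∃ (J : Type) (c : J → K) (ρ : J → K →+ L), (∀ i a x, ρ i (φ a * x) = a * ρ i x) ∧
      ∀ x, ∃ t : Finset J, ∀ t', t ⊆ t' → x = ∑ i ∈ t', φ (ρ i x) * c i := by
  let := φ.toAlgebra
  let b := Module.Basis.ofVectorSpace L K
  refine ⟨_, b, fun i => (b.coord i).toAddMonoidHom, fun i a x => ?_, fun x => ?_⟩
  · have : φ a * x = a • x := (Algebra.smul_def a x).symm
    simp [this]
  · refine ⟨(b.repr x).support, fun t' ht' => ?_⟩
    conv_lhs => rw [← b.linearCombination_repr x, Finsupp.linearCombination_apply,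
      Finsupp.sum_of_support_subset _ ht' _ (by simp)]
    exact Finset.sum_congr rfl fun i _ => Algebra.smul_def _ _

theorem exists_retraction (φ : L →+* K) :
    ∃ ρ : K →+ L, (∀ a x, ρ (φ a * x) = a * ρ x) ∧ ρ 1 = 1 := by
  let := φ.toAlgebra
  obtain ⟨f, hf⟩ := (Algebra.linearMap L K).exists_leftInverse_of_injective
    (LinearMap.ker_eq_bot.2 φ.injective)
  refine ⟨f.toAddMonoidHom, fun a x => ?_, ?_⟩
  · have : φ a * x = a • x := (Algebra.smul_def a x).symm
    simp [this]
  · simpa using LinearMap.congr_fun hf 1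

/-- The polynomial obtained by selecting the coefficients in the image of `e` and applying `ρ`. -/
noncomputable def pickCoeff (e : (σ →₀ ℕ) → (σ →₀ ℕ)) (he : Function.Injective e) (ρ : K →+ L)
    (s : MvPolynomial σ K) : MvPolynomial σ L :=
  ∑ μ ∈ s.support.preimage e he.injOn, monomial μ (ρ (coeff (e μ) s))

theorem coeff_pickCoeff {e : (σ →₀ ℕ) → (σ →₀ ℕ)} (he : Function.Injective e) (ρ : K →+ L)
    (s : MvPolynomial σ K) (ν : σ →₀ ℕ) :
    coeff ν (pickCoeff e he ρ s) = ρ (coeff (e ν) s) := by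
  classical
  rw [pickCoeff, coeff_sum]
  simp only [coeff_monomial]
  rw [Finset.sum_ite_eq']
  split_ifs with h
  · rfl
  · have : coeff (e ν) s = 0 := by simpa using h
    rw [this, map_zero]

theorem pickCoeff_add {e : (σ →₀ ℕ) → (σ →₀ ℕ)} (he : Function.Injective e) (ρ : K →+ L)
    (s t : MvPolynomial σ K) :
    pickCoeff e he ρ (s + t) = pickCoeff e he ρ s + pickCoeff e he ρ t := by
  ext ν
  simp [coeff_pickCoeff]

theorem pickCoeff_sum {e : (σ →₀ ℕ) → (σ →₀ ℕ)} (he : Function.Injective e) (ρ : K →+ L)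
    {α : Type} (t : Finset α) (s : α → MvPolynomial σ K) :
    pickCoeff e he ρ (∑ i ∈ t, s i) = ∑ i ∈ t, pickCoeff e he ρ (s i) :=
  map_sum (AddMonoidHom.mk' (pickCoeff e he ρ) (pickCoeff_add he ρ)) s t

theorem pickCoeff_map_mul (φ : L →+* K) (ρ : K →+ L) (hρ : ∀ a x, ρ (φ a * x) = a * ρ x)
    (a : MvPolynomial σ L) (s : MvPolynomial σ K) :
    pickCoeff id Function.injective_id ρ (map φ a * s) =
      a * pickCoeff id Function.injective_id ρ s := by
  ext ν
  classical
  rw [coeff_pickCoeff, coeff_mul, coeff_mul, map_sum]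
  refine Finset.sum_congr rfl fun x _ => ?_
  rw [coeff_map, hρ, coeff_pickCoeff, id]

/-- Independence descends along extensions of the coefficient field. -/
theorem LInd.of_map {τ : Type} [Fintype τ] (φ : L →+* K) {m : τ → MvPolynomial σ L}
    (h : LInd fun t => map φ (m t)) : LInd m := by
  obtain ⟨ρ, hρ, hρ1⟩ := exists_retraction φ
  intro s hs t
  have h1 := h (fun t => map φ (s t)) (by
    have := congrArg (map φ) hs
    simpa using this) t
  obtain ⟨c, hc⟩ := Ideal.mem_span_range_iff_exists_fun.1 h1
  rw [Ideal.mem_span_range_iff_exists_fun]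
  refine ⟨fun u => pickCoeff id Function.injective_id ρ (c u), ?_⟩
  have h2 := congrArg (pickCoeff id Function.injective_id ρ) hc
  rw [pickCoeff_sum] at h2
  have h3 : pickCoeff id Function.injective_id ρ (map φ (s t)) = s t := by
    ext ν
    rw [coeff_pickCoeff, coeff_map, id]
    simpa [hρ1] using hρ (coeff ν (s t)) 1
  rw [h3] at h2
  rw [← h2]
  refine Finset.sum_congr rfl fun u _ => ?_
  rw [mul_comm (c u), pickCoeff_map_mul φ ρ hρ, mul_comm]

end CoefficientOperators

section Frobenius

variable {σ : Type} {p : ℕ} [Fact p.Prime]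

theorem smul_add_injective (α : σ →₀ ℕ) : Function.Injective fun ν : σ →₀ ℕ => p • ν + α := by
  intro ν ν' h
  have hp : p ≠ 0 := (Fact.out : p.Prime).ne_zero
  ext i
  have := DFunLike.congr_fun h i
  simpa [hp] using this

variable [CharP k p]

theorem pickCoeff_pow_mul (ρ : k →+ k) (hρ : ∀ a x, ρ (a ^ p * x) = a * ρ x) {α : σ →₀ ℕ}
    (hα : ∀ i, α i < p) (a s : MvPolynomial σ k) :
    pickCoeff _ (smul_add_injective (p := p) α) ρ (a ^ p * s) =
      a * pickCoeff _ (smul_add_injective (p := p) α) ρ s := by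
  induction a using MvPolynomial.induction_on' with
  | add a b ha hb => rw [add_pow_char, add_mul, pickCoeff_add, ha, hb, add_mul]
  | monomial μ c =>
    ext ν
    rw [coeff_pickCoeff, monomial_pow, coeff_monomial_mul', coeff_monomial_mul', coeff_pickCoeff]
    have hiff : p • μ ≤ p • ν + α ↔ μ ≤ ν := by
      refine ⟨fun h i => ?_, fun h i => ?_⟩
      · have h1 := h i
        have h2 := hα i
        simp only [Finsupp.smul_apply, smul_eq_mul, Finsupp.add_apply] at h1
        by_contra hlt
        have : p * (ν i + 1) ≤ p * μ i := Nat.mul_le_mul_left _ (by omega)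
        rw [Nat.mul_add] at this
        omega
      · simp only [Finsupp.smul_apply, smul_eq_mul, Finsupp.add_apply]
        exact (Nat.mul_le_mul_left _ (h i)).trans (Nat.le_add_right _ _)
    simp only [hiff]
    split_ifs with h
    · rw [hρ]
      congr 4
      ext i
      have := h i
      simp only [Finsupp.smul_apply, smul_eq_mul, Finsupp.add_apply, Finsupp.tsub_apply,
        Nat.mul_sub]
      have := Nat.mul_le_mul_left p this
      omega
    · exact map_zero _

theorem sum_monomial_pow_eq [DecidableEq σ] (ρ : k →+ k) (s : MvPolynomial σ k) :
    ∑ μ ∈ s.support, monomial μ (ρ (coeff μ s) ^ p) =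
      ∑ α ∈ s.support.image (fun μ => μ.mapRange (· % p) (Nat.zero_mod p)),
        monomial α 1 * pickCoeff _ (smul_add_injective (p := p) α) ρ s ^ p := by
  have hp : 0 < p := (Fact.out : p.Prime).pos
  set R : (σ →₀ ℕ) → (σ →₀ ℕ) := fun μ => μ.mapRange (· % p) (Nat.zero_mod p) with hR
  let Q : (σ →₀ ℕ) → (σ →₀ ℕ) := fun μ => μ.mapRange (· / p) (Nat.zero_div p)
  have hQR : ∀ μ, p • Q μ + R μ = μ := fun μ => by
    ext i
    simpa [Q, R] using Nat.div_add_mod (μ i) p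
  rw [← Finset.sum_fiberwise_of_maps_to (g := R)
    (fun μ hμ => Finset.mem_image_of_mem _ hμ)]
  refine Finset.sum_congr rfl fun α hα => ?_
  have hpick : pickCoeff _ (smul_add_injective (p := p) α) ρ s =
      ∑ μ ∈ s.support with R μ = α, monomial (Q μ) (ρ (coeff μ s)) := by
    ext ν
    rw [coeff_pickCoeff, coeff_sum]
    simp only [coeff_monomial]
    obtain ⟨μ₀, -, rfl⟩ := Finset.mem_image.1 hα
    rw [Finset.sum_eq_single (p • ν + R μ₀)]
    · rw [if_pos]
      ext i
      simp only [Q, R, Finsupp.mapRange_apply, Finsupp.add_apply, Finsupp.smul_apply, smul_eq_mul]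
      rw [Nat.mul_add_div hp, Nat.div_eq_of_lt (Nat.mod_lt _ hp), add_zero]
    · intro μ hμ hne
      rw [if_neg]
      rintro rfl
      exact hne (by rw [← (Finset.mem_filter.1 hμ).2, hQR])
    · intro hμ
      rw [Finset.mem_filter, not_and_or] at hμ
      rcases hμ with h | h
      · rw [notMem_support_iff.1 h]
        simp
      · refine absurd ?_ h
        ext i
        simp [R, Nat.add_mod]
  rw [hpick, sum_pow_char, Finset.mul_sum]
  refine Finset.sum_congr rfl fun μ hμ => ?_
  rw [monomial_pow, monomial_mul, one_mul, ← (Finset.mem_filter.1 hμ).2, add_comm, hQR]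

/-- The Frobenius endomorphism of a polynomial ring is flat, so it preserves independence. -/
theorem LInd.pow_char {τ : Type} [Fintype τ] {m : τ → MvPolynomial σ k}
    (h : LInd m) : LInd fun t => m t ^ p := by
  classical
  have hp : 0 < p := (Fact.out : p.Prime).pos
  have : ExpChar k p := .prime Fact.out
  obtain ⟨J, c, ρ, hρ, hsum⟩ := exists_coordinates (frobenius k p)
  simp only [frobenius_def] at hρ hsum
  intro s hs t
  have hfrob : ∀ x ∈ Ideal.span (Set.range m), x ^ p ∈ Ideal.span (Set.range fun t => m t ^ p) := by
    intro x hx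
    obtain ⟨b, rfl⟩ := Ideal.mem_span_range_iff_exists_fun.1 hx
    rw [sum_pow_char]
    exact sum_mem fun u _ => by
      rw [mul_pow]
      exact Ideal.mul_mem_left _ _ (Ideal.subset_span ⟨u, rfl⟩)
  have hpick : ∀ i (α : σ →₀ ℕ), (∀ j, α j < p) →
      pickCoeff _ (smul_add_injective (p := p) α) (ρ i) (s t) ∈ Ideal.span (Set.range m) := by
    intro i α hα
    refine h (fun t => pickCoeff _ (smul_add_injective (p := p) α) (ρ i) (s t)) ?_ t
    have h1 := congrArg (pickCoeff _ (smul_add_injective (p := p) α) (ρ i)) hs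
    rw [pickCoeff_sum] at h1
    have h2 : pickCoeff _ (smul_add_injective (p := p) α) (ρ i) (0 : MvPolynomial σ k) = 0 := by
      ext ν
      simp [coeff_pickCoeff]
    rw [h2] at h1
    rw [← h1]
    refine Finset.sum_congr rfl fun u _ => ?_
    rw [mul_comm (s u) (m u ^ p), pickCoeff_pow_mul (ρ i) (hρ i) hα, mul_comm]
  choose T hT using hsum
  let T₀ := (s t).support.biUnion fun μ => T (coeff μ (s t))
  have hdec : s t = ∑ i ∈ T₀, C (c i) *
      ∑ μ ∈ (s t).support, monomial μ (ρ i (coeff μ (s t)) ^ p) := by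
    simp only [Finset.mul_sum]
    rw [Finset.sum_comm]
    conv_lhs => rw [(s t).as_sum]
    refine Finset.sum_congr rfl fun μ hμ => ?_
    conv_lhs => rw [hT (coeff μ (s t)) T₀ (Finset.subset_biUnion_of_mem
      (fun μ => T (coeff μ (s t))) hμ), map_sum]
    refine Finset.sum_congr rfl fun i _ => ?_
    rw [C_mul_monomial, mul_comm]
  rw [hdec]
  refine sum_mem fun i _ => Ideal.mul_mem_left _ _ ?_
  rw [sum_monomial_pow_eq]
  refine sum_mem fun α hα => Ideal.mul_mem_left _ _ (hfrob _ (hpick i α ?_))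
  obtain ⟨μ, -, rfl⟩ := Finset.mem_image.1 hα
  exact fun j => by simpa using Nat.mod_lt _ hp

theorem LIndPow.of_lInd {τ : Type} [Fintype τ] {m : τ → MvPolynomial σ k}
    (p : ℕ) [Fact p.Prime] [CharP k p] (h : LInd m) : LIndPow m := by
  have hp : p.Prime := Fact.out
  have H : ∀ e : ℕ, LInd fun t => m t ^ p ^ e := by
    intro e
    induction e with
    | zero => simpa using h
    | succ e ih =>
      simp only [pow_succ p, pow_mul]
      exact ih.pow_char
  exact LIndPow.of_frequently fun N => ⟨p ^ N, (Nat.lt_pow_self hp.one_lt).le, H N⟩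

end Frobenius

section Operators

variable {σ : Type}

theorem IsHomog.mul {I J : Ideal (MvPolynomial σ k)} (hI : IsHomog I) (hJ : IsHomog J) :
    IsHomog (I * J) := by
  rw [hI.eq_span, hJ.eq_span, Ideal.span_mul_span']
  refine IsHomog.span ?_
  rintro _ ⟨x, ⟨-, d, hx⟩, y, ⟨-, e, hy⟩, rfl⟩
  exact ⟨d + e, hx.mul hy⟩

/-- A set of additive operators lowering degrees and satisfying a weak Leibniz rule. -/
structure IsOpSystem (Φ : Set (MvPolynomial σ k →+ MvPolynomial σ k)) : Prop where
  shift : ∀ φ ∈ Φ, ∃ m, 0 < m ∧ ∀ d s, s.IsHomogeneous d →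
    (φ s).IsHomogeneous (d - m) ∧ (d < m → φ s = 0)
  leibniz : ∀ φ ∈ Φ, ∀ a b, φ (a * b) - φ a * b ∈
    Ideal.span (insert a ((fun ψ => ψ a) '' Φ)) * Ideal.span ((fun ψ => ψ b) '' Φ)

theorem IsOpSystem.union {Φ Ψ : Set (MvPolynomial σ k →+ MvPolynomial σ k)} (hΦ : IsOpSystem Φ)
    (hΨ : IsOpSystem Ψ) : IsOpSystem (Φ ∪ Ψ) where
  shift := by
    rintro φ (h | h)
    · exact hΦ.shift φ h
    · exact hΨ.shift φ h
  leibniz := by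
    rintro φ (h | h) a b
    · refine Ideal.mul_mono (Ideal.span_mono (Set.insert_subset_insert (Set.image_mono ?_)))
        (Ideal.span_mono (Set.image_mono ?_)) (hΦ.leibniz φ h a b) <;> exact Set.subset_union_left
    · refine Ideal.mul_mono (Ideal.span_mono (Set.insert_subset_insert (Set.image_mono ?_)))
        (Ideal.span_mono (Set.image_mono ?_)) (hΨ.leibniz φ h a b) <;> exact Set.subset_union_right

theorem IsOpSystem.iUnion {α : Type} {Φ : α → Set (MvPolynomial σ k →+ MvPolynomial σ k)}
    (hΦ : ∀ i, IsOpSystem (Φ i)) : IsOpSystem (⋃ i, Φ i) where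
  shift := by
    intro φ h
    obtain ⟨i, hi⟩ := Set.mem_iUnion.1 h
    exact (hΦ i).shift φ hi
  leibniz := by
    intro φ h a b
    obtain ⟨i, hi⟩ := Set.mem_iUnion.1 h
    refine Ideal.mul_mono (Ideal.span_mono (Set.insert_subset_insert (Set.image_mono ?_)))
      (Ideal.span_mono (Set.image_mono ?_)) ((hΦ i).leibniz φ hi a b) <;>
    exact Set.subset_iUnion Φ i

/-- The largest proper homogeneous ideal stable under `Φ`. -/
noncomputable def opIdeal (Φ : Set (MvPolynomial σ k →+ MvPolynomial σ k)) :
    Ideal (MvPolynomial σ k) :=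
  sSup {I | IsHomog I ∧ I ≤ irrel σ k ∧ ∀ φ ∈ Φ, ∀ x ∈ I, φ x ∈ I}

variable {Φ : Set (MvPolynomial σ k →+ MvPolynomial σ k)}

theorem opIdeal_isHomog : IsHomog (opIdeal Φ) := IsHomog.sSup fun _ h => h.1

theorem opIdeal_le_irrel : opIdeal Φ ≤ irrel σ k := sSup_le fun _ h => h.2.1

theorem le_opIdeal {I : Ideal (MvPolynomial σ k)} (h : IsHomog I) (h1 : I ≠ ⊤)
    (h2 : ∀ φ ∈ Φ, ∀ x ∈ I, φ x ∈ I) : I ≤ opIdeal Φ :=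
  le_sSup ⟨h, h.le_irrel h1, h2⟩

theorem map_mem_opIdeal {φ : MvPolynomial σ k →+ MvPolynomial σ k} (hφ : φ ∈ Φ)
    {x : MvPolynomial σ k} (hx : x ∈ opIdeal Φ) : φ x ∈ opIdeal Φ := by
  rw [opIdeal, sSup_eq_iSup'] at hx
  refine Submodule.iSup_induction (fun I : {I : Ideal (MvPolynomial σ k) // IsHomog I ∧
      I ≤ irrel σ k ∧ ∀ φ ∈ Φ, ∀ x ∈ I, φ x ∈ I} => (I : Ideal (MvPolynomial σ k)))
    (motive := fun s => φ s ∈ opIdeal Φ) hx ?_ ?_ ?_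
  · exact fun I x hx => (le_sSup I.2 : (I : Ideal (MvPolynomial σ k)) ≤ _) (I.2.2.2 φ hφ x hx)
  · simp
  · intro x y hx hy
    rw [map_add]
    exact add_mem hx hy

theorem IsOpSystem.map_mem_sq (hΦ : IsOpSystem Φ) {φ : MvPolynomial σ k →+ MvPolynomial σ k}
    (hφ : φ ∈ Φ) {x : MvPolynomial σ k} (hx : x ∈ opIdeal Φ * opIdeal Φ) :
    φ x ∈ opIdeal Φ * opIdeal Φ := by
  refine Submodule.mul_induction_on hx (fun a ha b hb => ?_) (fun a b ha hb => ?_)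
  · have h1 := hΦ.leibniz φ hφ a b
    have h2 : φ (a * b) - φ a * b ∈ opIdeal Φ * opIdeal Φ := by
      refine Ideal.mul_mono (Ideal.span_le.2 ?_) (Ideal.span_le.2 ?_) h1
      · rintro _ (rfl | ⟨ψ, hψ, rfl⟩)
        · exact ha
        · exact map_mem_opIdeal hψ ha
      · rintro _ ⟨ψ, hψ, rfl⟩
        exact map_mem_opIdeal hψ hb
    have h3 := add_mem h2 (Ideal.mul_mem_mul (map_mem_opIdeal hφ ha) hb)
    rwa [sub_add_cancel] at h3
  · rw [map_add]
    exact add_mem ha hb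

theorem mem_span_image_coe_iff {S : Type} [CommRing S] {τ : Type} {m : τ → S} {T : Finset τ}
    {x : S} : x ∈ Ideal.span (m '' (T : Set τ)) ↔ ∃ c : τ → S, ∑ t ∈ T, c t * m t = x := by
  classical
  constructor
  · intro hx
    rw [Ideal.span, Submodule.mem_span_image_finset_iff_exists_fun] at hx
    obtain ⟨c, rfl⟩ := hx
    refine ⟨fun t => if h : t ∈ T then c ⟨t, h⟩ else 0, ?_⟩
    rw [← Finset.sum_coe_sort]
    simp
  · rintro ⟨c, rfl⟩
    exact sum_mem fun t ht => Ideal.mul_mem_left _ _ (Ideal.subset_span ⟨t, ht, rfl⟩)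

variable {τ : Type} [Fintype τ] {m : τ → MvPolynomial σ k} {δ : τ → ℕ}

theorem IsOpSystem.map_mem_span_of_lt (hΦ : IsOpSystem Φ) (hm : ∀ t, (m t).IsHomogeneous (δ t))
    (hspan : Ideal.span (Set.range m) = opIdeal Φ) {φ : MvPolynomial σ k →+ MvPolynomial σ k}
    (hφ : φ ∈ Φ) {x : MvPolynomial σ k} {d : ℕ} (hx : x ∈ opIdeal Φ) (hxd : x.IsHomogeneous d) :
    φ x ∈ Ideal.span (m '' {u | δ u < d}) := by
  obtain ⟨e, he, hshift⟩ := hΦ.shift φ hφ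
  obtain ⟨h1, h2⟩ := hshift d x hxd
  by_cases hd : d < e
  · rw [h2 hd]
    exact zero_mem _
  · have h3 := homogeneousComponent_mem_span_of_lt hm (hspan ▸ map_mem_opIdeal hφ hx) (d - e)
    rw [homogeneousComponent_eq_self ((mem_homogeneousSubmodule _ _).2 h1)] at h3
    refine Ideal.span_mono (Set.image_mono fun u hu => ?_) h3
    have hu : δ u ≤ d - e := hu
    show δ u < d
    omega

/-- An irredundant family of homogeneous generators of `opIdeal Φ` is independent. -/
theorem IsOpSystem.lInd (hΦ : IsOpSystem Φ) (hm : ∀ t, (m t).IsHomogeneous (δ t))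
    (hspan : Ideal.span (Set.range m) = opIdeal Φ)
    (hirr : ∀ t, m t ∉ Ideal.span (m '' {u | u ≠ t})) : LInd m := by
  classical
  set P := opIdeal Φ with hP
  have hmP : ∀ t, m t ∈ P := fun t => hspan ▸ Ideal.subset_span ⟨t, rfl⟩
  have hPP : IsHomog (P * P) := opIdeal_isHomog.mul opIdeal_isHomog
  suffices H : ∀ (N : ℕ) (T : Finset τ), T.card = N → (∀ t ∈ T, ∀ u, δ u < δ t → u ∈ T) →
      ∀ s : τ → MvPolynomial σ k, ∑ t ∈ T, s t * m t ∈ P * P → ∀ t ∈ T, s t ∈ P by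
    intro s hs t
    rw [hspan]
    exact H _ Finset.univ rfl (by simp) s (by rw [hs]; exact zero_mem _) t (Finset.mem_univ t)
  intro N
  induction N with
  | zero =>
    intro T hT _ s _ t ht
    rw [Finset.card_eq_zero.1 hT] at ht
    simp at ht
  | succ N ih =>
    intro T hT hdown s hs
    obtain ⟨t₀, ht₀, hmax⟩ := Finset.exists_max_image T δ (Finset.card_pos.1 (by omega))
    let J : Ideal (MvPolynomial σ k) :=
      { carrier := {x | ∃ s : τ → MvPolynomial σ k, s t₀ = x ∧ ∑ t ∈ T, s t * m t ∈ P * P}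
        zero_mem' := ⟨0, rfl, by simp⟩
        add_mem' := by
          rintro _ _ ⟨s, rfl, hs⟩ ⟨s', rfl, hs'⟩
          refine ⟨s + s', rfl, ?_⟩
          simp only [Pi.add_apply, add_mul, Finset.sum_add_distrib]
          exact add_mem hs hs'
        smul_mem' := by
          rintro c _ ⟨s, rfl, hs⟩
          refine ⟨c • s, rfl, ?_⟩
          simp only [Pi.smul_apply, smul_eq_mul, mul_assoc, ← Finset.mul_sum]
          exact Ideal.mul_mem_left _ _ hs }
    have hJP : J ≤ P := by
      refine le_opIdeal ?_ ?_ ?_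
      · rintro _ ⟨s, rfl, hs⟩ d
        refine ⟨fun t => homogeneousComponent (d + δ t₀ - δ t) (s t), by simp, ?_⟩
        have h1 := hPP _ hs (d + δ t₀)
        rw [map_sum] at h1
        convert h1 using 1
        refine Finset.sum_congr rfl fun t ht => ?_
        rw [homogeneousComponent_mul_of_isHomogeneous (hm t), if_pos]
        have := hmax t ht
        omega
      · intro htop
        obtain ⟨s, hs1, hs⟩ := (Ideal.eq_top_iff_one J).1 htop
        apply hirr t₀
        have hcomp : ∀ x ∈ P * P, homogeneousComponent (δ t₀) x ∈
            Ideal.span (m '' {u | u ≠ t₀}) := by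
          intro x hx
          have hx' : x ∈ P • Ideal.span (Set.range m) := by
            rw [hspan]; exact hx
          obtain ⟨a, ha, rfl⟩ := (Submodule.mem_ideal_smul_span_iff_exists_sum P _ x).1 hx'
          rw [Finsupp.sum, map_sum]
          refine sum_mem fun t _ => ?_
          rw [smul_eq_mul, homogeneousComponent_mul_of_isHomogeneous (hm t)]
          split_ifs with hle
          · by_cases ht : t = t₀
            · subst ht
              rw [Nat.sub_self, homogeneousComponent_zero, mem_irrel.1 (opIdeal_le_irrel (ha t))]
              simp
            · exact Ideal.mul_mem_left _ _ (Ideal.subset_span ⟨t, ht, rfl⟩)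
          · exact zero_mem _
        have h2 := hcomp _ hs
        rw [← Finset.add_sum_erase _ _ ht₀, hs1, one_mul, map_add,
          homogeneousComponent_eq_self ((mem_homogeneousSubmodule _ _).2 (hm t₀))] at h2
        refine (Ideal.add_mem_iff_left _ ?_).1 h2
        rw [map_sum]
        refine sum_mem fun t ht => ?_
        rw [homogeneousComponent_mul_of_isHomogeneous (hm t)]
        split_ifs
        · exact Ideal.mul_mem_left _ _ (Ideal.subset_span ⟨t, Finset.ne_of_mem_erase ht, rfl⟩)
        · exact zero_mem _
      · rintro φ hφ _ ⟨s, rfl, hs⟩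
        have hr : ∀ t ∈ T, φ (s t * m t) - φ (s t) * m t ∈
            Ideal.span (m '' (↑(T.erase t₀) : Set τ)) := by
          intro t ht
          suffices hle : Ideal.span ((fun ψ => ψ (m t)) '' Φ) ≤
              Ideal.span (m '' (↑(T.erase t₀) : Set τ)) from
            hle (Ideal.mul_le_right (hΦ.leibniz φ hφ (s t) (m t)))
          rw [Ideal.span_le]
          rintro _ ⟨ψ, hψ, rfl⟩
          refine Ideal.span_mono (Set.image_mono fun u hu => ?_)
            (hΦ.map_mem_span_of_lt hm hspan hψ (hmP t) (hm t))
          have hu : δ u < δ t := hu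
          have := hmax t ht
          simp only [Finset.coe_erase, Set.mem_sdiff, Finset.mem_coe, Set.mem_singleton_iff]
          exact ⟨hdown t ht u hu, by rintro rfl; omega⟩
        obtain ⟨c, hc⟩ := mem_span_image_coe_iff.1 (sum_mem hr)
        refine ⟨fun t => φ (s t) + if t = t₀ then 0 else c t, by simp, ?_⟩
        have h3 : ∑ t ∈ T, (φ (s t) + if t = t₀ then 0 else c t) * m t =
            φ (∑ t ∈ T, s t * m t) := by
          have h4 : ∑ t ∈ T.erase t₀, c t * m t =
              ∑ t ∈ T, (if t = t₀ then 0 else c t) * m t := by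
            rw [← Finset.add_sum_erase T _ ht₀, if_pos rfl, zero_mul, zero_add]
            refine Finset.sum_congr rfl fun t ht => ?_
            rw [if_neg (Finset.ne_of_mem_erase ht)]
          rw [h4, Finset.sum_sub_distrib] at hc
          simp only [add_mul, Finset.sum_add_distrib]
          rw [hc, map_sum]
          ring
        rw [h3]
        exact hΦ.map_mem_sq hφ hs
    have hst₀ : s t₀ ∈ P := hJP ⟨s, rfl, hs⟩
    intro t ht
    by_cases htt : t = t₀
    · exact htt ▸ hst₀
    · refine ih (T.erase t₀) (by rw [Finset.card_erase_of_mem ht₀, hT]; rfl) ?_ s ?_ t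
        (Finset.mem_erase.2 ⟨htt, ht⟩)
      · intro t ht u hu
        rw [Finset.mem_erase] at ht ⊢
        refine ⟨?_, hdown t ht.2 u hu⟩
        rintro rfl
        have := hmax t ht.2
        omega
      · rw [← Finset.add_sum_erase _ _ ht₀] at hs
        exact (Ideal.add_mem_iff_right _ (Ideal.mul_mem_mul hst₀ (hmP t₀))).1 hs

end Operators

section LinearActions

/-- Faithful actions on a polynomial ring by linear substitutions. -/
class LinAct (Γ σ k : Type) [Group Γ] [Field k] [MulSemiringAction Γ (MvPolynomial σ k)] :
    Prop where
  smul_C : ∀ (g : Γ) (c : k), g • (C c : MvPolynomial σ k) = C c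
  smul_isHomogeneous : ∀ (g : Γ) (d : ℕ) (s : MvPolynomial σ k), s.IsHomogeneous d →
    (g • s).IsHomogeneous d
  faithful : ∀ g : Γ, (∀ s : MvPolynomial σ k, g • s = s) → g = 1

variable {Γ σ : Type} [Group Γ] [MulSemiringAction Γ (MvPolynomial σ k)] [LinAct Γ σ k]

theorem smul_homogeneousComponent (g : Γ) (d : ℕ) (s : MvPolynomial σ k) :
    homogeneousComponent d (g • s) = g • homogeneousComponent d s := by
  classical
  conv_lhs => rw [← sum_homogeneousComponent s, Finset.smul_sum, map_sum]
  have h : ∀ i, homogeneousComponent d (g • homogeneousComponent i s) =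
      if i = d then g • homogeneousComponent i s else 0 := fun i => by
    rw [homogeneousComponent_of_mem ((mem_homogeneousSubmodule _ _).2
      (LinAct.smul_isHomogeneous g i _ (homogeneousComponent_isHomogeneous i s)))]
    simp only [eq_comm]
  simp only [h]
  rw [Finset.sum_ite_eq']
  split_ifs with hmem
  · rfl
  · rw [homogeneousComponent_eq_zero, smul_zero]
    simp only [Finset.mem_range] at hmem
    omega

theorem homogeneousComponent_mem_fixedRing {G : Subgroup Γ} {s : MvPolynomial σ k}
    (hs : s ∈ fixedRing G (MvPolynomial σ k)) (d : ℕ) :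
    homogeneousComponent d s ∈ fixedRing G (MvPolynomial σ k) := fun g hg => by
  rw [← smul_homogeneousComponent, hs g hg]

theorem C_mem_fixedRing (G : Subgroup Γ) (c : k) :
    (C c : MvPolynomial σ k) ∈ fixedRing G (MvPolynomial σ k) := fun g _ => LinAct.smul_C g c

theorem smul_C_mul (g : Γ) (c : k) (s : MvPolynomial σ k) : g • (C c * s) = C c * g • s := by
  rw [smul_mul', LinAct.smul_C]

end LinearActions

section DegreeZeroPart

variable {σ : Type}

theorem sum_range_homogeneousComponent (ψ : MvPolynomial σ k →+ MvPolynomial σ k)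
    (s : MvPolynomial σ k) {N : ℕ} (hN : s.totalDegree < N) :
    ∑ d ∈ Finset.range (s.totalDegree + 1), homogeneousComponent d (ψ (homogeneousComponent d s)) =
      ∑ d ∈ Finset.range N, homogeneousComponent d (ψ (homogeneousComponent d s)) := by
  refine Finset.sum_subset (Finset.range_subset_range.2 hN) fun d _ hd => ?_
  rw [Finset.mem_range] at hd
  rw [homogeneousComponent_eq_zero d s (by omega), map_zero, map_zero]

/-- The part of degree zero of an additive endomorphism. -/
noncomputable def degZero (ψ : MvPolynomial σ k →+ MvPolynomial σ k) :
    MvPolynomial σ k →+ MvPolynomial σ k :=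
  AddMonoidHom.mk' (fun s => ∑ d ∈ Finset.range (s.totalDegree + 1),
    homogeneousComponent d (ψ (homogeneousComponent d s))) fun s t => by
    have hs : s.totalDegree < s.totalDegree + t.totalDegree + (s + t).totalDegree + 1 := by omega
    have ht : t.totalDegree < s.totalDegree + t.totalDegree + (s + t).totalDegree + 1 := by omega
    have hst : (s + t).totalDegree < s.totalDegree + t.totalDegree + (s + t).totalDegree + 1 := by
      omega
    rw [sum_range_homogeneousComponent ψ s hs, sum_range_homogeneousComponent ψ t ht,
      sum_range_homogeneousComponent ψ _ hst, ← Finset.sum_add_distrib]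
    simp only [map_add]

theorem degZero_of_isHomogeneous (ψ : MvPolynomial σ k →+ MvPolynomial σ k)
    {s : MvPolynomial σ k} {d : ℕ} (hs : s.IsHomogeneous d) :
    degZero ψ s = homogeneousComponent d (ψ s) := by
  classical
  change ∑ e ∈ Finset.range (s.totalDegree + 1), _ = _
  rw [sum_range_homogeneousComponent ψ s (N := s.totalDegree + d + 1) (by omega),
    Finset.sum_eq_single d]
  · rw [homogeneousComponent_eq_self ((mem_homogeneousSubmodule _ _).2 hs)]
  · intro e _ he
    rw [homogeneousComponent_of_mem ((mem_homogeneousSubmodule _ _).2 hs), if_neg he,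
      map_zero, map_zero]
  · intro h
    simp at h

theorem degZero_isHomogeneous (ψ : MvPolynomial σ k →+ MvPolynomial σ k)
    {s : MvPolynomial σ k} {d : ℕ} (hs : s.IsHomogeneous d) : (degZero ψ s).IsHomogeneous d := by
  rw [degZero_of_isHomogeneous ψ hs]
  exact homogeneousComponent_isHomogeneous _ _

variable {Γ : Type} [Group Γ] [MulSemiringAction Γ (MvPolynomial σ k)] [LinAct Γ σ k]

theorem IsInvLin.degZero {G : Subgroup Γ} {ψ : MvPolynomial σ k →+ MvPolynomial σ k}
    (hψ : IsInvLin G ψ) : IsInvLin G (degZero ψ) where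
  mem s := by
    change ∑ d ∈ Finset.range (s.totalDegree + 1),
      homogeneousComponent d (ψ (homogeneousComponent d s)) ∈ _
    exact sum_mem fun d _ => homogeneousComponent_mem_fixedRing (hψ.mem _) d
  map_mul a ha s := by
    rw [← sum_homogeneousComponent a, Finset.sum_mul, Finset.sum_mul, map_sum]
    refine Finset.sum_congr rfl fun i _ => ?_
    rw [← sum_homogeneousComponent s, Finset.mul_sum, map_sum, map_sum, Finset.mul_sum]
    refine Finset.sum_congr rfl fun j _ => ?_
    have hi := homogeneousComponent_isHomogeneous i a
    have hj := homogeneousComponent_isHomogeneous j s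
    rw [degZero_of_isHomogeneous ψ (hi.mul hj), degZero_of_isHomogeneous ψ hj,
      hψ.map_mul _ (homogeneousComponent_mem_fixedRing ha i), mul_comm,
      homogeneousComponent_mul_of_isHomogeneous hi, if_pos (Nat.le_add_right _ _),
      Nat.add_sub_cancel_left, mul_comm]

variable (σ k) in
/-- The splitting property for the invariants of `G`. -/
def HasSplitting (G : Subgroup Γ) : Prop :=
  ∃ π : MvPolynomial σ k →+ MvPolynomial σ k, IsInvLin G π ∧ π 1 = 1

end DegreeZeroPart

section Taylor

variable {σ κ : Type}

/-- The Taylor expansion `s ↦ s(x + L(y))` along a family `L` of linear forms in `y`. -/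
noncomputable def taylor (L : σ → MvPolynomial κ k) :
    MvPolynomial σ k →ₐ[k] MvPolynomial κ (MvPolynomial σ k) :=
  aeval fun i => C (X i) + MvPolynomial.map C (L i)

/-- The coefficients of the Taylor expansion. -/
noncomputable def hasse (L : σ → MvPolynomial κ k) (α : κ →₀ ℕ) :
    MvPolynomial σ k →+ MvPolynomial σ k where
  toFun s := coeff α (taylor L s)
  map_zero' := by simp
  map_add' s t := by simp

theorem hasse_apply (L : σ → MvPolynomial κ k) (α : κ →₀ ℕ) (s : MvPolynomial σ k) :
    hasse L α s = coeff α (taylor L s) := rfl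

theorem taylor_X (L : σ → MvPolynomial κ k) (i : σ) :
    taylor L (X i) = C (X i) + MvPolynomial.map C (L i) := aeval_X _ _

theorem taylor_C (L : σ → MvPolynomial κ k) (c : k) : taylor L (C c) = C (C c) :=
  (taylor L).commutes c

theorem exists_sum_X_of_isHomogeneous_one {s : MvPolynomial σ k} (hs : s.IsHomogeneous 1) :
    s ∈ Submodule.span k (Set.range (X : σ → MvPolynomial σ k)) := by
  rw [s.as_sum]
  refine sum_mem fun α hα => ?_
  have h1 : α.degree = 1 := by
    rw [Finsupp.degree_eq_weight_one]; exact hs (mem_support_iff.1 hα)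
  obtain ⟨i, rfl⟩ : ∃ i, α = Finsupp.single i 1 := by
    obtain ⟨i, hi⟩ := (Finsupp.sum_eq_one_iff α).1 (by rw [← h1, Finsupp.degree_apply]; rfl)
    exact ⟨i, hi⟩
  rw [show (monomial (Finsupp.single i 1) (coeff (Finsupp.single i 1) s) : MvPolynomial σ k) =
    (coeff (Finsupp.single i 1) s) • X i by rw [X, smul_monomial, smul_eq_mul, mul_one]]
  exact Submodule.smul_mem _ _ (Submodule.subset_span ⟨i, rfl⟩)

theorem isHomogeneous_one_induction {p : MvPolynomial σ k → Prop} (hX : ∀ i, p (X i)) (h0 : p 0)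
    (hadd : ∀ a b, p a → p b → p (a + b)) (hsmul : ∀ (c : k) a, p a → p (C c * a))
    {s : MvPolynomial σ k} (hs : s.IsHomogeneous 1) : p s := by
  have hs' := exists_sum_X_of_isHomogeneous_one hs
  clear hs
  induction hs' using Submodule.span_induction with
  | mem x hx => obtain ⟨i, rfl⟩ := hx; exact hX i
  | zero => exact h0
  | add a b _ _ ha hb => exact hadd a b ha hb
  | smul c a _ ha => rw [smul_eq_C_mul]; exact hsmul c a ha

theorem taylor_of_isHomogeneous_one (L : σ → MvPolynomial κ k) {s : MvPolynomial σ k}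
    (hs : s.IsHomogeneous 1) : taylor L s = C s + MvPolynomial.map C (aeval L s) := by
  refine isHomogeneous_one_induction (p := fun s => taylor L s = C s + MvPolynomial.map C (aeval L s))
    (fun i => ?_) (by simp) (fun a b ha hb => ?_) (fun c a ha => ?_) hs
  · rw [taylor_X, aeval_X]
  · simp only [map_add, ha, hb]; ring
  · rw [map_mul, taylor_C, ha, map_mul, map_mul, map_mul, algHom_C, algebraMap_eq, map_C]; ring

theorem map_constantCoeff_taylor (L : σ → MvPolynomial κ k) (s : MvPolynomial σ k) :
    MvPolynomial.map constantCoeff (taylor L s) = aeval L s := by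
  have h : (MvPolynomial.map constantCoeff).comp (taylor L).toRingHom =
      (aeval L).toRingHom := by
    refine ringHom_ext (fun c => ?_) fun i => ?_
    · simp [taylor_C]
    · have h2 : (constantCoeff : MvPolynomial σ k →+* k).comp C = RingHom.id k := by
        ext; simp
      simp [taylor_X, MvPolynomial.map_map, h2, MvPolynomial.map_id]
  exact DFunLike.congr_fun h s

theorem constantCoeff_hasse (L : σ → MvPolynomial κ k) (α : κ →₀ ℕ) (s : MvPolynomial σ k) :
    constantCoeff (hasse L α s) = coeff α (aeval L s) := by
  rw [← map_constantCoeff_taylor, coeff_map]; rfl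

theorem hasse_zero {L : σ → MvPolynomial κ k} (hL : ∀ i, (L i).IsHomogeneous 1)
    (s : MvPolynomial σ k) : hasse L 0 s = s := by
  have h : (constantCoeff).comp (taylor L).toRingHom = RingHom.id _ := by
    refine ringHom_ext (fun c => ?_) fun i => ?_
    · simp [taylor_C]
    · have : coeff 0 (L i) = 0 := (hL i).coeff_eq_zero (by simp)
      simp [taylor_X, constantCoeff_eq, coeff_map, this]
  exact DFunLike.congr_fun h s

theorem hasse_mul [DecidableEq κ] (L : σ → MvPolynomial κ k) (α : κ →₀ ℕ) (a b : MvPolynomial σ k) :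
    hasse L α (a * b) =
      ∑ x ∈ Finset.HasAntidiagonal.antidiagonal α, hasse L x.1 a * hasse L x.2 b := by
  simp only [hasse_apply, map_mul, coeff_mul]

/-- Total homogeneity of degree `d` in both sets of variables. -/
def IsBihomogeneous (P : MvPolynomial κ (MvPolynomial σ k)) (d : ℕ) : Prop :=
  ∀ α, (coeff α P).IsHomogeneous (d - α.degree) ∧ (d < α.degree → coeff α P = 0)

theorem IsBihomogeneous.add {P Q : MvPolynomial κ (MvPolynomial σ k)} {d : ℕ}
    (hP : IsBihomogeneous P d) (hQ : IsBihomogeneous Q d) : IsBihomogeneous (P + Q) d :=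
  fun α => ⟨by rw [coeff_add]; exact (hP α).1.add (hQ α).1, fun h => by
    rw [coeff_add, (hP α).2 h, (hQ α).2 h, add_zero]⟩

theorem IsBihomogeneous.mul {P Q : MvPolynomial κ (MvPolynomial σ k)} {d e : ℕ}
    (hP : IsBihomogeneous P d) (hQ : IsBihomogeneous Q e) : IsBihomogeneous (P * Q) (d + e) := by
  classical
  have key : ∀ α β : κ →₀ ℕ, (coeff α P * coeff β Q).IsHomogeneous (d + e - (α + β).degree) ∧
      (d + e < (α + β).degree → coeff α P * coeff β Q = 0) := by
    intro α β
    rw [map_add]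
    by_cases h1 : d < α.degree
    · rw [(hP α).2 h1, zero_mul]; exact ⟨isHomogeneous_zero _ _ _, fun _ => rfl⟩
    by_cases h2 : e < β.degree
    · rw [(hQ β).2 h2, mul_zero]; exact ⟨isHomogeneous_zero _ _ _, fun _ => rfl⟩
    refine ⟨?_, fun h => by omega⟩
    rw [show d + e - (α.degree + β.degree) = (d - α.degree) + (e - β.degree) by omega]
    exact (hP α).1.mul (hQ β).1
  refine fun α => ⟨?_, fun h => ?_⟩
  · rw [coeff_mul]
    refine IsHomogeneous.sum _ _ _ fun x hx => ?_
    rw [← Finset.HasAntidiagonal.mem_antidiagonal.1 hx]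
    exact (key _ _).1
  · rw [coeff_mul]
    refine Finset.sum_eq_zero fun x hx => (key _ _).2 ?_
    rw [Finset.HasAntidiagonal.mem_antidiagonal.1 hx]
    exact h

theorem isBihomogeneous_C {s : MvPolynomial σ k} {d : ℕ} (hs : s.IsHomogeneous d) :
    IsBihomogeneous (C s : MvPolynomial κ (MvPolynomial σ k)) d := by
  classical
  intro α
  rw [coeff_C]
  split_ifs with h
  · subst h
    exact ⟨by simpa using hs, fun h => by simp at h⟩
  · exact ⟨isHomogeneous_zero _ _ _, fun _ => rfl⟩

theorem isBihomogeneous_map_C {q : MvPolynomial κ k} {d : ℕ} (hq : q.IsHomogeneous d) :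
    IsBihomogeneous (MvPolynomial.map C q : MvPolynomial κ (MvPolynomial σ k)) d := by
  intro α
  rw [coeff_map]
  by_cases h : α.degree = d
  · rw [h, Nat.sub_self]
    exact ⟨isHomogeneous_C _ _, fun h => absurd h (lt_irrefl _)⟩
  · rw [hq.coeff_eq_zero h, C_0]
    exact ⟨isHomogeneous_zero _ _ _, fun _ => rfl⟩

theorem isBihomogeneous_taylor {L : σ → MvPolynomial κ k} (hL : ∀ i, (L i).IsHomogeneous 1)
    {s : MvPolynomial σ k} {d : ℕ} (hs : s.IsHomogeneous d) :
    IsBihomogeneous (taylor L s) d := by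
  classical
  have hsum : ∀ (T : Finset (σ →₀ ℕ)) (F : (σ →₀ ℕ) → MvPolynomial κ (MvPolynomial σ k)),
      (∀ α ∈ T, IsBihomogeneous (F α) d) → IsBihomogeneous (∑ α ∈ T, F α) d := by
    intro T F
    induction T using Finset.induction_on with
    | empty => intro _ α; simpa using isHomogeneous_zero _ _ _
    | insert a T ha ih =>
      intro h
      rw [Finset.sum_insert ha]
      exact (h a (by simp)).add (ih fun α hα => h α (by simp [hα]))
  have hmon : ∀ α : σ →₀ ℕ, IsBihomogeneous (taylor L (monomial α (1 : k))) α.degree := by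
    intro α
    induction α using Finsupp.induction with
    | zero =>
      rw [show (monomial 0 (1 : k) : MvPolynomial σ k) = 1 from rfl, map_one, map_zero, ← C_1]
      exact isBihomogeneous_C (isHomogeneous_one _ _)
    | single_add i n α _ _ ih =>
      rw [show (monomial (Finsupp.single i n + α) (1 : k) : MvPolynomial σ k) =
        X i ^ n * monomial α 1 by rw [X_pow_eq_monomial, monomial_mul, one_mul],
        map_mul, map_pow, map_add, Finsupp.degree_single]
      refine IsBihomogeneous.mul ?_ ih
      clear ih
      clear * - hL
      induction n with
      | zero => rw [pow_zero, ← C_1]; exact isBihomogeneous_C (isHomogeneous_one _ _)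
      | succ n ih =>
        rw [pow_succ]
        refine ih.mul ?_
        rw [taylor_X]
        exact (isBihomogeneous_C (isHomogeneous_X _ _)).add (isBihomogeneous_map_C (hL i))
  rw [s.as_sum, map_sum]
  refine hsum _ _ fun α hα => ?_
  have h1 : α.degree = d := by
    rw [Finsupp.degree_eq_weight_one]; exact hs (mem_support_iff.1 hα)
  rw [show monomial α (coeff α s) = C (coeff α s) * monomial α 1 by
    rw [C_mul_monomial, mul_one], map_mul, taylor_C, ← h1, ← zero_add (α.degree)]
  exact (isBihomogeneous_C (isHomogeneous_C _ _)).mul (hmon α)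

theorem isOpSystem_hasse {L : σ → MvPolynomial κ k} (hL : ∀ i, (L i).IsHomogeneous 1) :
    IsOpSystem (hasse L '' {α | α ≠ 0}) where
  shift := by
    rintro _ ⟨α, hα, rfl⟩
    refine ⟨α.degree, Nat.pos_of_ne_zero fun h => hα ((Finsupp.degree_eq_zero_iff α).1 h),
      fun d s hs => isBihomogeneous_taylor hL hs α⟩
  leibniz := by
    classical
    rintro _ ⟨α, hα, rfl⟩ a b
    have hmem : (α, 0) ∈ Finset.HasAntidiagonal.antidiagonal α := by simp
    rw [hasse_mul, ← Finset.add_sum_erase _ _ hmem]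
    simp only [hasse_zero hL, add_sub_cancel_left]
    refine sum_mem fun x hx => Ideal.mul_mem_mul (Ideal.subset_span ?_) (Ideal.subset_span ?_)
    · by_cases h : x.1 = 0
      · rw [h, hasse_zero hL]; exact Set.mem_insert _ _
      · exact Set.mem_insert_of_mem _ ⟨_, ⟨x.1, h, rfl⟩, rfl⟩
    · refine ⟨_, ⟨x.2, fun h => ?_, rfl⟩, rfl⟩
      have h1 := Finset.HasAntidiagonal.mem_antidiagonal.1 (Finset.mem_of_mem_erase hx)
      refine Finset.ne_of_mem_erase hx (Prod.ext ?_ h)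
      rw [← h1, h, add_zero]

theorem aeval_hasse_eq_zero (L : σ → MvPolynomial κ k) {s : MvPolynomial σ k}
    (hL : ∀ i, (L i).IsHomogeneous 1) (hs : aeval L s = 0) (α : κ →₀ ℕ) :
    aeval L (hasse L α s) = 0 := by
  have h : (MvPolynomial.map (aeval L).toRingHom).comp
      (taylor L).toRingHom =
      (taylor (X : κ → MvPolynomial κ k)).toRingHom.comp
        (aeval L).toRingHom := by
    refine ringHom_ext (fun c => ?_) fun i => ?_
    · simp [taylor_C, algebraMap_eq]
    · have h2 : ((aeval L : MvPolynomial σ k →ₐ[k] MvPolynomial κ k) :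
          MvPolynomial σ k →+* MvPolynomial κ k).comp C = C := by
        ext c : 1; simp [algebraMap_eq]
      simp only [RingHom.comp_apply, AlgHom.toRingHom_eq_coe, RingHom.coe_coe, taylor_X, aeval_X, map_add, MvPolynomial.map_map, h2,
        map_C]
      rw [taylor_of_isHomogeneous_one _ (hL i), aeval_X_left_apply]
  have h3 := DFunLike.congr_fun h s
  simp only [RingHom.comp_apply, AlgHom.toRingHom_eq_coe, RingHom.coe_coe, hs, map_zero] at h3
  have h4 := congrArg (coeff α) h3
  rwa [coeff_map, coeff_zero] at h4

theorem eval₂_taylor_neg (L : σ → MvPolynomial κ k) (s : MvPolynomial σ k) :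
    eval₂Hom (taylor L).toRingHom X
      (taylor (-L) s) = C s := by
  have h : (eval₂Hom (taylor L).toRingHom X).comp
      (taylor (-L)).toRingHom = C := by
    refine ringHom_ext (fun c => ?_) fun i => ?_
    · simp [taylor_C]
    · have h3 : ∀ q : MvPolynomial κ k, eval₂ (taylor L).toRingHom X
          (MvPolynomial.map C q) = (MvPolynomial.map C q : MvPolynomial κ (MvPolynomial σ k)) := by
        intro q
        induction q using MvPolynomial.induction_on with
        | C a => simp [taylor_C]
        | add p q hp hq => rw [map_add, eval₂_add, hp, hq]
        | mul_X p i hp => rw [map_mul, eval₂_mul, hp, map_X, eval₂_X]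
      simp only [RingHom.comp_apply, AlgHom.toRingHom_eq_coe, RingHom.coe_coe, taylor_X, map_add,
        coe_eval₂Hom, eval₂_C, Pi.neg_apply, map_neg] at h3 ⊢
      rw [h3]
      ring
  exact DFunLike.congr_fun h s

variable {Γ : Type} [Group Γ] [MulSemiringAction Γ (MvPolynomial σ k)] [LinAct Γ σ k]

theorem map_smul_taylor {L : σ → MvPolynomial κ k} {g : Γ}
    (hg : ∀ s : MvPolynomial σ k, aeval L (g • s) = aeval L s) (s : MvPolynomial σ k) :
    MvPolynomial.map (MulSemiringAction.toRingHom Γ (MvPolynomial σ k) g) (taylor L s) =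
      taylor L (g • s) := by
  have h : (MvPolynomial.map (MulSemiringAction.toRingHom Γ (MvPolynomial σ k) g)).comp
      (taylor L).toRingHom =
      (taylor L).toRingHom.comp
        (MulSemiringAction.toRingHom Γ (MvPolynomial σ k) g) := by
    refine ringHom_ext (fun c => ?_) fun i => ?_
    · simp [taylor_C, LinAct.smul_C]
    · have h2 : (MulSemiringAction.toRingHom Γ (MvPolynomial σ k) g).comp C = C := by
        ext c : 1; simp [LinAct.smul_C]
      simp only [RingHom.comp_apply, AlgHom.toRingHom_eq_coe, RingHom.coe_coe, taylor_X, map_add, map_C, MvPolynomial.map_map, h2,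
        MulSemiringAction.toRingHom_apply]
      rw [taylor_of_isHomogeneous_one _ (LinAct.smul_isHomogeneous g 1 _ (isHomogeneous_X _ _)),
        hg, aeval_X]
  exact DFunLike.congr_fun h s

theorem hasse_smul {L : σ → MvPolynomial κ k} {g : Γ}
    (hg : ∀ s : MvPolynomial σ k, aeval L (g • s) = aeval L s) (α : κ →₀ ℕ)
    (s : MvPolynomial σ k) : hasse L α (g • s) = g • hasse L α s := by
  rw [hasse_apply, ← map_smul_taylor hg, coeff_map]; rfl

theorem hasse_mem_fixedRing {L : σ → MvPolynomial κ k} {G : Subgroup Γ}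
    (hG : ∀ g ∈ G, ∀ s : MvPolynomial σ k, aeval L (g • s) = aeval L s) (α : κ →₀ ℕ)
    {s : MvPolynomial σ k} (hs : s ∈ fixedRing G (MvPolynomial σ k)) :
    hasse L α s ∈ fixedRing G (MvPolynomial σ k) := fun g hg => by
  rw [← hasse_smul (hG g hg), hs g hg]

end Taylor

section Inertia

variable {σ κ : Type}

/-- Application of an additive map to the coefficients. -/
noncomputable def mapCoeffs (φ : MvPolynomial σ k →+ MvPolynomial σ k)
    (P : MvPolynomial κ (MvPolynomial σ k)) : MvPolynomial κ (MvPolynomial σ k) :=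
  ∑ α ∈ P.support, monomial α (φ (coeff α P))

theorem coeff_mapCoeffs (φ : MvPolynomial σ k →+ MvPolynomial σ k)
    (P : MvPolynomial κ (MvPolynomial σ k)) (α : κ →₀ ℕ) :
    coeff α (mapCoeffs φ P) = φ (coeff α P) := by
  classical
  simp only [mapCoeffs, coeff_sum, coeff_monomial, Finset.sum_ite_eq']
  split_ifs with h
  · rfl
  · rw [notMem_support_iff.1 h, map_zero]

theorem mapCoeffs_add (φ : MvPolynomial σ k →+ MvPolynomial σ k)
    (P Q : MvPolynomial κ (MvPolynomial σ k)) :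
    mapCoeffs φ (P + Q) = mapCoeffs φ P + mapCoeffs φ Q := by
  ext1 α
  simp only [coeff_add, coeff_mapCoeffs, map_add]

theorem mapCoeffs_one (φ : MvPolynomial σ k →+ MvPolynomial σ k) :
    mapCoeffs φ (1 : MvPolynomial κ (MvPolynomial σ k)) = C (φ 1) := by
  classical
  ext1 α
  rw [coeff_mapCoeffs, coeff_one, coeff_C]
  split_ifs <;> simp

variable {Γ : Type} [Group Γ] [MulSemiringAction Γ (MvPolynomial σ k)] [LinAct Γ σ k]

theorem HasSplitting.of_isInvLin {L : σ → MvPolynomial κ k} (hL : ∀ i, (L i).IsHomogeneous 1)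
    {I : Subgroup Γ} (hI : ∀ g ∈ I, ∀ s : MvPolynomial σ k, aeval L (g • s) = aeval L s)
    {φ : MvPolynomial σ k →+ MvPolynomial σ k} (hφ : IsInvLin I φ) (h1 : aeval L (φ 1) ≠ 0) :
    HasSplitting k σ I := by
  classical
  obtain ⟨α, hα⟩ := exists_coeff_ne_zero h1
  rw [← constantCoeff_hasse] at hα
  have hI' : ∀ g ∈ I, ∀ s : MvPolynomial σ k, aeval (-L) (g • s) = aeval (-L) s := by
    have hneg : ∀ s : MvPolynomial σ k,
        aeval (-L) s = aeval (fun j => -(X j : MvPolynomial κ k)) (aeval L s) := by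
      have h : aeval (-L) = (aeval fun j => -(X j : MvPolynomial κ k)).comp (aeval L) := by
        ext1 i
        simp only [AlgHom.comp_apply, aeval_X, Pi.neg_apply]
        refine (isHomogeneous_one_induction (p := fun q => aeval
          (fun j => -(X j : MvPolynomial κ k)) q = -q) (fun i => aeval_X _ _) (by simp)
          (fun a b ha hb => ?_) (fun c a ha => ?_) (hL i)).symm
        · rw [map_add, ha, hb]; ring
        · rw [map_mul, ha, algHom_C, algebraMap_eq]; ring
      exact DFunLike.congr_fun h
    intro g hg s
    rw [hneg, hneg, hI g hg]
  let N := eval₂Hom (taylor L).toRingHom (X : κ → MvPolynomial κ (MvPolynomial σ k))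
  let ψ : MvPolynomial σ k →+ MvPolynomial σ k := AddMonoidHom.mk'
    (fun s => coeff α (N (mapCoeffs φ (taylor (-L) s))))
    fun s t => by rw [map_add, mapCoeffs_add, map_add, coeff_add]
  have hψ : IsInvLin I ψ := by
    refine ⟨fun s g hg => ?_, fun a ha s => ?_⟩
    · change (MulSemiringAction.toRingHom Γ _ g) (coeff α _) = coeff α _
      rw [← coeff_map]
      congr 1
      have hN : (MvPolynomial.map (MulSemiringAction.toRingHom Γ (MvPolynomial σ k) g)).comp N =
          N.comp (MvPolynomial.map (MulSemiringAction.toRingHom Γ (MvPolynomial σ k) g)) := by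
        refine ringHom_ext (fun s => ?_) fun i => ?_
        · simp only [N, RingHom.comp_apply, coe_eval₂Hom, eval₂_C, map_C]
          exact map_smul_taylor (hI g hg) s
        · simp [N]
      rw [← RingHom.comp_apply, hN, RingHom.comp_apply]
      congr 1
      ext1 β
      rw [coeff_map, coeff_mapCoeffs]
      exact hφ.mem _ g hg
    · have h2 : mapCoeffs φ (taylor (-L) (a * s)) =
          taylor (-L) a * mapCoeffs φ (taylor (-L) s) := by
        ext1 β
        rw [coeff_mapCoeffs, map_mul, coeff_mul, coeff_mul, map_sum]
        refine Finset.sum_congr rfl fun x _ => ?_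
        rw [coeff_mapCoeffs]
        exact hφ.map_mul _ (hasse_mem_fixedRing hI' x.1 ha) _
      change coeff α (N (mapCoeffs φ (taylor (-L) (a * s)))) = a * coeff α _
      rw [h2, map_mul, show N (taylor (-L) a) = C a from eval₂_taylor_neg L a, coeff_C_mul]
  have hψ1 : ψ 1 = hasse L α (φ 1) := by
    change coeff α (N (mapCoeffs φ (taylor (-L) 1))) = _
    rw [map_one, mapCoeffs_one]
    simp [N, hasse_apply]
  set c := constantCoeff (hasse L α (φ 1)) with hc
  have hd : degZero ψ 1 = C c := by
    rw [degZero_of_isHomogeneous ψ (isHomogeneous_one _ _), homogeneousComponent_zero, hψ1, hc,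
      constantCoeff_eq]
  refine ⟨(AddMonoidHom.mulLeft (C c⁻¹)).comp (degZero ψ), ⟨fun s => ?_, fun a ha s => ?_⟩, ?_⟩
  · exact mul_mem (C_mem_fixedRing I _) (hψ.degZero.mem s)
  · simp only [AddMonoidHom.comp_apply, AddMonoidHom.coe_mulLeft, hψ.degZero.map_mul a ha]
    ring
  · simp only [AddMonoidHom.comp_apply, AddMonoidHom.coe_mulLeft, hd]
    rw [← C_mul, inv_mul_cancel₀ hα, C_1]

theorem sub_mem_of_X {R : Type} [CommRing R] (q : Ideal R) {f₁ f₂ : MvPolynomial σ k →+* R}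
    (hC : ∀ c, f₁ (C c) = f₂ (C c)) (hX : ∀ i, f₁ (X i) - f₂ (X i) ∈ q) (s : MvPolynomial σ k) :
    f₁ s - f₂ s ∈ q := by
  have h : (Ideal.Quotient.mk q).comp f₁ = (Ideal.Quotient.mk q).comp f₂ :=
    ringHom_ext (fun c => by simp [hC]) fun i => by
      simpa using Ideal.Quotient.eq.2 (hX i)
  exact Ideal.Quotient.eq.1 (DFunLike.congr_fun h s)

theorem exists_linear_quotient (U : Submodule k (MvPolynomial σ k))
    (hU : ∀ u ∈ U, u.IsHomogeneous 1) :
    ∃ (κ : Type) (L : σ → MvPolynomial κ k), (∀ i, (L i).IsHomogeneous 1) ∧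
      (∀ x, x.IsHomogeneous 1 → aeval L x = 0 → x ∈ U) ∧
      RingHom.ker (aeval L : MvPolynomial σ k →ₐ[k] MvPolynomial κ k) =
        Ideal.span (U : Set (MvPolynomial σ k)) := by
  let b := Module.Basis.ofVectorSpace k (MvPolynomial σ k ⧸ U)
  let κ := Module.Basis.ofVectorSpaceIndex k (MvPolynomial σ k ⧸ U)
  let F : (MvPolynomial σ k ⧸ U) →ₗ[k] MvPolynomial κ k :=
    b.constr k (fun j => (X j : MvPolynomial κ k))
  choose y hy using fun j => U.mkQ_surjective (b j)
  have hid : ∀ x, U.mkQ (aeval y (F x)) = x := by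
    have h : U.mkQ ∘ₗ (aeval y : MvPolynomial κ k →ₐ[k] MvPolynomial σ k).toLinearMap ∘ₗ F =
        LinearMap.id := b.ext fun j => by
      simp only [LinearMap.comp_apply, F, Module.Basis.constr_basis, AlgHom.toLinearMap_apply,
        aeval_X, hy, LinearMap.id_apply]
    exact DFunLike.congr_fun h
  have hFinj : Function.Injective F := fun x x' h => by rw [← hid x, h, hid]
  have hFhom : ∀ x, (F x).IsHomogeneous 1 := by
    intro x
    rw [Module.Basis.constr_apply]
    refine IsHomogeneous.sum _ _ _ fun j _ => ?_
    change (_ • X j : MvPolynomial κ k).IsHomogeneous 1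
    rw [smul_eq_C_mul, ← zero_add 1]
    exact (isHomogeneous_C _ _).mul (isHomogeneous_X _ _)
  have hlin : ∀ x, x.IsHomogeneous 1 → aeval (fun i => F (U.mkQ (X i))) x = F (U.mkQ x) := by
    intro x hx
    refine isHomogeneous_one_induction (p := fun x =>
      aeval (fun i => F (U.mkQ (X i))) x = F (U.mkQ x)) (fun i => aeval_X _ _) (by simp)
      (fun a b ha hb => by simp only [map_add, ha, hb]) (fun c a ha => ?_) hx
    rw [← smul_eq_C_mul, map_smul, map_smul, map_smul, ha]
  have hker : ∀ x, x.IsHomogeneous 1 → aeval (fun i => F (U.mkQ (X i))) x = 0 → x ∈ U := by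
    intro x hx h0
    rw [hlin x hx, ← map_zero F] at h0
    simpa using hFinj h0
  refine ⟨κ, fun i => F (U.mkQ (X i)), fun i => hFhom _, hker, le_antisymm ?_ ?_⟩
  · intro s hs
    rw [RingHom.mem_ker] at hs
    have h := sub_mem_of_X (Ideal.span (U : Set (MvPolynomial σ k)))
      (f₁ := RingHom.id (MvPolynomial σ k))
      (f₂ := (aeval y).toRingHom.comp (aeval fun i => F (U.mkQ (X i))).toRingHom)
      (fun c => by simp [algebraMap_eq]) (fun i => Ideal.subset_span ?_) s
    · change s - aeval y (aeval (fun i => F (U.mkQ (X i))) s) ∈ _ at h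
      rwa [hs, map_zero, sub_zero] at h
    · change X i - aeval y (aeval (fun i => F (U.mkQ (X i))) (X i)) ∈ U
      rw [aeval_X, ← Submodule.Quotient.mk_eq_zero, ← Submodule.mkQ_apply, map_sub, hid, sub_self]
  · rw [Ideal.span_le]
    intro u hu
    rw [SetLike.mem_coe, RingHom.mem_ker, hlin u (hU u hu), Submodule.mkQ_apply,
      (Submodule.Quotient.mk_eq_zero U).2 hu, map_zero]

end Inertia

section Reflections

variable {Γ σ : Type} [Group Γ] [MulSemiringAction Γ (MvPolynomial σ k)]

/-- The subgroup of elements of `G` acting trivially modulo `q`. -/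
def inertia (G : Subgroup Γ) (q : Ideal (MvPolynomial σ k)) : Subgroup Γ where
  carrier := {g | g ∈ G ∧ ∀ s : MvPolynomial σ k, g • s - s ∈ q}
  one_mem' := ⟨one_mem _, fun s => by simp⟩
  mul_mem' := fun {a b} ha hb => ⟨mul_mem ha.1 hb.1, fun s => by
    rw [mul_smul, ← sub_add_sub_cancel _ (b • s)]
    exact add_mem (ha.2 _) (hb.2 _)⟩
  inv_mem' := fun {a} ha => ⟨inv_mem ha.1, fun s => by
    have h := ha.2 (a⁻¹ • s)
    rw [smul_inv_smul] at h
    rw [← neg_sub]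
    exact neg_mem h⟩

theorem mem_inertia {G : Subgroup Γ} {q : Ideal (MvPolynomial σ k)} {g : Γ} :
    g ∈ inertia G q ↔ g ∈ G ∧ ∀ s : MvPolynomial σ k, g • s - s ∈ q := Iff.rfl

theorem inertia_le (G : Subgroup Γ) (q : Ideal (MvPolynomial σ k)) : inertia G q ≤ G :=
  fun _ h => h.1

variable (k σ) in
/-- Elements which are trivial modulo a linear form: the identity and the reflections. -/
def IsReflOrOne (g : Γ) : Prop :=
  ∃ l : MvPolynomial σ k, l.IsHomogeneous 1 ∧ ∀ s : MvPolynomial σ k, l ∣ g • s - s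

variable (k σ) in
/-- The subgroup generated by the reflections in `G`. -/
def reflSub (G : Subgroup Γ) : Subgroup Γ := Subgroup.closure {g | g ∈ G ∧ IsReflOrOne k σ g}

theorem reflSub_le (G : Subgroup Γ) : reflSub k σ G ≤ G :=
  (Subgroup.closure_le G).2 fun _ h => h.1

theorem IsReflOrOne.mem_reflSub {G : Subgroup Γ} {g : Γ} (h : IsReflOrOne k σ g) (hg : g ∈ G) :
    g ∈ reflSub k σ G := Subgroup.subset_closure ⟨hg, h⟩

theorem reflSub_reflSub (G : Subgroup Γ) : reflSub k σ (reflSub k σ G) = reflSub k σ G := by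
  refine le_antisymm (reflSub_le _) ?_
  conv_lhs => rw [reflSub]
  rw [Subgroup.closure_le]
  exact fun g hg => hg.2.mem_reflSub (hg.2.mem_reflSub hg.1)

variable [LinAct Γ σ k]

theorem smul_eq_of_X {g : Γ} (h : ∀ i, g • (X i : MvPolynomial σ k) = X i)
    (s : MvPolynomial σ k) : g • s = s := by
  have := sub_mem_of_X (⊥ : Ideal (MvPolynomial σ k))
    (f₁ := MulSemiringAction.toRingHom Γ _ g) (f₂ := RingHom.id _)
    (fun c => LinAct.smul_C g c) (fun i => by simp [h]) s
  simpa [sub_eq_zero] using this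

theorem smul_sub_mem_of_X {g : Γ} {q : Ideal (MvPolynomial σ k)}
    (h : ∀ i, g • (X i : MvPolynomial σ k) - X i ∈ q) (s : MvPolynomial σ k) : g • s - s ∈ q :=
  sub_mem_of_X q (f₁ := MulSemiringAction.toRingHom Γ _ g) (f₂ := RingHom.id _)
    (fun c => LinAct.smul_C g c) h s

theorem smul_X_sub_X_isHomogeneous (g : Γ) (i : σ) :
    (g • (X i : MvPolynomial σ k) - X i).IsHomogeneous 1 :=
  (LinAct.smul_isHomogeneous g 1 _ (isHomogeneous_X _ _)).sub (isHomogeneous_X _ _)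

theorem isRefl_of_prime {p : MvPolynomial σ k} (hp : Prime p) {g : Γ}
    (h : ∀ s : MvPolynomial σ k, p ∣ g • s - s) : IsReflOrOne k σ g := by
  by_cases hg : ∀ i, g • (X i : MvPolynomial σ k) = X i
  · exact ⟨0, isHomogeneous_zero _ _ _, fun s => by rw [smul_eq_of_X hg, sub_self]⟩
  push Not at hg
  obtain ⟨i, hi⟩ := hg
  have hhom := smul_X_sub_X_isHomogeneous (k := k) g i
  refine ⟨g • X i - X i, hhom, fun s => dvd_trans ?_ (h s)⟩
  obtain ⟨c, hc⟩ := h (X i)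
  have hne : g • (X i : MvPolynomial σ k) - X i ≠ 0 := sub_ne_zero.2 hi
  have hc0 : c ≠ 0 := by rintro rfl; exact hne (by rw [hc, mul_zero])
  have hdeg := totalDegree_mul_of_isDomain hp.ne_zero hc0
  rw [← hc, hhom.totalDegree hne] at hdeg
  have hp0 : p.totalDegree ≠ 0 := by
    intro h0
    rw [totalDegree_eq_zero_iff_eq_C] at h0
    refine hp.not_isUnit ?_
    rw [h0]
    refine (IsUnit.mk0 _ fun h1 => hp.ne_zero ?_).map C
    rw [h0, h1, C_0]
  have hcC : c = C (coeff 0 c) := totalDegree_eq_zero_iff_eq_C.1 (by omega)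
  have hu : IsUnit c := by
    rw [hcC]
    refine (IsUnit.mk0 _ fun h1 => hc0 ?_).map C
    rw [hcC, h1, C_0]
  rw [hc]
  exact (hu.mul_right_dvd).2 dvd_rfl

theorem HasSplitting.toReflSub {I : Subgroup Γ} [Finite I] (h : HasSplitting k σ I) :
    HasSplitting k σ (reflSub k σ I) := by
  obtain ⟨π, hπ, h1⟩ := h
  refine exists_isInvLin_of_le (reflSub_le I) (fun g hg hs => ?_)
    (fun p hp g hg hs => (isRefl_of_prime hp hs).mem_reflSub hg) hπ h1
  rw [LinAct.faithful (k := k) (σ := σ) g hs]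
  exact one_mem _

theorem exists_relTr_reflSub {I : Subgroup Γ} [Finite I]
    {ψ : MvPolynomial σ k →+ MvPolynomial σ k} (hψ : IsInvLin I ψ) :
    ∃ τ : MvPolynomial σ k →+ MvPolynomial σ k, IsInvLin (reflSub k σ I) τ ∧
      ∀ s, relTr I (reflSub k σ I) (τ s) = ψ s := by
  obtain ⟨τ, hτ, h, -⟩ := exists_linear_factor (reflSub_le I) (fun g hg hs => by
    rw [LinAct.faithful (k := k) (σ := σ) g hs]
    exact one_mem _)
    (fun p hp g hg hs => (isRefl_of_prime hp hs).mem_reflSub hg) hψ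
  exact ⟨τ, hτ, h⟩

theorem exists_linear_quotient_ideal (q : Ideal (MvPolynomial σ k)) :
    ∃ (κ : Type) (L : σ → MvPolynomial κ k), (∀ i, (L i).IsHomogeneous 1) ∧
      (∀ x, x.IsHomogeneous 1 → (aeval L x = 0 ↔ x ∈ q)) ∧
      RingHom.ker (aeval L : MvPolynomial σ k →ₐ[k] MvPolynomial κ k) =
        Ideal.span {x | x.IsHomogeneous 1 ∧ x ∈ q} := by
  obtain ⟨κ, L, hL, h1, h2⟩ := exists_linear_quotient
    (homogeneousSubmodule σ k 1 ⊓ q.restrictScalars k) (fun u hu => hu.1)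
  refine ⟨κ, L, hL, fun x hx => ⟨fun h => (h1 x hx h).2, fun h => ?_⟩, h2⟩
  have : x ∈ RingHom.ker (aeval L : MvPolynomial σ k →ₐ[k] MvPolynomial κ k) := by
    rw [h2]
    exact Ideal.subset_span ⟨hx, h⟩
  exact this

theorem aeval_smul_of_X {κ : Type} {L : σ → MvPolynomial κ k} {g : Γ}
    (h : ∀ i, aeval L (g • (X i : MvPolynomial σ k) - X i) = 0) (s : MvPolynomial σ k) :
    aeval L (g • s) = aeval L s := by
  rw [← sub_eq_zero, ← map_sub]
  exact smul_sub_mem_of_X (q := RingHom.ker (aeval L : MvPolynomial σ k →ₐ[k] MvPolynomial κ k))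
    h s

theorem HasSplitting.toInertia {G : Subgroup Γ} [Finite G] (h : HasSplitting k σ G)
    (q : Ideal (MvPolynomial σ k)) : HasSplitting k σ (inertia G q) := by
  obtain ⟨κ, L, hL, h1, -⟩ := exists_linear_quotient_ideal q
  obtain ⟨π, hπ, hπ1⟩ := h
  have hpr : (RingHom.ker (aeval L : MvPolynomial σ k →ₐ[k] MvPolynomial κ k)).IsPrime :=
    RingHom.ker_isPrime _
  obtain ⟨κ', _, u, v, hu, hv, h0, hne⟩ := exists_separating_system G (inertia G q)
    (inertia_le G q) (RingHom.ker (aeval L : MvPolynomial σ k →ₐ[k] MvPolynomial κ k))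
    (fun g hg hs => ⟨hg, smul_sub_mem_of_X fun i =>
      (h1 _ (smul_X_sub_X_isHomogeneous g i)).1 (hs (X i))⟩)
  have hsys : IsSystem G (inertia G q) u v := ⟨hu, hv, h0⟩
  have hne0 : ∑ i, u i * v i ≠ 0 := fun h => hne (by rw [h]; exact zero_mem _)
  refine HasSplitting.of_isInvLin hL (fun g hg => aeval_smul_of_X fun i =>
    (h1 _ (smul_X_sub_X_isHomogeneous g i)).2 (hg.2 _))
    (twist_isInvLin (inertia_le G q) hsys (comp_relTr_isInvLin (H := inertia G q) hπ) hne0)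
    ?_
  rw [twist_comp_relTr_one hsys hπ, hπ1, mul_one]
  exact hne

end Reflections

section Coinvariants

variable {Γ σ : Type} [Group Γ] [MulSemiringAction Γ (MvPolynomial σ k)]

variable (k σ) in
/-- The ideal generated by the homogeneous invariants of positive degree. -/
noncomputable def posIdeal (G : Subgroup Γ) : Ideal (MvPolynomial σ k) :=
  Ideal.span {a | a ∈ fixedRing G (MvPolynomial σ k) ∧ ∃ d, 0 < d ∧ a.IsHomogeneous d}

theorem posIdeal_isHomog (G : Subgroup Γ) : IsHomog (posIdeal k σ G) :=
  IsHomog.span fun _ hx => ⟨_, hx.2.choose_spec.2⟩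

theorem posIdeal_le_irrel (G : Subgroup Γ) : posIdeal k σ G ≤ irrel σ k :=
  Ideal.span_le.2 fun _ hx => hx.2.choose_spec.2.mem_irrel hx.2.choose_spec.1

variable [LinAct Γ σ k]

theorem homogeneousComponent_mem_posIdeal {G : Subgroup Γ} {a : MvPolynomial σ k}
    (ha : a ∈ fixedRing G (MvPolynomial σ k)) {d : ℕ} (hd : 0 < d) :
    homogeneousComponent d a ∈ posIdeal k σ G :=
  Ideal.subset_span ⟨homogeneousComponent_mem_fixedRing ha d, d, hd,
    homogeneousComponent_isHomogeneous d a⟩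

theorem sub_C_mem_posIdeal {G : Subgroup Γ} {a : MvPolynomial σ k}
    (ha : a ∈ fixedRing G (MvPolynomial σ k)) :
    a - C (constantCoeff a) ∈ posIdeal k σ G := by
  have h : a - C (constantCoeff a) =
      ∑ d ∈ Finset.range a.totalDegree, homogeneousComponent (d + 1) a := by
    have h := sum_homogeneousComponent a
    rw [Finset.sum_range_succ', homogeneousComponent_zero] at h
    rw [constantCoeff_eq]
    linear_combination -h
  rw [h]
  exact sum_mem fun d _ => homogeneousComponent_mem_posIdeal ha d.succ_pos

theorem exists_X_pow_mem_posIdeal (G : Subgroup Γ) [Finite G] (i : σ) :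
    ∃ N, 0 < N ∧ (X i : MvPolynomial σ k) ^ N ∈ posIdeal k σ G := by
  have := Fintype.ofFinite G
  set P := MulSemiringAction.charpoly G (X i : MvPolynomial σ k)
  have hfix : ∀ m, P.coeff m ∈ fixedRing G (MvPolynomial σ k) := fun m g hg =>
    MulSemiringAction.smul_coeff_charpoly (G := G) (X i : MvPolynomial σ k) m ⟨g, hg⟩
  have h0 : P.eval (X i) = 0 := MulSemiringAction.eval_charpoly G _
  have hN : P.natDegree ≠ 0 := by
    intro h
    have h1 := (MulSemiringAction.monic_charpoly G (X i : MvPolynomial σ k)).natDegree_eq_zero.1 h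
    rw [show P = 1 from h1] at h0
    simp at h0
  refine ⟨P.natDegree, Nat.pos_of_ne_zero hN, ?_⟩
  rw [Polynomial.eval_eq_sum_range, Finset.sum_range_succ,
    show P.coeff P.natDegree = 1 from MulSemiringAction.monic_charpoly G _, one_mul] at h0
  have h2 := congrArg (homogeneousComponent P.natDegree) h0
  rw [map_add, map_sum, map_zero, homogeneousComponent_eq_self
    ((mem_homogeneousSubmodule _ _).2 (isHomogeneous_X_pow i P.natDegree))] at h2
  rw [← sub_eq_of_eq_add' h2.symm, zero_sub]
  refine neg_mem (sum_mem fun m hm => ?_)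
  rw [Finset.mem_range] at hm
  rw [homogeneousComponent_mul_of_isHomogeneous (isHomogeneous_X_pow i m), if_pos hm.le]
  exact Ideal.mul_mem_right _ _ (homogeneousComponent_mem_posIdeal (hfix m) (by omega))

theorem finite_quotient_posIdeal [Finite σ] (G : Subgroup Γ) [Finite G] :
    Module.Finite k (MvPolynomial σ k ⧸ posIdeal k σ G) := by
  have hft : Algebra.FiniteType k (MvPolynomial σ k ⧸ posIdeal k σ G) :=
    Algebra.FiniteType.of_surjective (Ideal.Quotient.mkₐ k (posIdeal k σ G))
      Ideal.Quotient.mk_surjective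
  have hint : Algebra.IsIntegral k (MvPolynomial σ k ⧸ posIdeal k σ G) := by
    refine ⟨fun x => ?_⟩
    obtain ⟨s, rfl⟩ := Ideal.Quotient.mk_surjective x
    induction s using MvPolynomial.induction_on with
    | C a => exact isIntegral_algebraMap (R := k)
    | add p q hp hq => rw [map_add]; exact hp.add hq
    | mul_X p i hp =>
      rw [map_mul]
      obtain ⟨N, hN, hX⟩ := exists_X_pow_mem_posIdeal (k := k) G i
      refine hp.mul (IsIntegral.of_pow hN ?_)
      rw [← map_pow, Ideal.Quotient.eq_zero_iff_mem.2 hX]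
      exact isIntegral_zero
  exact Algebra.IsIntegral.finite

/-- A homogeneous basis of the coinvariants, with its coordinate functions. -/
structure IsCoinvBasis (G : Subgroup Γ) {J : Type} [Fintype J] (e : J → MvPolynomial σ k)
    (δ : J → ℕ) (c : J → MvPolynomial σ k →ₗ[k] k) (j₀ : J) : Prop where
  isHomogeneous : ∀ j, (e j).IsHomogeneous (δ j)
  e_eq_one : e j₀ = 1
  pos : ∀ j, j ≠ j₀ → 0 < δ j
  coord_eq_zero : ∀ j, ∀ s ∈ posIdeal k σ G, c j s = 0
  coord_self : ∀ j, c j (e j) = 1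
  coord_ne : ∀ i j, i ≠ j → c i (e j) = 0
  coord_homog : ∀ j d s, s.IsHomogeneous d → d ≠ δ j → c j s = 0
  sub_mem : ∀ s, s - ∑ j, C (c j s) * e j ∈ posIdeal k σ G

theorem exists_isCoinvBasis [Finite σ] (G : Subgroup Γ) [Finite G] :
    ∃ (J : Type) (_ : Fintype J) (e : J → MvPolynomial σ k) (δ : J → ℕ)
      (c : J → MvPolynomial σ k →ₗ[k] k) (j₀ : J), IsCoinvBasis G e δ c j₀ := by
  classical
  have := finite_quotient_posIdeal (k := k) (σ := σ) G
  let Q := MvPolynomial σ k ⧸ posIdeal k σ G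
  let q : MvPolynomial σ k →ₐ[k] Q := Ideal.Quotient.mkₐ k (posIdeal k σ G)
  have hq0 : ∀ s, q s = 0 ↔ s ∈ posIdeal k σ G := fun s => Ideal.Quotient.eq_zero_iff_mem
  have hne : posIdeal k σ G ≠ ⊤ := fun h =>
    irrel_ne_top (top_le_iff.1 (h ▸ posIdeal_le_irrel (k := k) (σ := σ) G))
  have h10 : q 1 ≠ 0 := fun h => hne ((Ideal.eq_top_iff_one _).2 ((hq0 1).1 h))
  obtain ⟨b, hbT, h1b, hTb, hli⟩ := exists_linearIndepOn_id_extension (K := k)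
    (s := {q 1}) (t := {x : Q | ∃ s d, s.IsHomogeneous d ∧ q s = x})
    (LinearIndepOn.singleton h10) (by
      rintro _ rfl
      exact ⟨1, 0, isHomogeneous_one _ _, rfl⟩)
  have hfin : Finite b := hli.linearIndependent.finite
  have := Fintype.ofFinite b
  have hspan : ⊤ ≤ Submodule.span k (Set.range ((↑) : b → Q)) := by
    rintro x -
    obtain ⟨s, rfl⟩ := Ideal.Quotient.mk_surjective x
    change q s ∈ _
    rw [Subtype.range_coe, ← sum_homogeneousComponent s, map_sum]
    exact sum_mem fun d _ => hTb ⟨_, d, homogeneousComponent_isHomogeneous d s, rfl⟩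
  let B : Module.Basis b k Q := Module.Basis.mk hli hspan
  have hB : ∀ j, B j = j := fun j => Module.Basis.mk_apply hli hspan j
  have hex : ∀ j : b, ∃ s : MvPolynomial σ k, ∃ d, s.IsHomogeneous d ∧ q s = j ∧
      ((j : Q) = q 1 → s = 1) := by
    intro j
    by_cases h : (j : Q) = q 1
    · exact ⟨1, 0, isHomogeneous_one _ _, h.symm, fun _ => rfl⟩
    · obtain ⟨s, d, hs, hsj⟩ := hbT j.2
      exact ⟨s, d, hs, hsj, fun h' => absurd h' h⟩
  choose e δ he hej he1 using hex
  have hej' : ∀ j, q (e j) = B j := fun j => by rw [hej, hB]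
  have hself : ∀ j, B.coord j (q (e j)) = 1 := fun j => by
    rw [hej', B.coord_apply, B.repr_self, Finsupp.single_eq_same]
  have hnej : ∀ i j, i ≠ j → B.coord i (q (e j)) = 0 := fun i j h => by
    rw [hej', B.coord_apply, B.repr_self, Finsupp.single_eq_of_ne h]
  let j₀ : b := ⟨q 1, h1b rfl⟩
  have hsub : ∀ s, s - ∑ j, C (B.coord j (q s)) * e j ∈ posIdeal k σ G := fun s => by
    rw [← hq0, map_sub, map_sum, sub_eq_zero]
    conv_lhs => rw [← B.sum_repr (q s)]
    refine Finset.sum_congr rfl fun j _ => ?_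
    rw [← smul_eq_C_mul, map_smul, hej', B.coord_apply]
  refine ⟨b, inferInstance, e, δ, fun j => B.coord j ∘ₗ q.toLinearMap, j₀, he, he1 j₀ rfl,
    fun j hj => ?_, fun j s hs => ?_, hself, hnej, fun j d s hs hd => ?_, hsub⟩
  · by_contra h0
    have h0' : δ j = 0 := by omega
    have h2 : e j = C (coeff 0 (e j)) :=
      totalDegree_eq_zero_iff_eq_C.1 (Nat.le_zero.1 (h0' ▸ (he j).totalDegree_le))
    have h3 : B.coord j (q (e j)) = 0 := by
      rw [h2, ← mul_one (C (coeff 0 (e j))), ← he1 j₀ rfl, ← smul_eq_C_mul, map_smul, map_smul,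
        hnej j j₀ hj, smul_zero]
    rw [hself] at h3
    exact one_ne_zero h3
  · change B.coord j (q s) = 0
    rw [(hq0 s).2 hs, map_zero]
  · have h := posIdeal_isHomog G _ (hsub s) d
    have h2 : s - homogeneousComponent d (s - ∑ i, C (B.coord i (q s)) * e i) =
        ∑ i, if δ i = d then C (B.coord i (q s)) * e i else 0 := by
      rw [map_sub, homogeneousComponent_eq_self ((mem_homogeneousSubmodule _ _).2 hs), map_sum,
        sub_sub_cancel]
      refine Finset.sum_congr rfl fun i _ => ?_
      rw [homogeneousComponent_C_mul, homogeneousComponent_of_mem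
        ((mem_homogeneousSubmodule _ _).2 (he i))]
      split_ifs with h1 h2 h2
      · rfl
      · exact absurd h1.symm h2
      · exact absurd h2.symm h1
      · rw [mul_zero]
    have h3 : B.coord j (q s) =
        B.coord j (q (∑ i, if δ i = d then C (B.coord i (q s)) * e i else 0)) := by
      rw [← h2, map_sub q, (hq0 _).2 h, sub_zero]
    change B.coord j (q s) = 0
    rw [h3, map_sum, map_sum]
    refine Finset.sum_eq_zero fun i _ => ?_
    split_ifs with hi
    · rw [← smul_eq_C_mul, map_smul, map_smul, hnej j i (by rintro rfl; exact hd hi.symm), smul_zero]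
    · rw [map_zero, map_zero]

end Coinvariants

section Free

variable {σ κ : Type}

theorem homogeneousComponent_aeval {L : σ → MvPolynomial κ k} (hL : ∀ i, (L i).IsHomogeneous 1)
    (d : ℕ) (s : MvPolynomial σ k) :
    homogeneousComponent d (aeval L s) = aeval L (homogeneousComponent d s) := by
  classical
  have h : ∀ n, (aeval L (homogeneousComponent n s)).IsHomogeneous n := fun n => by
    have := (homogeneousComponent_isHomogeneous n s).aeval L hL
    rwa [one_mul] at this
  conv_lhs => rw [← sum_homogeneousComponent s, map_sum, map_sum]
  simp_rw [fun n => homogeneousComponent_of_mem (m := d) ((mem_homogeneousSubmodule _ _).2 (h n))]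
  rw [Finset.sum_ite_eq]
  split_ifs with hd
  · rfl
  · rw [homogeneousComponent_eq_zero _ _ (by simpa using hd), map_zero]

theorem sum_range_homogeneousComponent_of_le {a : MvPolynomial σ k} {D : ℕ}
    (h : ∀ d, D ≤ d → homogeneousComponent d a = 0) :
    ∑ d ∈ Finset.range D, homogeneousComponent d a = a := by
  have h1 : ∑ d ∈ Finset.range D, homogeneousComponent d a =
      ∑ d ∈ Finset.range (D + (a.totalDegree + 1)), homogeneousComponent d a :=
    Finset.sum_subset (Finset.range_mono (by omega)) fun d _ hd => h d (by simpa using hd)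
  have h2 : ∑ d ∈ Finset.range (a.totalDegree + 1), homogeneousComponent d a =
      ∑ d ∈ Finset.range (D + (a.totalDegree + 1)), homogeneousComponent d a :=
    Finset.sum_subset (Finset.range_mono (by omega)) fun d _ hd =>
      homogeneousComponent_eq_zero _ _ (by simpa using hd)
  rw [h1, ← h2, sum_homogeneousComponent]

variable {Γ : Type} [Group Γ] [MulSemiringAction Γ (MvPolynomial σ k)]

/-- Homogeneous invariants generating, independently and over the invariants, the invariants
which vanish under the linear substitution `L`. -/
structure IsParams (G : Subgroup Γ) (L : σ → MvPolynomial κ k) {τ : Type} [Fintype τ]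
    (f : τ → MvPolynomial σ k) (δ : τ → ℕ) : Prop where
  linear : ∀ i, (L i).IsHomogeneous 1
  map_smul : ∀ g ∈ G, ∀ s : MvPolynomial σ k, aeval L (g • s) = aeval L s
  mem : ∀ t, f t ∈ fixedRing G (MvPolynomial σ k)
  isHomogeneous : ∀ t, (f t).IsHomogeneous (δ t)
  pos : ∀ t, 0 < δ t
  ind : LIndPow f
  map_eq_zero : ∀ t, aeval L (f t) = 0
  exists_coeffs : ∀ a ∈ fixedRing G (MvPolynomial σ k), ∀ d, a.IsHomogeneous d → aeval L a = 0 →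
    ∃ c : τ → MvPolynomial σ k, (∀ t, c t ∈ fixedRing G (MvPolynomial σ k) ∧
      (c t).IsHomogeneous (d - δ t) ∧ (d < δ t → c t = 0)) ∧ a = ∑ t, c t * f t

/-- A homogeneous basis over the invariants together with its coordinate functions. -/
structure IsDualBasis (G : Subgroup Γ) {J : Type} [Fintype J] (e : J → MvPolynomial σ k)
    (δ : J → ℕ) (φ : J → MvPolynomial σ k →+ MvPolynomial σ k) (j₀ : J) : Prop where
  isHomogeneous : ∀ j, (e j).IsHomogeneous (δ j)
  e_eq_one : e j₀ = 1
  pos : ∀ j, j ≠ j₀ → 0 < δ j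
  isInvLin : ∀ j, IsInvLin G (φ j)
  sum_eq : ∀ s, ∑ j, φ j s * e j = s
  coord_one : φ j₀ 1 = 1
  coord_homog : ∀ j d s, s.IsHomogeneous d → (φ j s).IsHomogeneous (d - δ j) ∧
    (d < δ j → φ j s = 0)

section

variable {G : Subgroup Γ} {J : Type} [Fintype J] {e : J → MvPolynomial σ k}
    {δ : J → ℕ} {φ : J → MvPolynomial σ k →+ MvPolynomial σ k} {j₀ : J}

theorem IsDualBasis.isOpSystem (h : IsDualBasis G e δ φ j₀) : IsOpSystem (φ '' {j | j ≠ j₀}) where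
  shift := by
    rintro _ ⟨j, hj, rfl⟩
    exact ⟨δ j, h.pos j hj, h.coord_homog j⟩
  leibniz := by
    classical
    rintro _ ⟨l, hl, rfl⟩ a b
    set Φ := φ '' {j | j ≠ j₀}
    set A := Ideal.span (insert a ((fun ψ => ψ a) '' Φ))
    have ha : ∀ n, φ n a ∈ A := fun n => by
      by_cases hn : n = j₀
      · subst hn
        have h1 := h.sum_eq a
        rw [← Finset.add_sum_erase _ _ (Finset.mem_univ n), h.e_eq_one, mul_one] at h1
        rw [← sub_eq_of_eq_add h1.symm]
        refine sub_mem (Ideal.subset_span (Set.mem_insert _ _)) (sum_mem fun m hm => ?_)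
        exact Ideal.mul_mem_right _ _ (Ideal.subset_span (Set.mem_insert_of_mem _
          ⟨_, ⟨m, Finset.ne_of_mem_erase hm, rfl⟩, rfl⟩))
      · exact Ideal.subset_span (Set.mem_insert_of_mem _ ⟨_, ⟨n, hn, rfl⟩, rfl⟩)
    have hmul : ∀ x, φ l (a * x) ∈ A := fun x => by
      rw [← h.sum_eq a, Finset.sum_mul, map_sum]
      refine sum_mem fun n _ => ?_
      rw [mul_assoc, (h.isInvLin l).map_mul _ ((h.isInvLin n).mem a)]
      exact Ideal.mul_mem_right _ _ (ha n)
    have key : φ l (a * b) - φ l a * b =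
        ∑ m ∈ Finset.univ.erase j₀, (φ l (a * e m) - φ l a * e m) * φ m b := by
      have h1 : φ l (a * b) = ∑ m, φ m b * φ l (a * e m) := by
        conv_lhs => rw [← h.sum_eq b, Finset.mul_sum, map_sum]
        refine Finset.sum_congr rfl fun m _ => ?_
        rw [mul_left_comm, (h.isInvLin l).map_mul _ ((h.isInvLin m).mem b)]
      have h2 : φ l a * b = ∑ m, φ m b * (φ l a * e m) := by
        conv_lhs => rw [← h.sum_eq b, Finset.mul_sum]
        exact Finset.sum_congr rfl fun m _ => mul_left_comm _ _ _
      rw [h1, h2, ← Finset.sum_sub_distrib, ← Finset.add_sum_erase _ _ (Finset.mem_univ j₀),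
        h.e_eq_one, mul_one, mul_one, sub_self, zero_add]
      exact Finset.sum_congr rfl fun m _ => by ring
    rw [key]
    refine sum_mem fun m hm => Ideal.mul_mem_mul (sub_mem (hmul _) (Ideal.mul_mem_right _ _ (ha l)))
      (Ideal.subset_span ⟨_, ⟨m, Finset.ne_of_mem_erase hm, rfl⟩, rfl⟩)

theorem IsDualBasis.eq_coord_of_sum_mem (h : IsDualBasis G e δ φ j₀) {Q : Ideal (MvPolynomial σ k)}
    {s : MvPolynomial σ k} (hs : ∀ j, j ≠ j₀ → φ j s ∈ Q) : s - φ j₀ s ∈ Q := by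
  classical
  have h1 := h.sum_eq s
  rw [← Finset.add_sum_erase _ _ (Finset.mem_univ j₀), h.e_eq_one, mul_one] at h1
  rw [← eq_sub_of_add_eq' h1]
  exact sum_mem fun m hm => Ideal.mul_mem_right _ _ (hs m (Finset.ne_of_mem_erase hm))

/-- Elements of degree `d` with a homogeneous expansion along `e`. -/
def expSub (G : Subgroup Γ) (e : J → MvPolynomial σ k) (δ : J → ℕ) (d : ℕ) :
    AddSubgroup (MvPolynomial σ k) where
  carrier := {s | ∃ a : J → MvPolynomial σ k, (∀ j, a j ∈ fixedRing G (MvPolynomial σ k) ∧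
    (a j).IsHomogeneous (d - δ j) ∧ (d < δ j → a j = 0)) ∧ s = ∑ j, a j * e j}
  zero_mem' := ⟨0, fun j => ⟨zero_mem _, isHomogeneous_zero _ _ _, fun _ => rfl⟩, by simp⟩
  add_mem' := by
    rintro _ _ ⟨a, ha, rfl⟩ ⟨b, hb, rfl⟩
    refine ⟨a + b, fun j => ⟨add_mem (ha j).1 (hb j).1, (ha j).2.1.add (hb j).2.1, fun h => ?_⟩, ?_⟩
    · rw [Pi.add_apply, (ha j).2.2 h, (hb j).2.2 h, add_zero]
    · simp [add_mul, Finset.sum_add_distrib]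
  neg_mem' := by
    rintro _ ⟨a, ha, rfl⟩
    refine ⟨-a, fun j => ⟨neg_mem (ha j).1, (ha j).2.1.neg, fun h => ?_⟩, ?_⟩
    · rw [Pi.neg_apply, (ha j).2.2 h, neg_zero]
    · simp

theorem mul_mem_expSub {d m : ℕ} {x y : MvPolynomial σ k} (hx : x ∈ fixedRing G (MvPolynomial σ k))
    (hxm : x.IsHomogeneous m) (hy : y ∈ expSub G e δ d) : y * x ∈ expSub G e δ (d + m) := by
  obtain ⟨a, ha, rfl⟩ := hy
  refine ⟨fun j => a j * x, fun j => ?_, ?_⟩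
  · by_cases h : d < δ j
    · simp only [(ha j).2.2 h, zero_mul]
      exact ⟨zero_mem _, isHomogeneous_zero _ _ _, fun _ => trivial⟩
    · refine ⟨mul_mem (ha j).1 hx, ?_, fun h' => by omega⟩
      have := (ha j).2.1.mul hxm
      rwa [show d - δ j + m = d + m - δ j by omega] at this
  · rw [Finset.sum_mul]
    exact Finset.sum_congr rfl fun j _ => by ring

end

variable [LinAct Γ σ k] {G : Subgroup Γ} {J : Type} [Fintype J] {e : J → MvPolynomial σ k}
    {δ : J → ℕ} {c : J → MvPolynomial σ k →ₗ[k] k} {j₀ : J}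

theorem IsCoinvBasis.mem_expSub (h : IsCoinvBasis G e δ c j₀) (d : ℕ) :
    ∀ s : MvPolynomial σ k, s.IsHomogeneous d → s ∈ expSub G e δ d := by
  classical
  induction d using Nat.strong_induction_on with
  | _ d ih =>
    intro s hs
    have hsub := h.sub_mem s
    set r := s - ∑ j, C (c j s) * e j with hr
    have hterm : ∀ j, C (c j s) * e j ∈ expSub G e δ d ∧ (C (c j s) * e j).IsHomogeneous d := by
      intro j
      by_cases hj : d = δ j
      · have h1 : (C (c j s) * e j).IsHomogeneous d := by
          have := (isHomogeneous_C σ (c j s)).mul (h.isHomogeneous j)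
          rwa [zero_add, ← hj] at this
        refine ⟨⟨Pi.single j (C (c j s)), fun i => ?_, ?_⟩, h1⟩
        · by_cases hi : i = j
          · subst hi
            rw [Pi.single_eq_same, hj, Nat.sub_self]
            exact ⟨C_mem_fixedRing G _, isHomogeneous_C _ _, fun h' => absurd h' (lt_irrefl _)⟩
          · rw [Pi.single_eq_of_ne hi]
            exact ⟨zero_mem _, isHomogeneous_zero _ _ _, fun _ => rfl⟩
        · simp [Pi.single_apply]
      · rw [h.coord_homog j d s hs hj, map_zero, zero_mul]
        exact ⟨zero_mem _, isHomogeneous_zero _ _ _⟩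
    have hrd : r.IsHomogeneous d := hs.sub (IsHomogeneous.sum _ _ _ fun j _ => (hterm j).2)
    have hsr : s = r + ∑ j, C (c j s) * e j := by rw [hr, sub_add_cancel]
    rw [hsr]
    refine add_mem ?_ (sum_mem fun j _ => (hterm j).1)
    obtain ⟨n, y, x, hyx⟩ := (Submodule.mem_span_set' (R := MvPolynomial σ k)).1 hsub
    choose D hD using fun i => (x i).2.2
    have hmem : r ∈ Ideal.span (Set.range fun i => (x i : MvPolynomial σ k)) :=
      Ideal.mem_span_range_iff_exists_fun.2 ⟨y, hyx⟩
    obtain ⟨b, hb, hb'⟩ := exists_homogeneous_coeffs (fun i => (hD i).2) hmem d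
    rw [homogeneousComponent_eq_self ((mem_homogeneousSubmodule _ _).2 hrd)] at hb
    rw [hb]
    refine sum_mem fun i _ => ?_
    by_cases hi : d < D i
    · rw [(hb' i).2 hi, zero_mul]
      exact zero_mem _
    · have := mul_mem_expSub (x i).2.1 (hD i).2
        (ih (d - D i) (by have := (hD i).1; omega) _ (hb' i).1)
      rwa [show d - D i + D i = d by omega] at this

theorem IsCoinvBasis.coord_mul (h : IsCoinvBasis G e δ c j₀) (j : J) {a : MvPolynomial σ k}
    (ha : a ∈ fixedRing G (MvPolynomial σ k)) (s : MvPolynomial σ k) :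
    c j (a * s) = constantCoeff a * c j s := by
  have h1 : a * s = (a - C (constantCoeff a)) * s + constantCoeff a • s := by
    rw [smul_eq_C_mul]; ring
  rw [h1, map_add, h.coord_eq_zero j _ (Ideal.mul_mem_right _ _ (sub_C_mem_posIdeal ha)), zero_add,
    map_smul, smul_eq_mul]

variable {L : σ → MvPolynomial κ k} {τ : Type} [Fintype τ] {f : τ → MvPolynomial σ k} {w : τ → ℕ}

theorem IsParams.exists_coeffs_of_le (h : IsParams G L f w) {a : MvPolynomial σ k} {D : ℕ}
    (ha : a ∈ fixedRing G (MvPolynomial σ k)) (hD : ∀ d, D ≤ d → homogeneousComponent d a = 0)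
    (ha0 : aeval L a = 0) : ∃ c : τ → MvPolynomial σ k,
      (∀ t, c t ∈ fixedRing G (MvPolynomial σ k) ∧
        ∀ d, D - w t ≤ d → homogeneousComponent d (c t) = 0) ∧ a = ∑ t, c t * f t := by
  classical
  have h1 := fun d => h.exists_coeffs _ (homogeneousComponent_mem_fixedRing ha d) d
    (homogeneousComponent_isHomogeneous d a) (by
      rw [← homogeneousComponent_aeval h.linear, ha0, map_zero])
  choose c hc hac using h1
  refine ⟨fun t => ∑ d ∈ Finset.range D, c d t, fun t => ⟨sum_mem fun d _ => (hc d t).1, ?_⟩, ?_⟩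
  · intro d hd
    rw [map_sum]
    refine Finset.sum_eq_zero fun n hn => ?_
    rw [Finset.mem_range] at hn
    by_cases hnt : n < w t
    · rw [(hc n t).2.2 hnt, map_zero]
    · rw [homogeneousComponent_of_mem ((mem_homogeneousSubmodule _ _).2 (hc n t).2.1),
        if_neg (by omega)]
  · conv_lhs => rw [← sum_range_homogeneousComponent_of_le hD]
    simp_rw [Finset.sum_mul]
    rw [Finset.sum_comm]
    exact Finset.sum_congr rfl fun d _ => hac d

theorem IsParams.mem_span (h : IsParams G L f w) {a : MvPolynomial σ k}
    (ha : a ∈ fixedRing G (MvPolynomial σ k)) (ha0 : aeval L a = 0) :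
    a ∈ Ideal.span (Set.range f) := by
  obtain ⟨c, -, rfl⟩ := h.exists_coeffs_of_le (D := a.totalDegree + 1) ha (fun d hd =>
    homogeneousComponent_eq_zero _ _ (by omega)) ha0
  exact Ideal.mem_span_range_iff_exists_fun.2 ⟨c, rfl⟩

theorem IsParams.hasse_mem_span (h : IsParams G L f w) (α : κ →₀ ℕ) {x : MvPolynomial σ k}
    (hx : x ∈ Ideal.span (Set.range f)) : hasse L α x ∈ Ideal.span (Set.range f) := by
  classical
  obtain ⟨c, rfl⟩ := Ideal.mem_span_range_iff_exists_fun.1 hx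
  rw [map_sum]
  refine sum_mem fun t _ => ?_
  rw [hasse_mul]
  exact sum_mem fun x _ => Ideal.mul_mem_left _ _ (h.mem_span
    (hasse_mem_fixedRing h.map_smul _ (h.mem t)) (aeval_hasse_eq_zero L h.linear (h.map_eq_zero t) _))

theorem IsParams.aeval_eq_zero (h : IsParams G L f w) (hc : IsCoinvBasis G e δ c j₀)
    {x : J → MvPolynomial σ k} (hx : ∀ j, x j ∈ fixedRing G (MvPolynomial σ k))
    (hsum : ∑ j, x j * e j ∈ Ideal.span (Set.range f)) (j : J) : aeval L (x j) = 0 := by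
  classical
  by_contra hj
  set B := Finset.univ.filter fun j => aeval L (x j) ≠ 0
  obtain ⟨l, hlB, hmax⟩ := B.exists_max_image δ ⟨j, Finset.mem_filter.2 ⟨Finset.mem_univ j, hj⟩⟩
  have hB : ∑ j ∈ B, x j * e j ∈ Ideal.span (Set.range f) := by
    rw [← Finset.sum_filter_add_sum_filter_not Finset.univ (fun j => aeval L (x j) ≠ 0)] at hsum
    refine (Ideal.add_mem_iff_left _ (sum_mem fun i hi => ?_)).1 hsum
    exact Ideal.mul_mem_right _ _ (h.mem_span (hx i) (by simpa using hi))
  obtain ⟨α, hα⟩ := ne_zero_iff.1 (Finset.mem_filter.1 hlB).2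
  have hpos : ∀ y ∈ Ideal.span (Set.range f), c l y = 0 := fun y hy =>
    hc.coord_eq_zero l y ((Ideal.span_le.2 (by
      rintro _ ⟨t, rfl⟩
      exact Ideal.subset_span ⟨h.mem t, w t, h.pos t, h.isHomogeneous t⟩) :
        Ideal.span (Set.range f) ≤ posIdeal k σ G) hy)
  have h0 := hpos _ (h.hasse_mem_span α hB)
  have hterm : ∀ i ∈ B, c l (hasse L α (x i * e i)) = constantCoeff (hasse L α (x i)) * c l (e i) := by
    intro i hi
    rw [hasse_mul, map_sum, Finset.sum_eq_single (α, 0)]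
    · rw [hasse_zero h.linear, hc.coord_mul l (hasse_mem_fixedRing h.map_smul _ (hx i))]
    · rintro ⟨β, γ⟩ hβγ hne
      rw [Finset.HasAntidiagonal.mem_antidiagonal] at hβγ
      have hγ : γ ≠ 0 := by
        rintro rfl
        simp only [add_zero] at hβγ
        exact hne (by rw [hβγ])
      have hγ' : 0 < γ.degree := Nat.pos_of_ne_zero fun h => hγ ((Finsupp.degree_eq_zero_iff γ).1 h)
      rw [hc.coord_mul l (hasse_mem_fixedRing h.map_smul _ (hx i))]
      have hbi := isBihomogeneous_taylor h.linear (hc.isHomogeneous i) γ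
      rw [← hasse_apply] at hbi
      by_cases hlt : δ i < γ.degree
      · rw [hbi.2 hlt, map_zero, mul_zero]
      · rw [hc.coord_homog l _ _ hbi.1 (by have := hmax i hi; omega), mul_zero]
    · intro hn
      exact absurd (Finset.HasAntidiagonal.mem_antidiagonal.2 (by simp)) hn
  rw [map_sum, map_sum, Finset.sum_congr rfl hterm, Finset.sum_eq_single l, hc.coord_self, mul_one,
    constantCoeff_hasse] at h0
  · exact hα h0
  · intro i _ hi
    rw [hc.coord_ne l i hi.symm, mul_zero]
  · intro hl
    exact absurd hlB hl

theorem IsParams.eq_zero_of_sum_eq_zero (h : IsParams G L f w) (hc : IsCoinvBasis G e δ c j₀)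
    {x : J → MvPolynomial σ k} (hx : ∀ j, x j ∈ fixedRing G (MvPolynomial σ k))
    (hsum : ∑ j, x j * e j = 0) : x = 0 := by
  let F : ℕ → AddSubgroup (J → MvPolynomial σ k) := fun D =>
    { carrier := {x | ∀ j, x j ∈ fixedRing G (MvPolynomial σ k) ∧
        ∀ d, D ≤ d → homogeneousComponent d (x j) = 0}
      zero_mem' := fun j => ⟨zero_mem _, fun d _ => map_zero _⟩
      add_mem' := fun {a b} ha hb j => ⟨add_mem (ha j).1 (hb j).1, fun d hd => by
        rw [Pi.add_apply, map_add, (ha j).2 d hd, (hb j).2 d hd, add_zero]⟩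
      neg_mem' := fun {a} ha j => ⟨neg_mem (ha j).1, fun d hd => by
        rw [Pi.neg_apply, map_neg, (ha j).2 d hd, neg_zero]⟩ }
  let Λ : (J → MvPolynomial σ k) →+ MvPolynomial σ k :=
    AddMonoidHom.mk' (fun x => ∑ j, x j * e j) fun x y => by
      simp [add_mul, Finset.sum_add_distrib]
  let φ : τ → (J → MvPolynomial σ k) →+ (J → MvPolynomial σ k) := fun t =>
    AddMonoidHom.mk' (fun x j => x j * f t) fun x y => by
      ext1 j; simp [add_mul]
  refine h.ind.eq_zero_of_map_eq_zero h.isHomogeneous h.pos φ Λ ?_ F ?_ h.pos ?_ ?_ ?_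
    (D := ∑ j, (x j).totalDegree + 1) ?_ hsum
  · intro t x
    change ∑ j, x j * f t * e j = (∑ j, x j * e j) * f t
    rw [Finset.sum_mul]
    exact Finset.sum_congr rfl fun j _ => by ring
  · intro x hx
    ext1 j
    rw [← sum_range_homogeneousComponent_of_le (hx j).2, Finset.range_zero, Finset.sum_empty,
      Pi.zero_apply]
  · intro t D x hx j
    refine ⟨mul_mem (hx j).1 (h.mem t), fun d hd => ?_⟩
    change homogeneousComponent d (x j * f t) = 0
    rw [homogeneousComponent_mul_of_isHomogeneous (h.isHomogeneous t), if_pos (by omega),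
      (hx j).2 _ (by omega), zero_mul]
  · intro s t x
    ext1 j
    change x j * f t * f s = x j * f s * f t
    ring
  · intro D x hx hLx
    choose b hb hb' using fun j => h.exists_coeffs_of_le (hx j).1 (hx j).2
      (h.aeval_eq_zero hc (fun j => (hx j).1) hLx j)
    refine ⟨fun t j => b j t, fun t j => hb j t, ?_⟩
    ext1 j
    rw [Finset.sum_apply]
    exact hb' j
  · intro j
    refine ⟨hx j, fun d hd => homogeneousComponent_eq_zero _ _ ?_⟩
    have := Finset.single_le_sum (f := fun j => (x j).totalDegree) (fun _ _ => Nat.zero_le _)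
      (Finset.mem_univ j)
    omega

/-- The polynomial ring is free over the invariants as soon as `IsParams` holds. -/
theorem IsParams.exists_isDualBasis [Finite σ] [Finite G] (h : IsParams G L f w) :
    ∃ (J : Type) (_ : Fintype J) (e : J → MvPolynomial σ k) (δ : J → ℕ)
      (φ : J → MvPolynomial σ k →+ MvPolynomial σ k) (j₀ : J), IsDualBasis G e δ φ j₀ := by
  classical
  obtain ⟨J, hJ, e, δ, c, j₀, hc⟩ := exists_isCoinvBasis (k := k) (σ := σ) G
  have huniq : ∀ x y : J → MvPolynomial σ k, (∀ j, x j ∈ fixedRing G (MvPolynomial σ k)) →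
      (∀ j, y j ∈ fixedRing G (MvPolynomial σ k)) → ∑ j, x j * e j = ∑ j, y j * e j →
      ∀ j, x j = y j := fun x y hx hy hxy j => by
    have := h.eq_zero_of_sum_eq_zero hc (x := x - y) (fun j => sub_mem (hx j) (hy j)) (by
      simp [sub_mul, hxy])
    exact sub_eq_zero.1 (congrFun this j)
  have hex : ∀ s : MvPolynomial σ k, ∃ a : J → MvPolynomial σ k,
      (∀ j, a j ∈ fixedRing G (MvPolynomial σ k)) ∧ ∑ j, a j * e j = s := by
    intro s
    choose a ha hsa using fun d => hc.mem_expSub d _ (homogeneousComponent_isHomogeneous d s)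
    refine ⟨fun j => ∑ d ∈ Finset.range (s.totalDegree + 1), a d j,
      fun j => sum_mem fun d _ => (ha d j).1, ?_⟩
    conv_rhs => rw [← sum_homogeneousComponent s]
    simp_rw [Finset.sum_mul]
    rw [Finset.sum_comm]
    exact Finset.sum_congr rfl fun d _ => (hsa d).symm
  choose a ha hsum using hex
  refine ⟨J, hJ, e, δ, fun j => AddMonoidHom.mk' (fun s => a s j) fun s t => ?_, j₀,
    hc.isHomogeneous, hc.e_eq_one, hc.pos, fun j => ⟨fun s => ha s j, fun b hb s => ?_⟩, hsum, ?_,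
    fun j d s hs => ?_⟩
  · refine huniq (a (s + t)) (fun j => a s j + a t j) (ha _) (fun j => add_mem (ha _ _) (ha _ _)) ?_ j
    simp_rw [add_mul, Finset.sum_add_distrib, hsum]
  · refine huniq (a (b * s)) (fun j => b * a s j) (ha _) (fun j => mul_mem hb (ha _ _)) ?_ j
    simp_rw [mul_assoc, ← Finset.mul_sum, hsum]
  · refine (huniq (a 1) (Pi.single j₀ 1) (ha _) (fun j => ?_) ?_ j₀).trans (Pi.single_eq_same _ _)
    · rw [Pi.single_apply]
      split_ifs
      · exact one_mem _
      · exact zero_mem _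
    · simp [Pi.single_apply, hsum, hc.e_eq_one]
  · obtain ⟨b, hb, hsb⟩ := hc.mem_expSub d s hs
    have : a s j = b j := huniq (a s) b (ha s) (fun j => (hb j).1) (by rw [hsum, hsb]) j
    change (a s j).IsHomogeneous _ ∧ (_ → a s j = 0)
    rw [this]
    exact (hb j).2

end Free

section Augmentation

variable {Γ σ : Type} [Group Γ] [MulSemiringAction Γ (MvPolynomial σ k)]

variable (k σ) in
/-- The ideal of the fixed-point scheme. -/
noncomputable def augIdeal (G : Subgroup Γ) : Ideal (MvPolynomial σ k) :=
  Ideal.span {x | ∃ g ∈ G, ∃ s : MvPolynomial σ k, x = g • s - s}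

theorem smul_sub_mem_augIdeal {G : Subgroup Γ} {g : Γ} (hg : g ∈ G) (s : MvPolynomial σ k) :
    g • s - s ∈ augIdeal k σ G := Ideal.subset_span ⟨g, hg, s, rfl⟩

theorem augIdeal_le {G : Subgroup Γ} {q : Ideal (MvPolynomial σ k)} :
    augIdeal k σ G ≤ q ↔ ∀ g ∈ G, ∀ s : MvPolynomial σ k, g • s - s ∈ q :=
  ⟨fun h _ hg s => h (smul_sub_mem_augIdeal hg s), fun h => Ideal.span_le.2 (by
    rintro _ ⟨g, hg, s, rfl⟩
    exact h g hg s)⟩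

theorem inertia_eq_iff {G : Subgroup Γ} {q : Ideal (MvPolynomial σ k)} :
    inertia G q = G ↔ augIdeal k σ G ≤ q := by
  rw [augIdeal_le]
  refine ⟨fun h g hg => (mem_inertia.1 (h.ge hg)).2, fun h => ?_⟩
  exact le_antisymm (inertia_le G q) fun g hg => mem_inertia.2 ⟨hg, h g hg⟩

theorem smul_mem_span_of_fixed {G : Subgroup Γ} {T : Set (MvPolynomial σ k)}
    (hT : ∀ x ∈ T, x ∈ fixedRing G (MvPolynomial σ k)) {g : Γ} (hg : g ∈ G) {x : MvPolynomial σ k}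
    (hx : x ∈ Ideal.span T) : g • x ∈ Ideal.span T := by
  induction hx using Submodule.span_induction with
  | mem x hx => rw [hT x hx g hg]; exact Ideal.subset_span hx
  | zero => rw [smul_zero]; exact zero_mem _
  | add x y _ _ hx hy => rw [smul_add]; exact add_mem hx hy
  | smul a x _ hx => rw [smul_eq_mul, smul_mul']; exact Ideal.mul_mem_left _ _ hx

theorem IsInvLin.mem_span {G : Subgroup Γ} {π : MvPolynomial σ k →+ MvPolynomial σ k}
    (hπ : IsInvLin G π) {T : Set (MvPolynomial σ k)}
    (hT : ∀ x ∈ T, x ∈ fixedRing G (MvPolynomial σ k)) {x : MvPolynomial σ k}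
    (hx : x ∈ Ideal.span T) : π x ∈ Ideal.span T := by
  obtain ⟨n, y, z, rfl⟩ := (Submodule.mem_span_set' (R := MvPolynomial σ k)).1 hx
  rw [map_sum]
  refine sum_mem fun i _ => ?_
  rw [smul_eq_mul, mul_comm, hπ.map_mul _ (hT _ (z i).2)]
  exact Ideal.mul_mem_right _ _ (Ideal.subset_span (z i).2)

theorem IsInvLin.map_of_mem {G : Subgroup Γ} {π : MvPolynomial σ k →+ MvPolynomial σ k}
    (hπ : IsInvLin G π) (h1 : π 1 = 1) {a : MvPolynomial σ k}
    (ha : a ∈ fixedRing G (MvPolynomial σ k)) : π a = a := by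
  have := hπ.map_mul a ha 1
  rwa [h1, mul_one] at this

variable [LinAct Γ σ k]

theorem exists_linear_quotient_augIdeal (G : Subgroup Γ) :
    ∃ (κ : Type) (L : σ → MvPolynomial κ k), (∀ i, (L i).IsHomogeneous 1) ∧
      RingHom.ker (aeval L : MvPolynomial σ k →ₐ[k] MvPolynomial κ k) = augIdeal k σ G := by
  obtain ⟨κ, L, hL, hx, hker⟩ := exists_linear_quotient_ideal (augIdeal k σ G)
  refine ⟨κ, L, hL, le_antisymm (hker ▸ Ideal.span_le.2 fun x hx => hx.2) (augIdeal_le.2 ?_)⟩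
  intro g hg s
  refine smul_sub_mem_of_X (fun i => ?_) s
  rw [RingHom.mem_ker]
  exact (hx _ (smul_X_sub_X_isHomogeneous g i)).2 (smul_sub_mem_augIdeal hg _)

theorem IsParams.of_exists {κ : Type} {G : Subgroup Γ} {L : σ → MvPolynomial κ k} {τ : Type}
    [Fintype τ] {f : τ → MvPolynomial σ k} {δ : τ → ℕ} (linear : ∀ i, (L i).IsHomogeneous 1)
    (hker : RingHom.ker (aeval L : MvPolynomial σ k →ₐ[k] MvPolynomial κ k) = augIdeal k σ G)
    (mem : ∀ t, f t ∈ fixedRing G (MvPolynomial σ k))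
    (isHomogeneous : ∀ t, (f t).IsHomogeneous (δ t))
    (pos : ∀ t, 0 < δ t) (ind : LIndPow f) (map_eq_zero : ∀ t, f t ∈ augIdeal k σ G)
    (hex : ∀ a ∈ fixedRing G (MvPolynomial σ k), a ∈ augIdeal k σ G →
      ∃ c : τ → MvPolynomial σ k, (∀ t, c t ∈ fixedRing G (MvPolynomial σ k)) ∧
        a = ∑ t, c t * f t) : IsParams G L f δ where
  linear := linear
  map_smul g hg s := by
    rw [← sub_eq_zero, ← map_sub]
    exact (hker.symm ▸ smul_sub_mem_augIdeal hg s :)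
  mem := mem
  isHomogeneous := isHomogeneous
  pos := pos
  ind := ind
  map_eq_zero t := (hker.symm ▸ map_eq_zero t :)
  exists_coeffs a ha d had h0 := by
    obtain ⟨c, hc, hac⟩ := hex a ha (hker.le (RingHom.mem_ker.2 h0))
    refine ⟨fun t => if δ t ≤ d then homogeneousComponent (d - δ t) (c t) else 0, fun t => ?_, ?_⟩
    · dsimp only
      split_ifs with h
      · exact ⟨homogeneousComponent_mem_fixedRing (hc t) _, homogeneousComponent_isHomogeneous _ _,
          fun h' => by omega⟩
      · exact ⟨zero_mem _, isHomogeneous_zero _ _ _, fun _ => rfl⟩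
    · conv_lhs => rw [← homogeneousComponent_eq_self ((mem_homogeneousSubmodule _ _).2 had), hac,
        map_sum]
      refine Finset.sum_congr rfl fun t _ => ?_
      rw [homogeneousComponent_mul_of_isHomogeneous (isHomogeneous t), ite_mul, zero_mul]

theorem isParams_of_augIdeal_eq_bot {κ : Type} {G : Subgroup Γ} {L : σ → MvPolynomial κ k}
    (linear : ∀ i, (L i).IsHomogeneous 1)
    (hker : RingHom.ker (aeval L : MvPolynomial σ k →ₐ[k] MvPolynomial κ k) = augIdeal k σ G)
    (h : augIdeal k σ G = ⊥) : IsParams G L (fun t : Empty => t.elim) fun t => t.elim := by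
  refine IsParams.of_exists linear hker nofun nofun nofun (fun a _ s _ t => t.elim) nofun ?_
  intro a _ ha
  rw [h, Ideal.mem_bot] at ha
  exact ⟨nofun, nofun, by simp [ha]⟩

theorem exists_smul_eq_C_mul {G : Subgroup Γ} {l : MvPolynomial σ k} (hl : l.IsHomogeneous 1)
    (h : ∀ g ∈ G, ∀ s : MvPolynomial σ k, l ∣ g • s - s) {g : Γ} (hg : g ∈ G) :
    ∃ χ : k, g • l = C χ * l := by
  obtain ⟨u, hu⟩ := h g hg l
  have h1 : (g • l - l).IsHomogeneous 1 := (LinAct.smul_isHomogeneous g 1 l hl).sub hl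
  have h2 := homogeneousComponent_mul_of_isHomogeneous hl u 1
  rw [mul_comm, ← hu, homogeneousComponent_eq_self ((mem_homogeneousSubmodule _ _).2 h1),
    if_pos le_rfl, Nat.sub_self, homogeneousComponent_zero] at h2
  exact ⟨coeff 0 u + 1, by rw [C_add, C_1]; linear_combination h2⟩

theorem pow_mem_fixedRing_of_pow_mul_mem {G : Subgroup Γ} {l : MvPolynomial σ k}
    (hl : l.IsHomogeneous 1) (hl0 : l ≠ 0)
    (h : ∀ g ∈ G, ∀ s : MvPolynomial σ k, l ∣ g • s - s) {m : ℕ} {b : MvPolynomial σ k}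
    (hb : ¬ l ∣ b) (hmb : l ^ m * b ∈ fixedRing G (MvPolynomial σ k)) :
    l ^ m ∈ fixedRing G (MvPolynomial σ k) := by
  intro g hg
  obtain ⟨χ, hχ⟩ := exists_smul_eq_C_mul hl h hg
  have h1 := hmb g hg
  have hpow : g • l ^ m = C (χ ^ m) * l ^ m := by rw [smul_pow', hχ, mul_pow, map_pow]
  rw [smul_mul', hpow] at h1
  have h2 : C (χ ^ m) * g • b = b :=
    mul_left_cancel₀ (pow_ne_zero m hl0) (by linear_combination h1)
  by_cases hχm : χ ^ m = 1
  · rw [hpow, hχm, C_1, one_mul]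
  · exfalso
    apply hb
    have h3 : C (1 - χ ^ m) * b = C (χ ^ m) * (g • b - b) := by
      rw [C_sub, C_1]; linear_combination -h2
    have h4 : l ∣ C (1 - χ ^ m) * b := h3 ▸ Dvd.dvd.mul_left (h g hg b) _
    have h5 : b = C (1 - χ ^ m)⁻¹ * (C (1 - χ ^ m) * b) := by
      rw [← mul_assoc, ← C_mul, inv_mul_cancel₀ (sub_ne_zero.2 fun h => hχm h.symm), C_1, one_mul]
    rw [h5]
    exact Dvd.dvd.mul_left h4 _

theorem exists_isParams_of_dvd {κ : Type} {G : Subgroup Γ} [Finite G] {L : σ → MvPolynomial κ k}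
    (linear : ∀ i, (L i).IsHomogeneous 1)
    (hker : RingHom.ker (aeval L : MvPolynomial σ k →ₐ[k] MvPolynomial κ k) = augIdeal k σ G)
    {l : MvPolynomial σ k} (hl : l.IsHomogeneous 1)
    (h : ∀ g ∈ G, ∀ s : MvPolynomial σ k, l ∣ g • s - s) :
    ∃ (τ : Type) (_ : Fintype τ) (f : τ → MvPolynomial σ k) (δ : τ → ℕ), IsParams G L f δ := by
  classical
  by_cases hbot : augIdeal k σ G = ⊥
  · exact ⟨_, _, _, _, isParams_of_augIdeal_eq_bot linear hker hbot⟩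
  have hle : augIdeal k σ G ≤ Ideal.span {l} :=
    augIdeal_le.2 fun g hg s => Ideal.mem_span_singleton.2 (h g hg s)
  have hl0 : l ≠ 0 := by
    rintro rfl
    exact hbot (le_bot_iff.1 (by simpa using hle))
  have hlaug : l ∈ augIdeal k σ G := by
    by_contra hla
    refine hbot (le_bot_iff.1 (augIdeal_le.2 fun g hg s => smul_sub_mem_of_X (fun i => ?_) s))
    by_contra hne
    rw [Ideal.mem_bot] at hne
    obtain ⟨u, hu⟩ := h g hg (X i)
    have h2 := homogeneousComponent_mul_of_isHomogeneous hl u 1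
    rw [mul_comm, ← hu, homogeneousComponent_eq_self
      ((mem_homogeneousSubmodule _ _).2 (smul_X_sub_X_isHomogeneous g i)), if_pos le_rfl,
      Nat.sub_self, homogeneousComponent_zero] at h2
    have hc : coeff 0 u ≠ 0 := fun h0 => hne (by rw [h2, h0, C_0, zero_mul])
    apply hla
    rw [show l = C (coeff 0 u)⁻¹ * (g • X i - X i) by
      rw [h2, ← mul_assoc, ← C_mul, inv_mul_cancel₀ hc, C_1, one_mul]]
    exact Ideal.mul_mem_left _ _ (smul_sub_mem_augIdeal hg _)
  have hnu : ¬ IsUnit l := fun hu =>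
    irrel_ne_top (Ideal.eq_top_of_isUnit_mem _ (hl.mem_irrel one_pos) hu)
  have hdecomp : ∀ a ∈ fixedRing G (MvPolynomial σ k), a ∈ augIdeal k σ G → a ≠ 0 →
      ∃ m b, 0 < m ∧ l ^ m ∈ fixedRing G (MvPolynomial σ k) ∧ a = l ^ m * b := by
    intro a ha hla ha0
    obtain ⟨b, hab, hb⟩ := (FiniteMultiplicity.of_not_isUnit hnu ha0).exists_eq_pow_mul_and_not_dvd
    refine ⟨_, b, ?_, pow_mem_fixedRing_of_pow_mul_mem hl hl0 h hb (hab ▸ ha), hab⟩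
    refine Nat.pos_of_ne_zero fun h0 => hb ?_
    rw [h0, pow_zero, one_mul] at hab
    exact hab ▸ Ideal.mem_span_singleton.1 (hle hla)
  have hex : ∃ m, 0 < m ∧ l ^ m ∈ fixedRing G (MvPolynomial σ k) := by
    obtain ⟨c, hc0, hc, -⟩ := exists_mul_mem_fixedRing G hl0
    obtain ⟨m, -, hm, hlm, -⟩ := hdecomp _ hc (Ideal.mul_mem_left _ _ hlaug) (mul_ne_zero hc0 hl0)
    exact ⟨m, hm, hlm⟩
  set n := Nat.find hex
  obtain ⟨hn, hln⟩ := Nat.find_spec hex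
  refine ⟨Unit, inferInstance, fun _ => l ^ n, fun _ => n, IsParams.of_exists linear hker
    (fun _ => hln) (fun _ => by simpa using hl.pow n) (fun _ => hn) (fun a _ s hs t => ?_)
    (fun _ => Ideal.pow_mem_of_mem _ hlaug n hn) fun a ha hla => ?_⟩
  · simp only [Finset.univ_unique, Finset.sum_singleton] at hs
    rcases mul_eq_zero.1 hs with h0 | h0
    · rw [show s t = 0 from h0]; exact zero_mem _
    · exact absurd h0 (pow_ne_zero _ (pow_ne_zero _ hl0))
  · by_cases ha0 : a = 0
    · exact ⟨0, fun _ => zero_mem _, by simp [ha0]⟩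
    · obtain ⟨m, b, hm, hlm, hab⟩ := hdecomp a ha hla ha0
      have hnm : n ≤ m := Nat.find_min' hex ⟨hm, hlm⟩
      have hab' : a = l ^ (m - n) * b * l ^ n := by
        rw [hab, mul_right_comm, ← pow_add, Nat.sub_add_cancel hnm]
      refine ⟨fun _ => l ^ (m - n) * b, fun _ g hg => ?_, by simpa using hab'⟩
      have h1 := ha g hg
      rw [hab', smul_mul', show g • l ^ n = l ^ n from hln g hg] at h1
      exact mul_right_cancel₀ (pow_ne_zero n hl0) h1

end Augmentation

section MinimalGenerators

variable {σ : Type}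

/-- A family of forms generating the ideal `I`. -/
def IsGen (I : Ideal (MvPolynomial σ k)) {τ : Type} (m : τ → MvPolynomial σ k) : Prop :=
  (∀ t, ∃ d, (m t).IsHomogeneous d) ∧ Ideal.span (Set.range m) = I

theorem exists_minimal_isGen [Finite σ] {I : Ideal (MvPolynomial σ k)} (hI : IsHomog I) :
    ∃ r, (∃ m : Fin r → MvPolynomial σ k, IsGen I m) ∧
      ∀ m : Fin r → MvPolynomial σ k, IsGen I m → ∀ t, m t ∉ Ideal.span (m '' {u | u ≠ t}) := by
  classical
  have hex : ∃ r, ∃ m : Fin r → MvPolynomial σ k, IsGen I m := by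
    have hfg : (Submodule.span (MvPolynomial σ k)
        {x : MvPolynomial σ k | x ∈ I ∧ ∃ e, x.IsHomogeneous e}).FG := IsNoetherian.noetherian _
    obtain ⟨T, hT, hspan⟩ := (Submodule.fg_span_iff_fg_span_finset_subset _).1 hfg
    refine ⟨T.card, fun i => T.equivFin.symm i, fun i => (hT (T.equivFin.symm i).2).2, ?_⟩
    have : Set.range (fun i => (T.equivFin.symm i : MvPolynomial σ k)) = T := by
      ext x
      refine ⟨?_, fun hx => ⟨T.equivFin ⟨x, hx⟩, by simp⟩⟩
      rintro ⟨i, rfl⟩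
      exact (T.equivFin.symm i).2
    rw [this]
    exact hspan.symm.trans hI.eq_span.symm
  refine ⟨Nat.find hex, Nat.find_spec hex, fun m hm t ht => ?_⟩
  have hpos : 0 < Nat.find hex := t.pos
  obtain ⟨r, hr⟩ : ∃ r, Nat.find hex = r + 1 := ⟨Nat.find hex - 1, by omega⟩
  refine Nat.find_min hex (m := r) (by omega) ?_
  let m' : Fin r → MvPolynomial σ k := fun i => m (finCongr hr.symm ((finCongr hr t).succAbove i))
  refine ⟨m', fun i => hm.1 _, le_antisymm ?_ ?_⟩
  · rw [← hm.2]
    exact Ideal.span_mono (by rintro _ ⟨i, rfl⟩; exact ⟨_, rfl⟩)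
  · have hle : Ideal.span (m '' {u | u ≠ t}) ≤ Ideal.span (Set.range m') := by
      refine Ideal.span_mono ?_
      rintro _ ⟨u, hu, rfl⟩
      obtain ⟨i, hi⟩ := Fin.exists_succAbove_eq (x := finCongr hr u) (y := finCongr hr t)
        (fun h => hu ((finCongr hr).injective h))
      refine ⟨i, ?_⟩
      simp only [m', hi]
      congr 1
    rw [← hm.2, Ideal.span_le]
    rintro _ ⟨u, rfl⟩
    by_cases hu : u = t
    · exact hu ▸ hle ht
    · exact hle (Ideal.subset_span ⟨u, hu, rfl⟩)

theorem pos_of_irredundant {τ : Type} {m : τ → MvPolynomial σ k} {δ : τ → ℕ}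
    (hm : ∀ t, (m t).IsHomogeneous (δ t)) (hirrel : ∀ t, m t ∈ irrel σ k)
    (hirr : ∀ t, m t ∉ Ideal.span (m '' {u | u ≠ t})) (t : τ) : 0 < δ t := by
  refine Nat.pos_of_ne_zero fun h0 => hirr t ?_
  have h1 : m t = C (coeff 0 (m t)) :=
    totalDegree_eq_zero_iff_eq_C.1 (Nat.le_zero.1 (h0 ▸ (hm t).totalDegree_le))
  rw [h1, mem_irrel.1 (hirrel t), C_0]
  exact zero_mem _

theorem span_image_le_of_sub_mem {S : Type} [CommRing S] {τ : Type} {m f : τ → S} {δ : τ → ℕ}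
    {D : ℕ} (h : ∀ u, δ u < D → m u - f u ∈ Ideal.span (m '' {v | δ v < δ u})) :
    Ideal.span (m '' {u | δ u < D}) = Ideal.span (f '' {u | δ u < D}) := by
  refine le_antisymm ?_ (Ideal.span_le.2 ?_)
  · suffices H : ∀ D' ≤ D, Ideal.span (m '' {u | δ u < D'}) ≤ Ideal.span (f '' {u | δ u < D'}) from
      H D le_rfl
    intro D'
    induction D' using Nat.strong_induction_on with
    | _ D' ih =>
      intro hD'
      rw [Ideal.span_le]
      rintro _ ⟨u, hu, rfl⟩
      have hu' : δ u < D' := hu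
      have h1 := ih (δ u) hu' (by omega) (h u (by omega))
      rw [← sub_add_cancel (m u) (f u)]
      exact add_mem (Ideal.span_mono (Set.image_mono fun v (hv : δ v < δ u) =>
        (hv.trans hu' : δ v < D')) h1) (Ideal.subset_span ⟨u, hu, rfl⟩)
  · rintro _ ⟨u, hu, rfl⟩
    have hu' : δ u < D := hu
    rw [show f u = m u - (m u - f u) by ring]
    exact sub_mem (Ideal.subset_span ⟨u, hu, rfl⟩) (Ideal.span_mono (Set.image_mono
      fun v (hv : δ v < δ u) => (hv.trans hu' : δ v < D)) (h u hu'))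

end MinimalGenerators

section Core

variable {Γ σ : Type} [Group Γ] [MulSemiringAction Γ (MvPolynomial σ k)]

theorem smul_sub_mem_of_closure {G : Subgroup Γ} {T : Set Γ} (hT : G = Subgroup.closure T)
    {Q : Ideal (MvPolynomial σ k)} (hQ : ∀ g ∈ G, ∀ x ∈ Q, g • x ∈ Q) {j : MvPolynomial σ k}
    (h : ∀ g ∈ T, g • j - j ∈ Q) : ∀ g ∈ G, g • j - j ∈ Q := by
  intro g hg
  rw [hT] at hg
  induction hg using Subgroup.closure_induction with
  | mem g hg => exact h g hg
  | one => simp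
  | mul a b ha _ hja hjb =>
    rw [show (a * b) • j - j = a • (b • j - j) + (a • j - j) by rw [mul_smul, smul_sub]; ring]
    exact add_mem (hQ a (hT ▸ ha) _ hjb) hja
  | inv a ha hja =>
    rw [show a⁻¹ • j - j = -(a⁻¹ • (a • j - j)) by rw [smul_sub, inv_smul_smul]; ring]
    exact neg_mem (hQ _ (hT ▸ inv_mem ha) _ hja)

variable [LinAct Γ σ k]

variable (k σ) in
/-- The polynomial ring has a dual basis over the invariants. -/
def HasDualBasis (G : Subgroup Γ) : Prop :=
  ∃ (J : Type) (_ : Fintype J) (e : J → MvPolynomial σ k) (δ : J → ℕ)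
    (φ : J → MvPolynomial σ k →+ MvPolynomial σ k) (j₀ : J), IsDualBasis G e δ φ j₀

theorem exists_mul_sub_mem {G I : Subgroup Γ} [Finite G] {q Q : Ideal (MvPolynomial σ k)}
    [q.IsPrime] (hI : I = inertia G q) (hsplit : HasSplitting k σ I)
    (hQ : ∀ g ∈ G, ∀ x ∈ Q, g • x ∈ Q) {j y : MvPolynomial σ k}
    (hj : ∀ g ∈ G, g • j - j ∈ Q) (hy : y ∈ fixedRing (reflSub k σ I) (MvPolynomial σ k))
    (hyj : j - y ∈ Q) :
    ∃ a ∈ fixedRing G (MvPolynomial σ k), a ∉ q ∧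
      ∃ a' ∈ fixedRing G (MvPolynomial σ k), a * j - a' ∈ Q := by
  have hIG : I ≤ G := hI ▸ inertia_le G q
  have : Finite I := Set.Finite.subset (Set.toFinite (G : Set Γ)) hIG
  have hmod : ∀ g ∈ G, ∀ z, j - z ∈ Q → g • z - j ∈ Q := fun g hg z hz => by
    rw [show g • z - j = -(g • (j - z)) + (g • j - j) by rw [smul_sub]; ring]
    exact add_mem (neg_mem (hQ g hg _ hz)) (hj g hg)
  obtain ⟨π, hπ, hπ1⟩ := hsplit
  obtain ⟨ψ, hψ, hψr⟩ := exists_relTr_reflSub hπ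
  have h1 : relTr I (reflSub k σ I) (ψ 1) = 1 := by rw [hψr, hπ1]
  set w := relTr I (reflSub k σ I) (ψ 1 * y)
  have hw : w ∈ fixedRing I (MvPolynomial σ k) := relTr_mem (mul_mem (hψ.mem 1) hy)
  have hwj : j - w ∈ Q := by
    have := relTr_congr_mod (G := I) (H := reflSub k σ I) Q (b := ψ 1)
      (fun g hg => hQ g (hIG hg)) (fun g hg => hmod g (hIG hg) y hyj)
    rw [h1, one_mul] at this
    rw [← neg_sub]
    exact neg_mem this
  obtain ⟨κ, _, u, v, hu, hv, huv, hne⟩ := exists_separating_system G I hIG q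
    (fun g hg hs => hI ▸ mem_inertia.2 ⟨hg, hs⟩)
  have hsys : IsSystem G I u v := ⟨hu, hv, huv⟩
  have hsum := hsys.sum_mul_relTr (one_mem (fixedRing I (MvPolynomial σ k)))
  simp only [one_mul, mul_one] at hsum
  obtain ⟨i, hi⟩ : ∃ i, relTr G I (v i) ∉ q := by
    by_contra! hall
    exact hne (hsum ▸ sum_mem fun i _ => Ideal.mul_mem_left _ _ (hall i))
  refine ⟨relTr G I (v i), relTr_mem (hv i), hi, relTr G I (v i * w), relTr_mem (mul_mem (hv i) hw),
    ?_⟩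
  rw [← neg_sub]
  exact neg_mem (relTr_congr_mod Q hQ fun g hg => hmod g hg w hwj)

/-- The data of the inductive step. -/
structure IsCoreData (G : Subgroup Γ) {κ : Type} (L : σ → MvPolynomial κ k)
    (π : MvPolynomial σ k →+ MvPolynomial σ k)
    (Φ : Set (MvPolynomial σ k →+ MvPolynomial σ k)) : Prop where
  linear : ∀ i, (L i).IsHomogeneous 1
  ker_eq : RingHom.ker (aeval L : MvPolynomial σ k →ₐ[k] MvPolynomial κ k) = augIdeal k σ G
  isInvLin : IsInvLin G π
  map_one : π 1 = 1
  homog : ∀ d s, s.IsHomogeneous d → (π s).IsHomogeneous d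
  isOpSystem : IsOpSystem Φ
  hasse_mem : ∀ α ≠ 0, hasse L α ∈ Φ
  exists_dualBasis : ∀ q : Ideal (MvPolynomial σ k), ¬ augIdeal k σ G ≤ q →
    ∃ (J : Type) (_ : Fintype J) (e : J → MvPolynomial σ k) (δ : J → ℕ)
    (φ : J → MvPolynomial σ k →+ MvPolynomial σ k) (j₀ : J),
    IsDualBasis (reflSub k σ (inertia G q)) e δ φ j₀ ∧ ∀ j, j ≠ j₀ → φ j ∈ Φ
  stable : ∀ φ ∈ Φ, (∃ α, φ = hasse L α) ∨
    ∀ a ∈ fixedRing G (MvPolynomial σ k), ∀ s, φ (a * s) = a * φ s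

namespace IsCoreData

variable {G : Subgroup Γ} {κ : Type} {L : σ → MvPolynomial κ k}
    {π : MvPolynomial σ k →+ MvPolynomial σ k} {Φ : Set (MvPolynomial σ k →+ MvPolynomial σ k)}

theorem opIdeal_le (h : IsCoreData G L π Φ) : opIdeal Φ ≤ augIdeal k σ G := by
  intro x hx
  rw [← h.ker_eq, RingHom.mem_ker]
  change aeval L x = 0
  ext α
  rw [← constantCoeff_hasse, coeff_zero, constantCoeff_eq, ← mem_irrel]
  by_cases hα : α = 0
  · rw [hα, hasse_zero h.linear]
    exact opIdeal_le_irrel hx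
  · exact opIdeal_le_irrel (map_mem_opIdeal (h.hasse_mem α hα) hx)

theorem mem_opIdeal (h : IsCoreData G L π Φ) {a : MvPolynomial σ k}
    (ha : a ∈ fixedRing G (MvPolynomial σ k)) (ha' : a ∈ augIdeal k σ G) : a ∈ opIdeal Φ := by
  classical
  set T := {x | x ∈ fixedRing G (MvPolynomial σ k) ∧ aeval L x = 0 ∧ ∃ d, x.IsHomogeneous d}
  have hT : ∀ x ∈ fixedRing G (MvPolynomial σ k), aeval L x = 0 → x ∈ Ideal.span T := by
    intro x hx h0
    rw [← sum_homogeneousComponent x]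
    exact sum_mem fun d _ => Ideal.subset_span ⟨homogeneousComponent_mem_fixedRing hx d, by
      rw [← homogeneousComponent_aeval h.linear, h0, map_zero], d,
      homogeneousComponent_isHomogeneous d x⟩
  have hle : Ideal.span T ≤ RingHom.ker (aeval L : MvPolynomial σ k →ₐ[k] MvPolynomial κ k) :=
    Ideal.span_le.2 fun x hx => hx.2.1
  have hsmul : ∀ g ∈ G, ∀ s : MvPolynomial σ k, aeval L (g • s) = aeval L s := fun g hg s => by
    rw [← sub_eq_zero, ← map_sub]
    exact (h.ker_eq.symm ▸ smul_sub_mem_augIdeal hg s :)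
  refine le_opIdeal (I := Ideal.span T) (IsHomog.span fun x hx => hx.2.2)
    (fun htop => RingHom.ker_ne_top _ (top_le_iff.1 (htop ▸ hle))) ?_
    (hT a ha (RingHom.mem_ker.1 (h.ker_eq.symm ▸ ha')))
  intro φ hφ x hx
  obtain ⟨n, y, z, rfl⟩ := (Submodule.mem_span_set' (R := MvPolynomial σ k)).1 hx
  rw [map_sum]
  refine sum_mem fun i _ => ?_
  rcases h.stable φ hφ with ⟨α, rfl⟩ | hlin
  · rw [smul_eq_mul, hasse_mul]
    exact sum_mem fun b _ => Ideal.mul_mem_left _ _ (hT _ (hasse_mem_fixedRing hsmul _ (z i).2.1)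
      (aeval_hasse_eq_zero L h.linear (z i).2.2.1 _))
  · rw [smul_eq_mul, mul_comm, hlin _ (z i).2.1]
    exact Ideal.mul_mem_right _ _ (Ideal.subset_span (z i).2)

theorem exists_sub_mem (h : IsCoreData G L π Φ) {Q : Ideal (MvPolynomial σ k)}
    {j : MvPolynomial σ k} (hj : ∀ φ ∈ Φ, φ j ∈ Q) {q : Ideal (MvPolynomial σ k)}
    (hq : ¬ augIdeal k σ G ≤ q) :
    ∃ y ∈ fixedRing (reflSub k σ (inertia G q)) (MvPolynomial σ k), j - y ∈ Q := by
  obtain ⟨J, _, e, δ, φ, j₀, hφ, hmem⟩ := h.exists_dualBasis q hq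
  exact ⟨φ j₀ j, (hφ.isInvLin j₀).mem j, hφ.eq_coord_of_sum_mem fun i hi => hj _ (hmem i hi)⟩

theorem sub_map_mem [Finite G] (h : IsCoreData G L π Φ) (hrefl : reflSub k σ G = G)
    (hno : ∀ l : MvPolynomial σ k, l.IsHomogeneous 1 → ¬ augIdeal k σ G ≤ Ideal.span {l})
    {τ : Type} [Fintype τ] {m : τ → MvPolynomial σ k} {δ : τ → ℕ}
    (hm : ∀ t, (m t).IsHomogeneous (δ t)) (hδ : ∀ t, 0 < δ t) (hind : LIndPow m)
    (hspan : Ideal.span (Set.range m) = opIdeal Φ) (t : τ) :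
    m t - π (m t) ∈ Ideal.span (m '' {u | δ u < δ t}) := by
  induction hD : δ t using Nat.strong_induction_on generalizing t with
  | _ D ih =>
    subst hD
    set Q := Ideal.span (m '' {u | δ u < δ t}) with hQdef
    have hQ : Q = Ideal.span ((fun u => π (m u)) '' {u | δ u < δ t}) :=
      span_image_le_of_sub_mem fun u hu => ih (δ u) hu u rfl
    have hfix : ∀ x ∈ (fun u => π (m u)) '' {u | δ u < δ t},
        x ∈ fixedRing G (MvPolynomial σ k) := by
      rintro _ ⟨u, -, rfl⟩
      exact h.isInvLin.mem _
    have hQG : ∀ g ∈ G, ∀ x ∈ Q, g • x ∈ Q := fun g hg x hx => by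
      rw [hQ] at hx ⊢
      exact smul_mem_span_of_fixed hfix hg hx
    have hQπ : ∀ x ∈ Q, π x ∈ Q := fun x hx => by
      rw [hQ] at hx ⊢
      exact h.isInvLin.mem_span hfix hx
    have hmP : m t ∈ opIdeal Φ := hspan ▸ Ideal.subset_span ⟨t, rfl⟩
    have hΦ : ∀ φ ∈ Φ, φ (m t) ∈ Q := fun φ hφ =>
      h.isOpSystem.map_mem_span_of_lt hm hspan hφ hmP (hm t)
    have hGm : ∀ g ∈ G, g • m t - m t ∈ Q := by
      refine smul_sub_mem_of_closure hrefl.symm hQG ?_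
      rintro g ⟨hg, hr⟩
      obtain ⟨l, hl, hdvd⟩ := hr
      obtain ⟨y, hy, hyQ⟩ := h.exists_sub_mem hΦ (hno l hl)
      have hgy : g • y = y := hy g (IsReflOrOne.mem_reflSub ⟨l, hl, hdvd⟩
        (mem_inertia.2 ⟨hg, fun s => Ideal.mem_span_singleton.2 (hdvd s)⟩))
      rw [show g • m t - m t = g • (m t - y) - (m t - y) by rw [smul_sub, hgy]; ring]
      exact sub_mem (hQG g hg _ hyQ) hyQ
    set 𝔠 : Ideal (MvPolynomial σ k) := Submodule.comap
      (LinearMap.mulRight (MvPolynomial σ k) (m t - π (m t))) Q with h𝔠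
    have hmem𝔠 : ∀ x, x ∈ 𝔠 ↔ x * (m t - π (m t)) ∈ Q := fun x => Iff.rfl
    have hrad : m t ∈ 𝔠.radical := by
      rw [Ideal.radical_eq_sInf, Submodule.mem_sInf]
      rintro q ⟨h𝔠q, hq⟩
      by_contra hmq
      have hnq : ¬ augIdeal k σ G ≤ q := fun hle => hmq (hle (h.opIdeal_le hmP))
      obtain ⟨y, hy, hyQ⟩ := h.exists_sub_mem hΦ hnq
      obtain ⟨a, ha, haq, a', ha', haa'⟩ := exists_mul_sub_mem (I := inertia G q) rfl
        (HasSplitting.toInertia ⟨π, h.isInvLin, h.map_one⟩ q) hQG hGm hy hyQ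
      refine haq (h𝔠q ((hmem𝔠 a).2 ?_))
      have h1 := hQπ _ haa'
      rw [map_sub, h.isInvLin.map_mul a ha, h.isInvLin.map_of_mem h.map_one ha'] at h1
      rw [show a * (m t - π (m t)) = (a * m t - a') - (a * π (m t) - a') by ring]
      exact sub_mem haa' h1
    obtain ⟨N, hN⟩ := hrad
    refine hind.mem_span_of_mul_pow_mem hm hδ (r := t) (N := N) (by simp) ?_
    rw [mul_comm]
    exact hN

theorem exists_isParams [Finite σ] [Finite G] (p : ℕ) [Fact p.Prime] [CharP k p]
    (h : IsCoreData G L π Φ) (hrefl : reflSub k σ G = G)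
    (hno : ∀ l : MvPolynomial σ k, l.IsHomogeneous 1 → ¬ augIdeal k σ G ≤ Ideal.span {l}) :
    ∃ (τ : Type) (_ : Fintype τ) (f : τ → MvPolynomial σ k) (δ : τ → ℕ), IsParams G L f δ := by
  obtain ⟨r, ⟨m, hm⟩, hirr⟩ := exists_minimal_isGen (opIdeal_isHomog (Φ := Φ))
  choose δ hδ using hm.1
  have hpos := pos_of_irredundant hδ (fun t => opIdeal_le_irrel
    (hm.2 ▸ Ideal.subset_span ⟨t, rfl⟩ : m t ∈ opIdeal Φ)) (hirr m hm)
  have hind : LIndPow m := LIndPow.of_lInd p (h.isOpSystem.lInd hδ hm.2 (hirr m hm))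
  have hsub := h.sub_map_mem hrefl hno hδ hpos hind hm.2
  have hall : {u | δ u < ∑ u, δ u + 1} = Set.univ := by
    ext u
    have := Finset.single_le_sum (f := δ) (fun _ _ => Nat.zero_le _) (Finset.mem_univ u)
    simp only [Set.mem_ofPred_eq, Set.mem_univ, iff_true]
    omega
  have hspan := span_image_le_of_sub_mem (f := fun u => π (m u)) (D := ∑ u, δ u + 1)
    fun u _ => hsub u
  rw [hall, Set.image_univ, Set.image_univ, hm.2] at hspan
  have hf : IsGen (opIdeal Φ) fun u => π (m u) := ⟨fun t => ⟨δ t, h.homog _ _ (hδ t)⟩, hspan.symm⟩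
  have hfmem : ∀ t, π (m t) ∈ opIdeal Φ := fun t => hspan.symm ▸ Ideal.subset_span ⟨t, rfl⟩
  refine ⟨Fin r, inferInstance, fun u => π (m u), δ, IsParams.of_exists h.linear h.ker_eq
    (fun t => h.isInvLin.mem _) (fun t => h.homog _ _ (hδ t)) hpos
    (LIndPow.of_lInd p (h.isOpSystem.lInd (fun t => h.homog _ _ (hδ t)) hspan.symm
      (hirr _ hf))) (fun t => h.opIdeal_le (hfmem t)) fun a ha haug => ?_⟩
  obtain ⟨c, hc⟩ := Ideal.mem_span_range_iff_exists_fun.1 (hspan ▸ h.mem_opIdeal ha haug)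
  refine ⟨fun t => π (c t), fun t => h.isInvLin.mem _, ?_⟩
  conv_lhs => rw [← h.isInvLin.map_of_mem h.map_one ha, ← hc, map_sum]
  refine Finset.sum_congr rfl fun t _ => ?_
  rw [mul_comm, h.isInvLin.map_mul _ (h.isInvLin.mem _), mul_comm]

end IsCoreData

/-- In positive characteristic, a reflection group with a splitting admits parameters. -/
theorem exists_isParams [Finite σ] (p : ℕ) [Fact p.Prime] [CharP k p] (N : ℕ) :
    ∀ G : Subgroup Γ, Finite G → Nat.card G = N → reflSub k σ G = G → HasSplitting k σ G →
      ∀ (κ : Type) (L : σ → MvPolynomial κ k), (∀ i, (L i).IsHomogeneous 1) →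
      RingHom.ker (aeval L : MvPolynomial σ k →ₐ[k] MvPolynomial κ k) = augIdeal k σ G →
      ∃ (τ : Type) (_ : Fintype τ) (f : τ → MvPolynomial σ k) (δ : τ → ℕ), IsParams G L f δ := by
  induction N using Nat.strong_induction_on with
  | _ N ih =>
    intro G hfin hN hrefl hsplit κ L hL hker
    by_cases hex : ∃ l : MvPolynomial σ k, l.IsHomogeneous 1 ∧ augIdeal k σ G ≤ Ideal.span {l}
    · obtain ⟨l, hl, hle⟩ := hex
      exact exists_isParams_of_dvd hL hker hl fun g hg s =>
        Ideal.mem_span_singleton.1 (hle (smul_sub_mem_augIdeal hg s))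
    push Not at hex
    have hdual : ∀ q : {q : Ideal (MvPolynomial σ k) // ¬ augIdeal k σ G ≤ q},
        HasDualBasis k σ (reflSub k σ (inertia G q.1)) := by
      rintro ⟨q, hq⟩
      have hle : reflSub k σ (inertia G q) ≤ inertia G q := reflSub_le _
      have hfinI : Finite (inertia G q) :=
        Set.Finite.subset (Set.toFinite (G : Set Γ)) (inertia_le G q)
      have hfinH : Finite (reflSub k σ (inertia G q)) :=
        Set.Finite.subset (Set.toFinite (G : Set Γ)) (hle.trans (inertia_le G q))
      have hlt : Nat.card (reflSub k σ (inertia G q)) < N := by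
        rw [← hN]
        refine lt_of_le_of_lt (Subgroup.card_le_of_le hle) ?_
        refine lt_of_le_of_ne (Subgroup.card_le_of_le (inertia_le G q)) fun hcard => hq ?_
        exact inertia_eq_iff.1 (Subgroup.eq_of_le_of_card_ge (inertia_le G q) hcard.ge)
      obtain ⟨κ', L', hL', hker'⟩ :=
        exists_linear_quotient_augIdeal (k := k) (σ := σ) (reflSub k σ (inertia G q))
      obtain ⟨τ, _, f, δ, hf⟩ := ih _ hlt _ hfinH rfl (reflSub_reflSub _)
        (hsplit.toInertia q).toReflSub κ' L' hL' hker'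
      exact hf.exists_isDualBasis
    choose J hJ e δ φ j₀ hφ using hdual
    obtain ⟨π, hπ, hπ1⟩ := hsplit
    have hcore : IsCoreData G L (degZero π)
        (hasse L '' {α | α ≠ 0} ∪ ⋃ q, φ q '' {j | j ≠ j₀ q}) := by
      refine ⟨hL, hker, hπ.degZero, ?_, fun d s hs => degZero_isHomogeneous π hs,
        (isOpSystem_hasse hL).union (IsOpSystem.iUnion fun q => (hφ q).isOpSystem),
        fun α hα => Or.inl ⟨α, hα, rfl⟩, fun q hq => ?_, ?_⟩
      · rw [degZero_of_isHomogeneous π (isHomogeneous_one _ _), hπ1,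
          homogeneousComponent_eq_self ((mem_homogeneousSubmodule _ _).2 (isHomogeneous_one _ _))]
      · exact ⟨_, _, _, _, _, _, hφ ⟨q, hq⟩, fun j hj =>
          Or.inr (Set.mem_iUnion.2 ⟨⟨q, hq⟩, j, hj, rfl⟩)⟩
      · rintro ψ (⟨α, -, rfl⟩ | hψ)
        · exact Or.inl ⟨α, rfl⟩
        · obtain ⟨q, j, -, rfl⟩ := Set.mem_iUnion.1 hψ
          refine Or.inr fun a ha s => ((hφ q).isInvLin j).map_mul a (fixedRing_anti ?_ ha) s
          exact (reflSub_le _).trans (inertia_le G _)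
    exact hcore.exists_isParams p hrefl hex

end Core

section Exchange

variable {S : Type} [CommRing S] {τ : Type} [Fintype τ]

theorem LIndPow.of_pow {m : τ → S} {e : τ → ℕ} (he : ∀ t, 0 < e t)
    (h : LIndPow fun t => m t ^ e t) : LIndPow m := by
  refine LIndPow.of_frequently fun N => ⟨(N + 1) * ∏ t, e t, ?_, ?_⟩
  · have : 0 < ∏ t, e t := Finset.prod_pos fun t _ => he t
    nlinarith
  · have hd : ∀ t, e t ∣ (N + 1) * ∏ t, e t := fun t =>
      (Finset.dvd_prod_of_mem e (Finset.mem_univ t)).mul_left _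
    have h0 : 0 < (N + 1) * ∏ t, e t :=
      Nat.mul_pos (Nat.succ_pos _) (Finset.prod_pos fun t _ => he t)
    have := h (fun t => ((N + 1) * ∏ t, e t) / e t) fun t =>
      Nat.div_pos (Nat.le_of_dvd h0 (hd t)) (he t)
    simpa only [← pow_mul, Nat.mul_div_cancel' (hd _)] using this

theorem LInd.update_add [DecidableEq τ] {m : τ → S} {t₀ : τ} {h : S} {v : τ → S}
    (hm : LInd (Function.update m t₀ (h + ∑ t ∈ Finset.univ.erase t₀, v t * m t))) :
    LInd (Function.update m t₀ h) := by
  have hsplit : ∀ F : τ → S, ∑ t, F t = F t₀ + ∑ t ∈ Finset.univ.erase t₀, F t := fun F =>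
    (Finset.add_sum_erase _ F (Finset.mem_univ t₀)).symm
  have hcongr : ∀ (s : τ → S) (x : S),
      ∑ t ∈ Finset.univ.erase t₀, s t * Function.update m t₀ x t =
        ∑ t ∈ Finset.univ.erase t₀, s t * m t := fun s x =>
    Finset.sum_congr rfl fun t ht => by rw [Function.update_of_ne (Finset.ne_of_mem_erase ht)]
  have hmem : ∀ t ∈ Finset.univ.erase t₀,
      m t ∈ Ideal.span (Set.range (Function.update m t₀ h)) := fun t ht =>
    Ideal.subset_span ⟨t, Function.update_of_ne (Finset.ne_of_mem_erase ht) _ _⟩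
  have hle : Ideal.span (Set.range
      (Function.update m t₀ (h + ∑ t ∈ Finset.univ.erase t₀, v t * m t))) ≤
      Ideal.span (Set.range (Function.update m t₀ h)) := by
    rw [Ideal.span_le]
    rintro _ ⟨t, rfl⟩
    by_cases ht : t = t₀
    · subst ht
      rw [Function.update_self]
      exact add_mem (Ideal.subset_span ⟨t, Function.update_self _ _ _⟩)
        (sum_mem fun u hu => Ideal.mul_mem_left _ _ (hmem u hu))
    · rw [Function.update_of_ne ht]
      exact hmem t (by simp [ht])
  intro s hs
  rw [hsplit, Function.update_self, hcongr] at hs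
  have key := hm (Function.update (fun t => s t - s t₀ * v t) t₀ (s t₀)) (by
    rw [hsplit, hcongr, Function.update_self, Function.update_self]
    have : ∑ t ∈ Finset.univ.erase t₀, Function.update (fun t => s t - s t₀ * v t) t₀ (s t₀) t * m t
        = ∑ t ∈ Finset.univ.erase t₀, s t * m t -
          s t₀ * ∑ t ∈ Finset.univ.erase t₀, v t * m t := by
      rw [Finset.mul_sum, ← Finset.sum_sub_distrib]
      refine Finset.sum_congr rfl fun t ht => ?_
      rw [Function.update_of_ne (Finset.ne_of_mem_erase ht)]
      ring
    rw [this]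
    linear_combination hs)
  have h0 := hle (key t₀)
  rw [Function.update_self] at h0
  intro t
  by_cases ht : t = t₀
  · rwa [ht]
  · have h2 := hle (key t)
    rw [Function.update_of_ne ht] at h2
    have h3 := add_mem h2 (Ideal.mul_mem_right (v t) _ h0)
    rwa [sub_add_cancel] at h3

theorem LIndPow.update [DecidableEq τ] {m : τ → S} (hm : LIndPow m) {t₀ : τ} {h : S}
    (hr : m t₀ ∈ (Ideal.span (Set.range (Function.update m t₀ h))).radical) :
    LIndPow (Function.update m t₀ h) := by
  intro a ha
  have hrad : (Ideal.span (Set.range (Function.update m t₀ h))).radical ≤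
      (Ideal.span (Set.range fun t => Function.update m t₀ h t ^ a t)).radical := by
    rw [Ideal.radical_le_radical_iff, Ideal.span_le]
    rintro _ ⟨t, rfl⟩
    exact ⟨a t, Ideal.subset_span ⟨t, rfl⟩⟩
  obtain ⟨N, hN⟩ := hrad hr
  have hN1 := Ideal.mul_mem_left _ (m t₀) hN
  rw [← pow_succ'] at hN1
  obtain ⟨c, hc⟩ := Ideal.mem_span_range_iff_exists_fun.1 hN1
  rw [← Finset.add_sum_erase _ _ (Finset.mem_univ t₀), Function.update_self] at hc
  have h1 := hm (Function.update a t₀ (N + 1)) fun t => by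
    by_cases ht : t = t₀
    · subst ht; simp
    · rw [Function.update_of_ne ht]; exact ha t
  have e1 : (fun t => m t ^ Function.update a t₀ (N + 1) t) =
      Function.update (fun t => m t ^ a t) t₀ (h ^ a t₀ * c t₀ +
        ∑ t ∈ Finset.univ.erase t₀, c t * (fun t => m t ^ a t) t) := by
    funext t
    by_cases ht : t = t₀
    · subst ht
      rw [Function.update_self, Function.update_self, ← hc, mul_comm (c t)]
      congr 1
      refine Finset.sum_congr rfl fun u hu => ?_
      rw [Function.update_of_ne (Finset.ne_of_mem_erase hu)]
    · rw [Function.update_of_ne ht, Function.update_of_ne ht]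
  rw [e1] at h1
  convert h1.update_add.of_mul using 1
  funext t
  by_cases ht : t = t₀
  · subst ht
    rw [Function.update_self, Function.update_self]
  · rw [Function.update_of_ne ht, Function.update_of_ne ht]

theorem LIndPow.of_path [DecidableEq τ] {a b : τ → S} (hb : LIndPow b)
    (h : ∀ (T : Finset τ) (t : τ), b t ∈
      (Ideal.span (Set.range fun u => if u ∈ T then a u else b u)).radical) : LIndPow a := by
  suffices H : ∀ T : Finset τ, LIndPow fun u => if u ∈ T then a u else b u by
    simpa using H Finset.univ
  intro T
  induction T using Finset.induction_on with
  | empty => simpa using hb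
  | insert t T ht ih =>
    have e : (fun u => if u ∈ insert t T then a u else b u) =
        Function.update (fun u => if u ∈ T then a u else b u) t (a t) := by
      funext u
      by_cases hu : u = t
      · subst hu; simp
      · simp [hu]
    rw [e]
    refine ih.update ?_
    rw [← e]
    simpa [ht] using h (insert t T) t

end Exchange

section Deformation

variable {σ : Type}

theorem lIndPow_X [Fintype σ] : LIndPow (X : σ → MvPolynomial σ k) := by
  classical
  intro a _ s hs t
  have e : (Set.range fun i => (X i : MvPolynomial σ k) ^ a i) =
      (fun s => monomial s (1 : k)) '' (Set.range fun i => Finsupp.single i (a i)) := by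
    rw [← Set.range_comp]
    congr 1
    funext i
    simp [X_pow_eq_monomial]
  rw [e, mem_ideal_span_monomial_image]
  intro γ hγ
  by_contra hcon
  refine mem_support_iff.1 hγ ?_
  have h1 := congrArg (coeff (γ + Finsupp.single t (a t))) hs
  rw [coeff_sum, Finset.sum_eq_single t] at h1
  · simpa [X_pow_eq_monomial] using h1
  · intro u _ hut
    change coeff _ (s u * X u ^ a u) = 0
    rw [X_pow_eq_monomial, coeff_mul_monomial', if_neg]
    intro hle
    refine hcon ⟨_, ⟨u, rfl⟩, ?_⟩
    rw [Finsupp.single_le_iff] at hle ⊢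
    simpa [hut, Ne.symm hut] using hle
  · simp

theorem monomial_mem_span_add [Finite σ] {τ K : Type} [Fintype τ] [Field K] [Algebra k K] {s : K}
    (hs : Transcendental k s) {g h : τ → MvPolynomial σ k} {N : ℕ}
    (hg : ∀ t, (g t).IsHomogeneous N) (hh : ∀ t, (h t).IsHomogeneous N) {D : ℕ}
    (hD : ∀ x : MvPolynomial σ k, x.IsHomogeneous D → x ∈ Ideal.span (Set.range g))
    (hND : N ≤ D) {β : σ →₀ ℕ} (hβ : β.degree = D) :
    (monomial β 1 : MvPolynomial σ K) ∈ Ideal.span (Set.range fun t =>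
      MvPolynomial.map (algebraMap k K) (g t) +
        C s * MvPolynomial.map (algebraMap k K) (h t)) := by
  classical
  let B := {γ : σ →₀ ℕ // γ.degree = D}
  have hfin : Finite B := (Finsupp.finite_of_degree_le (σ := σ) D).subset (fun γ hγ => le_of_eq hγ)
  have := Fintype.ofFinite B
  have hex : ∀ γ : B, ∃ c : τ → MvPolynomial σ k, monomial γ.1 1 = ∑ t, c t * g t ∧
      ∀ t, (c t).IsHomogeneous (D - N) := by
    intro γ
    have hγ : (monomial γ.1 (1 : k)).IsHomogeneous D := isHomogeneous_monomial _ γ.2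
    obtain ⟨c, hc, hc'⟩ := exists_homogeneous_coeffs hg (hD _ hγ) D
    rw [homogeneousComponent_of_mem hγ, if_pos rfl] at hc
    exact ⟨c, hc, fun t => (hc' t).1⟩
  choose c hc hc' using hex
  let E : Matrix B B k := fun γ γ' => coeff γ'.1 (∑ t, c γ t * h t)
  have hhom : ∀ γ, (∑ t, c γ t * h t).IsHomogeneous D := fun γ =>
    IsHomogeneous.sum _ _ _ fun t _ => by
      have := (hc' γ t).mul (hh t)
      rwa [Nat.sub_add_cancel hND] at this
  have hE : ∀ γ, ∑ t, c γ t * h t = ∑ γ' : B, C (E γ γ') * monomial γ'.1 1 := by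
    intro γ
    ext δ
    rw [coeff_sum (Finset.univ : Finset B)]
    simp only [coeff_C_mul, coeff_monomial, mul_ite, mul_one, mul_zero]
    by_cases hδ : δ.degree = D
    · rw [Finset.sum_eq_single (⟨δ, hδ⟩ : B)]
      · simp [E, coeff_sum]
      · rintro ⟨b, hb⟩ _ hne
        rw [if_neg]
        rintro rfl
        exact hne rfl
      · simp
    · rw [(hhom γ).coeff_eq_zero hδ, Finset.sum_eq_zero]
      rintro ⟨b, hb⟩ _
      rw [if_neg]
      rintro rfl
      exact hδ hb
  let P : Polynomial k := (1 + (Polynomial.X : Polynomial k) • E.map Polynomial.C).det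
  have hP0 : P ≠ 0 := by
    intro h0
    have h1 : Polynomial.eval 0 P = 1 := by
      have := RingHom.map_det (Polynomial.evalRingHom (0 : k))
        (1 + (Polynomial.X : Polynomial k) • E.map Polynomial.C)
      rw [Polynomial.coe_evalRingHom] at this
      rw [show P = _ from rfl, this]
      convert Matrix.det_one (n := B) (R := k)
      ext i j
      simp [Matrix.one_apply, apply_ite]
    rw [h0] at h1
    simp at h1
  let M : Matrix B B K := 1 + s • E.map (algebraMap k K)
  have hM : M.det ≠ 0 := by
    intro h0
    refine hs ⟨P, hP0, ?_⟩
    have := RingHom.map_det (Polynomial.aeval (R := k) s).toRingHom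
      (1 + (Polynomial.X : Polynomial k) • E.map Polynomial.C)
    rw [← h0]
    refine this.trans ?_
    congr 1
    ext i j
    simp [M, Matrix.one_apply, apply_ite]
    exact mul_comm _ _
  have hrow : ∀ γ : B, ∑ γ' : B, C (M γ γ') * (monomial γ'.1 1 : MvPolynomial σ K) ∈
      Ideal.span (Set.range fun t => MvPolynomial.map (algebraMap k K) (g t) +
        C s * MvPolynomial.map (algebraMap k K) (h t)) := by
    intro γ
    have e : ∑ γ' : B, C (M γ γ') * (monomial γ'.1 1 : MvPolynomial σ K) =
        ∑ t, MvPolynomial.map (algebraMap k K) (c γ t) *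
          (MvPolynomial.map (algebraMap k K) (g t) +
            C s * MvPolynomial.map (algebraMap k K) (h t)) := by
      have h1 := congrArg (MvPolynomial.map (algebraMap k K)) (hc γ)
      have h2 := congrArg (MvPolynomial.map (algebraMap k K)) (hE γ)
      simp only [map_sum, map_mul, MvPolynomial.map_monomial, map_one, MvPolynomial.map_C] at h1 h2
      simp only [mul_add, Finset.sum_add_distrib, ← h1, mul_left_comm _ (C s), ← Finset.mul_sum, h2]
      simp only [M, Matrix.add_apply, Matrix.smul_apply, Matrix.map_apply, smul_eq_mul, map_add,
        map_mul, add_mul, Finset.sum_add_distrib, Finset.mul_sum, mul_assoc]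
      congr 1
      rw [Finset.sum_eq_single γ]
      · simp
      · intro b _ hb
        simp [Matrix.one_apply_ne (Ne.symm hb)]
      · simp
    rw [e]
    exact sum_mem fun t _ => Ideal.mul_mem_left _ _ (Ideal.subset_span ⟨t, rfl⟩)
  have hinv : M⁻¹ * M = 1 := Matrix.nonsing_inv_mul _ (Ne.isUnit hM)
  have e : (monomial β 1 : MvPolynomial σ K) = ∑ γ : B, C (M⁻¹ ⟨β, hβ⟩ γ) *
      ∑ γ' : B, C (M γ γ') * (monomial γ'.1 1 : MvPolynomial σ K) := by
    simp only [Finset.mul_sum]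
    rw [Finset.sum_comm]
    have : ∀ γ' : B, ∑ γ : B, C (M⁻¹ ⟨β, hβ⟩ γ) * (C (M γ γ') *
        (monomial γ'.1 1 : MvPolynomial σ K)) =
        C ((1 : Matrix B B K) ⟨β, hβ⟩ γ') * monomial γ'.1 1 := by
      intro γ'
      rw [← hinv, Matrix.mul_apply, map_sum, Finset.sum_mul]
      simp only [map_mul, mul_assoc]
    simp only [this]
    rw [Finset.sum_eq_single (⟨β, hβ⟩ : B)]
    · simp
    · intro b _ hb
      simp [Matrix.one_apply_ne (Ne.symm hb)]
    · simp
  rw [e]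
  exact sum_mem fun γ _ => Ideal.mul_mem_left _ _ (hrow γ)

theorem exists_isHomogeneous_mem [Fintype σ] {I : Ideal (MvPolynomial σ k)}
    (h : ∀ i, X i ∈ I.radical) :
    ∃ D₀, ∀ D, D₀ ≤ D → ∀ x : MvPolynomial σ k, x.IsHomogeneous D → x ∈ I := by
  choose M hM using h
  refine ⟨∑ i, M i + 1, fun D hD x hx => ?_⟩
  rw [x.as_sum]
  refine sum_mem fun γ hγ => ?_
  have hdeg : γ.degree = D := by
    by_contra hne
    exact mem_support_iff.1 hγ (hx.coeff_eq_zero hne)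
  obtain ⟨i, hi⟩ : ∃ i, M i ≤ γ i := by
    by_contra! hcon
    have : γ.degree ≤ ∑ i, M i := by
      rw [Finsupp.degree_eq_sum]
      exact Finset.sum_le_sum fun i _ => (hcon i).le
    omega
  refine Ideal.mem_of_dvd _ ?_ (hM i)
  rw [X_pow_eq_monomial, monomial_dvd_monomial]
  exact ⟨Or.inr (by simpa using hi), one_dvd _⟩

theorem mem_radical_of_X [Fintype σ] {I : Ideal (MvPolynomial σ k)} (h : ∀ i, X i ∈ I.radical)
    {x : MvPolynomial σ k} {d : ℕ} (hx : x.IsHomogeneous d) (hd : 0 < d) : x ∈ I.radical := by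
  obtain ⟨D, hD⟩ := exists_isHomogeneous_mem h
  exact ⟨D, hD (d * D) (Nat.le_mul_of_pos_left D hd) _ (hx.pow D)⟩

theorem X_mem_radical_span_add [Fintype σ] {τ K : Type} [Fintype τ] [Field K] [Algebra k K] {s : K}
    (hs : Transcendental k s) {g h : τ → MvPolynomial σ k} {N : ℕ}
    (hg : ∀ t, (g t).IsHomogeneous N) (hh : ∀ t, (h t).IsHomogeneous N)
    (hX : ∀ i, X i ∈ (Ideal.span (Set.range g)).radical) (i : σ) :
    (X i : MvPolynomial σ K) ∈ (Ideal.span (Set.range fun t =>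
      MvPolynomial.map (algebraMap k K) (g t) +
        C s * MvPolynomial.map (algebraMap k K) (h t))).radical := by
  obtain ⟨D, hD⟩ := exists_isHomogeneous_mem hX
  refine ⟨D + N, ?_⟩
  rw [X_pow_eq_monomial]
  exact monomial_mem_span_add hs hg hh (hD (D + N) (by omega)) (by omega) (by simp)

/-- Homogeneous polynomials of positive degree, as many as there are variables and with only the
trivial common zero, satisfy `LIndPow`. -/
theorem lIndPow_of_X_mem_radical [Fintype σ] {f : σ → MvPolynomial σ k} {δ : σ → ℕ}
    (hf : ∀ t, (f t).IsHomogeneous (δ t)) (hδ : ∀ t, 0 < δ t)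
    (hX : ∀ i, X i ∈ (Ideal.span (Set.range f)).radical) : LIndPow f := by
  classical
  let N := ∏ t, δ t
  have hN : 0 < N := Finset.prod_pos fun t _ => hδ t
  have hd : ∀ t, δ t ∣ N := fun t => Finset.dvd_prod_of_mem δ (Finset.mem_univ t)
  have he : ∀ t, 0 < N / δ t := fun t => Nat.div_pos (Nat.le_of_dvd hN (hd t)) (hδ t)
  refine LIndPow.of_pow he ?_
  let F : σ → MvPolynomial σ k := fun t => f t ^ (N / δ t)
  have hF : ∀ t, (F t).IsHomogeneous N := fun t => by
    have := (hf t).pow (N / δ t)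
    rwa [Nat.mul_div_cancel' (hd t)] at this
  have hXF : ∀ i, X i ∈ (Ideal.span (Set.range F)).radical := by
    intro i
    refine (Ideal.radical_le_radical_iff.2 (Ideal.span_le.2 ?_)) (hX i)
    rintro _ ⟨t, rfl⟩
    exact ⟨N / δ t, Ideal.subset_span ⟨t, rfl⟩⟩
  let P : σ → MvPolynomial σ k := fun t => X t ^ N
  have hP : ∀ t, (P t).IsHomogeneous N := fun t => by
    simpa using (isHomogeneous_X k t).pow N
  have hXP : ∀ i, X i ∈ (Ideal.span (Set.range P)).radical := fun i =>
    ⟨N, Ideal.subset_span ⟨i, rfl⟩⟩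
  let K := RatFunc k
  let s : K := RatFunc.X
  have hs : Transcendental k s := RatFunc.transcendental_X
  have hs0 : s ≠ 0 := RatFunc.X_ne_zero
  have hs' : Transcendental k s⁻¹ := fun h => hs (IsAlgebraic.inv_iff.1 h)
  let μ : MvPolynomial σ k →+* MvPolynomial σ K := MvPolynomial.map (algebraMap k K)
  have hμ : ∀ {x : MvPolynomial σ k}, x.IsHomogeneous N → (μ x).IsHomogeneous N := fun hx =>
    hx.map _
  have h0 : LIndPow fun t => μ (P t) := by
    have : LIndPow fun t : σ => (X t : MvPolynomial σ K) ^ N := lIndPow_X.pow fun _ => hN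
    simpa [μ, P] using this
  have h1 : LIndPow fun t => μ (P t) + C s * μ (F t) := by
    refine LIndPow.of_path h0 fun T t => mem_radical_of_X (fun i => ?_) (hμ (hP t)) hN
    have := X_mem_radical_span_add hs (g := P) (h := fun u => if u ∈ T then F u else 0) hP
      (fun u => by split_ifs; exacts [hF u, isHomogeneous_zero _ _ _]) hXP i
    convert this using 5 with u
    by_cases hu : u ∈ T <;> simp [hu, μ]
  have h2 : LIndPow fun t => μ (F t) := by
    refine LIndPow.of_path h1 fun T t => mem_radical_of_X (fun i => ?_)
      ((hμ (hP t)).add ((hμ (hF t)).C_mul s)) hN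
    have := X_mem_radical_span_add hs' (g := F) (h := fun u => if u ∈ T then 0 else P u) hF
      (fun u => by split_ifs; exacts [isHomogeneous_zero _ _ _, hP u]) hXF i
    refine (Ideal.radical_mono (Ideal.span_le.2 ?_)) this
    rintro _ ⟨u, rfl⟩
    have hmem : (if u ∈ T then μ (F u) else μ (P u) + C s * μ (F u)) ∈ Ideal.span
        (Set.range fun u => if u ∈ T then μ (F u) else μ (P u) + C s * μ (F u)) :=
      Ideal.subset_span ⟨u, rfl⟩
    by_cases hu : u ∈ T
    · simpa [hu, μ] using hmem
    · rw [if_neg hu] at hmem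
      have h3 := Ideal.mul_mem_left _ (C s⁻¹) hmem
      have h4 : C s⁻¹ * (μ (P u) + C s * μ (F u)) = μ (F u) + C s⁻¹ * μ (P u) := by
        rw [mul_add, ← mul_assoc, ← C_mul, inv_mul_cancel₀ hs0, C_1, one_mul, add_comm]
      rw [h4] at h3
      simpa [hu, μ] using h3
  intro a ha
  have := h2 a ha
  refine LInd.of_map (algebraMap k K) ?_
  simpa [μ, F] using this

end Deformation

section Generators

variable {σ τ : Type}

theorem constantCoeff_aeval {f : τ → MvPolynomial σ k} (hf : ∀ t, f t ∈ irrel σ k)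
    (P : MvPolynomial τ k) : constantCoeff (aeval f P) = constantCoeff P := by
  have h : (constantCoeff : MvPolynomial σ k →+* k).comp (aeval f).toRingHom = constantCoeff := by
    refine MvPolynomial.ringHom_ext (fun r => by simp) fun t => ?_
    have : constantCoeff (f t) = 0 := hf t
    simp [this]
  exact RingHom.congr_fun h P

theorem mem_span_X {P : MvPolynomial τ k} (hP : constantCoeff P = 0) :
    P ∈ Ideal.span (Set.range (X : τ → MvPolynomial τ k)) := by
  rw [← Set.image_univ, mem_ideal_span_X_image]
  intro γ hγ
  by_contra! hcon
  refine mem_support_iff.1 hγ ?_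
  have : γ = 0 := by
    ext i
    simpa using hcon i
  rw [this]
  exact hP

theorem exists_eq_sum_mul_X [Fintype τ] {P : MvPolynomial τ k} (hP : constantCoeff P = 0) {D : ℕ}
    (hD : ∀ d, D ≤ d → homogeneousComponent d P = 0) :
    ∃ Q : τ → MvPolynomial τ k, (∀ t d, D - 1 ≤ d → homogeneousComponent d (Q t) = 0) ∧
      P = ∑ t, Q t * X t := by
  choose c hc hc' using exists_homogeneous_coeffs (m := (X : τ → MvPolynomial τ k))
    (δ := fun _ => 1) (fun t => isHomogeneous_X k t) (mem_span_X hP)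
  refine ⟨fun t => ∑ d ∈ Finset.range D, c d t, fun t e he => ?_, ?_⟩
  · rw [map_sum]
    refine Finset.sum_eq_zero fun d hd => ?_
    rw [Finset.mem_range] at hd
    rcases Nat.eq_zero_or_pos d with rfl | hd0
    · rw [(hc' 0 t).2 (by omega), map_zero]
    · rw [homogeneousComponent_of_mem (hc' d t).1, if_neg (by omega)]
  · rw [← sum_range_homogeneousComponent_of_le hD]
    simp only [Finset.sum_mul]
    rw [Finset.sum_comm]
    exact Finset.sum_congr rfl fun d _ => hc d

theorem exists_bound (P : MvPolynomial τ k) :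
    ∃ D, ∀ d, D ≤ d → homogeneousComponent d P = 0 :=
  ⟨P.totalDegree + 1, fun d hd => homogeneousComponent_eq_zero _ _ (by omega)⟩

/-- Polynomials all of whose terms have degree less than `D`. -/
noncomputable def degLT (τ k : Type) [Field k] (D : ℕ) : AddSubgroup (MvPolynomial τ k) where
  carrier := {P | ∀ d, D ≤ d → homogeneousComponent d P = 0}
  zero_mem' := fun d _ => map_zero _
  add_mem' := fun ha hb d hd => by rw [map_add, ha d hd, hb d hd, add_zero]
  neg_mem' := fun ha d hd => by rw [map_neg, ha d hd, neg_zero]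

theorem LIndPow.algebraicIndependent [Fintype τ] {f : τ → MvPolynomial σ k} {δ : τ → ℕ}
    (hind : LIndPow f) (hf : ∀ t, (f t).IsHomogeneous (δ t)) (hδ : ∀ t, 0 < δ t) :
    AlgebraicIndependent k f := by
  have hirr : ∀ t, f t ∈ irrel σ k := fun t => (hf t).mem_irrel (hδ t)
  rw [algebraicIndependent_iff]
  intro P hP
  obtain ⟨D, hD⟩ := exists_bound P
  refine hind.eq_zero_of_map_eq_zero hf hδ (fun t => AddMonoidHom.mulRight (X t))
    (aeval f : MvPolynomial τ k →ₐ[k] MvPolynomial σ k).toRingHom.toAddMonoidHom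
    (fun t x => ?_) (degLT τ k) (fun x hx => ?_) (w := fun _ => 1)
    (fun _ => one_pos) (fun t D x hx d hd => ?_) (fun s t x => ?_) (fun D x hx hLx => ?_) hD hP
  · exact (map_mul (aeval f) x (X t)).trans (congrArg _ (aeval_X f t))
  · rw [← sum_range_homogeneousComponent_of_le hx, Finset.range_zero, Finset.sum_empty]
  · have := homogeneousComponent_mul_of_isHomogeneous (isHomogeneous_X k t) x d
    rw [hx _ (by omega), zero_mul, ite_self] at this
    exact this
  · exact mul_right_comm _ _ _
  · have h0 : constantCoeff x = 0 := by
      rw [← constantCoeff_aeval hirr]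
      exact (Ideal.span_le.2 (by rintro _ ⟨t, rfl⟩; exact hirr t) : _ ≤ irrel σ k) hLx
    obtain ⟨Q, hQ, hx⟩ := exists_eq_sum_mul_X h0 hx
    exact ⟨Q, hQ, hx⟩

end Generators

section Forward

variable {Γ σ κ τ : Type} [Group Γ] [MulSemiringAction Γ (MvPolynomial σ k)] [LinAct Γ σ k]

theorem posIdeal_le_span_of_adjoin [Fintype τ] {G : Subgroup Γ} {f : τ → MvPolynomial σ k}
    (hf : ∀ t, f t ∈ irrel σ k)
    (hgen : ∀ a ∈ fixedRing G (MvPolynomial σ k), a ∈ Algebra.adjoin k (Set.range f)) :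
    posIdeal k σ G ≤ Ideal.span (Set.range f) := by
  refine Ideal.span_le.2 ?_
  rintro a ⟨ha, d, hd, had⟩
  have h := hgen a ha
  rw [Algebra.adjoin_range_eq_range_aeval] at h
  obtain ⟨P, rfl⟩ := h
  have hP : constantCoeff P = 0 := by
    rw [← constantCoeff_aeval hf]
    exact had.mem_irrel hd
  obtain ⟨D, hD⟩ := exists_bound P
  obtain ⟨Q, -, hQ⟩ := exists_eq_sum_mul_X hP hD
  change aeval f P ∈ Ideal.span (Set.range f)
  rw [hQ, map_sum]
  refine sum_mem fun t _ => ?_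
  rw [map_mul, aeval_X]
  exact Ideal.mul_mem_left _ _ (Ideal.subset_span ⟨t, rfl⟩)

theorem isParams_of_adjoin [Fintype σ] {G : Subgroup Γ} [Finite G] {f : σ → MvPolynomial σ k}
    {δ : σ → ℕ} (hf : ∀ t, (f t).IsHomogeneous (δ t)) (hδ : ∀ t, 0 < δ t)
    (hmem : ∀ t, f t ∈ fixedRing G (MvPolynomial σ k))
    (hgen : ∀ a ∈ fixedRing G (MvPolynomial σ k), a ∈ Algebra.adjoin k (Set.range f)) :
    IsParams G (0 : σ → MvPolynomial Empty k) f δ := by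
  have hirr : ∀ t, f t ∈ irrel σ k := fun t => (hf t).mem_irrel (hδ t)
  have hzero : ∀ {x : MvPolynomial σ k}, x ∈ irrel σ k →
      aeval (0 : σ → MvPolynomial Empty k) x = 0 := fun {x} hx => by
    rw [MvPolynomial.aeval_zero, show constantCoeff x = 0 from hx, map_zero]
  have hP : ∀ P : MvPolynomial σ k, aeval f P ∈ fixedRing G (MvPolynomial σ k) := by
    intro P
    induction P using MvPolynomial.induction_on with
    | C c => rw [aeval_C]; exact C_mem_fixedRing G c
    | add p q hp hq => rw [map_add]; exact add_mem hp hq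
    | mul_X p i hp => rw [map_mul, aeval_X]; exact mul_mem hp (hmem i)
  refine ⟨fun i => isHomogeneous_zero _ _ _, fun g _ s => aeval_smul_of_X (fun i => ?_) s, hmem, hf,
    hδ, ?_, fun t => hzero (hirr t), fun a ha d had h0 => ?_⟩
  · exact hzero ((smul_X_sub_X_isHomogeneous g i).mem_irrel one_pos)
  · refine lIndPow_of_X_mem_radical hf hδ fun i => ?_
    obtain ⟨N, -, hN⟩ := exists_X_pow_mem_posIdeal (k := k) G i
    exact ⟨N, posIdeal_le_span_of_adjoin hirr hgen hN⟩
  · have h := hgen a ha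
    rw [Algebra.adjoin_range_eq_range_aeval] at h
    obtain ⟨P, hPa⟩ := h
    replace hPa : aeval f P = a := hPa
    have hP0 : constantCoeff P = 0 := by
      rw [← constantCoeff_aeval hirr, hPa]
      rw [MvPolynomial.aeval_zero] at h0
      exact (map_eq_zero _).1 h0
    obtain ⟨D, hD⟩ := exists_bound P
    obtain ⟨Q, -, hQ⟩ := exists_eq_sum_mul_X hP0 hD
    refine ⟨fun t => if δ t ≤ d then homogeneousComponent (d - δ t) (aeval f (Q t)) else 0,
      fun t => ?_, ?_⟩
    · dsimp only
      by_cases ht : δ t ≤ d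
      · rw [if_pos ht]
        exact ⟨homogeneousComponent_mem_fixedRing (hP _) _, homogeneousComponent_isHomogeneous _ _,
          fun h => absurd ht (by omega)⟩
      · rw [if_neg ht]
        exact ⟨zero_mem _, isHomogeneous_zero _ _ _, fun _ => rfl⟩
    · have h1 : homogeneousComponent d a = a := by
        rw [homogeneousComponent_of_mem had, if_pos rfl]
      rw [← h1, ← hPa, hQ, map_sum, map_sum]
      refine Finset.sum_congr rfl fun t _ => ?_
      rw [map_mul, aeval_X, homogeneousComponent_mul_of_isHomogeneous (hf t), ite_mul, zero_mul]

theorem mem_fixedRing_of_homogeneousComponent {G : Subgroup Γ} {s : MvPolynomial σ k}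
    (h : ∀ d, homogeneousComponent d s ∈ fixedRing G (MvPolynomial σ k)) :
    s ∈ fixedRing G (MvPolynomial σ k) := by
  rw [← sum_homogeneousComponent s]
  exact sum_mem fun d _ => h d

theorem eq_of_fixedRing_le {G H : Subgroup Γ} [Finite G] (hHG : H ≤ G)
    (h : fixedRing H (MvPolynomial σ k) ≤ fixedRing G (MvPolynomial σ k)) : H = G := by
  have : (⊥ : Ideal (MvPolynomial σ k)).IsPrime := Ideal.isPrime_bot
  obtain ⟨κ, _, u, v, -, hv, hsep, hval⟩ := exists_separating_system G H hHG
    (⊥ : Ideal (MvPolynomial σ k)) fun g _ hg => by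
      have : g = 1 := LinAct.faithful (σ := σ) (k := k) g fun s => by
        have := hg s
        rwa [Ideal.mem_bot, sub_eq_zero] at this
      rw [this]
      exact one_mem _
  refine le_antisymm hHG fun g hg => ?_
  by_contra hgH
  refine hval ?_
  rw [Ideal.mem_bot, ← hsep g hg hgH]
  exact Finset.sum_congr rfl fun i _ => by rw [h (hv i) g hg]

theorem IsDualBasis.reflSub_eq {G : Subgroup Γ} [Finite G] {J : Type} [Fintype J]
    {e : J → MvPolynomial σ k} {δ : J → ℕ} {φ : J → MvPolynomial σ k →+ MvPolynomial σ k} {j₀ : J}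
    (h : IsDualBasis G e δ φ j₀) : reflSub k σ G = G := by
  classical
  refine eq_of_fixedRing_le (k := k) (σ := σ) (reflSub_le G) fun s hs =>
    mem_fixedRing_of_homogeneousComponent fun d => ?_
  have hb := homogeneousComponent_mem_fixedRing hs d
  have hbd := homogeneousComponent_isHomogeneous d s
  generalize homogeneousComponent d s = b at hb hbd
  have hz : ∀ j, j ≠ j₀ → φ j b = 0 := by
    intro j hj
    by_cases hd : d < δ j
    · exact (h.coord_homog j d b hbd).2 hd
    obtain ⟨ρ, hρ, hρφ⟩ := exists_relTr_reflSub (h.isInvLin j)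
    have hcomp : homogeneousComponent (d - δ j) (φ j b) = 0 := by
      have := Fintype.ofFinite (G ⧸ (reflSub k σ G).subgroupOf G)
      have h1 : ρ b = ρ 1 * b := by
        have := hρ.map_mul b hb 1
        rwa [mul_one, mul_comm] at this
      rw [← hρφ, h1, relTr_eq_sum, map_sum]
      refine Finset.sum_eq_zero fun q _ => ?_
      have := h.pos j hj
      rw [smul_homogeneousComponent, homogeneousComponent_mul_of_isHomogeneous hbd,
        if_neg (by omega), smul_zero]
    rwa [homogeneousComponent_of_mem (h.coord_homog j d b hbd).1, if_pos rfl] at hcomp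
  have hsum := h.sum_eq b
  rw [Finset.sum_eq_single j₀ (fun j _ hj => by rw [hz j hj, zero_mul]) (by simp), h.e_eq_one,
    mul_one] at hsum
  rw [← hsum]
  exact (h.isInvLin j₀).mem b

/-- If the invariants form a polynomial ring, then the group is generated by reflections and the
invariants split off. -/
theorem reflSub_eq_and_exists_splitting [Fintype σ] {G : Subgroup Γ} [Finite G]
    {f : σ → MvPolynomial σ k} {δ : σ → ℕ} (hf : ∀ t, (f t).IsHomogeneous (δ t))
    (hδ : ∀ t, 0 < δ t) (hmem : ∀ t, f t ∈ fixedRing G (MvPolynomial σ k))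
    (hgen : ∀ a ∈ fixedRing G (MvPolynomial σ k), a ∈ Algebra.adjoin k (Set.range f)) :
    reflSub k σ G = G ∧ ∃ π : MvPolynomial σ k →+ MvPolynomial σ k, IsInvLin G π ∧ π 1 = 1 ∧
      ∀ d s, s.IsHomogeneous d → (π s).IsHomogeneous d := by
  obtain ⟨J, _, e, ε, φ, j₀, h⟩ := (isParams_of_adjoin hf hδ hmem hgen).exists_isDualBasis
  have h0 : ε j₀ = 0 := by
    by_contra hne
    have h1 := h.isHomogeneous j₀
    rw [h.e_eq_one] at h1
    exact hne (h1.inj_right (isHomogeneous_one _ _) one_ne_zero)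
  refine ⟨h.reflSub_eq, φ j₀, h.isInvLin j₀, h.coord_one, fun d s hs => ?_⟩
  simpa [h0] using (h.coord_homog j₀ d s hs).1

end Forward

section Backward

variable {Γ σ τ : Type} [Group Γ] [MulSemiringAction Γ (MvPolynomial σ k)] [LinAct Γ σ k]

variable (k σ) in
/-- The invariants are a polynomial ring on homogeneous generators, as many as the variables. -/
def HasPolyInv (G : Subgroup Γ) : Prop :=
  ∃ f : σ → MvPolynomial σ k, (∀ i, ∃ d, (f i).IsHomogeneous d) ∧ AlgebraicIndependent k f ∧
    (∀ i, f i ∈ fixedRing G (MvPolynomial σ k)) ∧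
    ∀ a ∈ fixedRing G (MvPolynomial σ k), a ∈ Algebra.adjoin k (Set.range f)

theorem isAlgebraic_of_fixedRing_le {G : Subgroup Γ} [Finite G]
    {B : Subalgebra k (MvPolynomial σ k)} (h : ∀ a ∈ fixedRing G (MvPolynomial σ k), a ∈ B) :
    Algebra.IsAlgebraic B (MvPolynomial σ k) := by
  refine ⟨fun s => ?_⟩
  have := Fintype.ofFinite G
  have hP : MulSemiringAction.charpoly G s ∈
      Polynomial.lifts (algebraMap B (MvPolynomial σ k)) := by
    rw [Polynomial.lifts_iff_coeff_lifts]
    intro n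
    exact ⟨⟨_, h _ fun g hg => MulSemiringAction.smul_coeff_charpoly (G := G) s n ⟨g, hg⟩⟩, rfl⟩
  obtain ⟨q, hq⟩ := (Polynomial.mem_lifts _).1 hP
  refine ⟨q, ?_, ?_⟩
  · rintro rfl
    rw [Polynomial.map_zero] at hq
    exact (MulSemiringAction.monic_charpoly G s).ne_zero hq.symm
  · rw [Polynomial.aeval_def, ← Polynomial.eval_map, hq]
    exact MulSemiringAction.eval_charpoly G s

theorem mem_adjoin_of_exists_coeffs [Fintype τ] {G : Subgroup Γ} {f : τ → MvPolynomial σ k}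
    {δ : τ → ℕ} (hδ : ∀ t, 0 < δ t)
    (hex : ∀ a ∈ fixedRing G (MvPolynomial σ k), ∀ d, a.IsHomogeneous d → 0 < d →
      ∃ c : τ → MvPolynomial σ k, (∀ t, c t ∈ fixedRing G (MvPolynomial σ k) ∧
        (c t).IsHomogeneous (d - δ t)) ∧ a = ∑ t, c t * f t)
    {a : MvPolynomial σ k} (ha : a ∈ fixedRing G (MvPolynomial σ k)) :
    a ∈ Algebra.adjoin k (Set.range f) := by
  have H : ∀ d, ∀ a ∈ fixedRing G (MvPolynomial σ k), a.IsHomogeneous d →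
      a ∈ Algebra.adjoin k (Set.range f) := by
    intro d
    induction d using Nat.strong_induction_on with
    | _ d ih =>
      intro a ha had
      rcases Nat.eq_zero_or_pos d with rfl | hd
      · rw [totalDegree_eq_zero_iff_eq_C.1 (Nat.le_zero.1 had.totalDegree_le)]
        exact Subalgebra.algebraMap_mem _ _
      · obtain ⟨c, hc, rfl⟩ := hex a ha d had hd
        refine sum_mem fun t _ => mul_mem ?_ (Algebra.subset_adjoin ⟨t, rfl⟩)
        have := hδ t
        exact ih _ (by omega) _ (hc t).1 (hc t).2
  rw [← sum_homogeneousComponent a]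
  exact sum_mem fun d _ => H d _ (homogeneousComponent_mem_fixedRing ha d)
    (homogeneousComponent_isHomogeneous d a)

theorem HasPolyInv.of_exists_coeffs [Fintype τ] {G : Subgroup Γ} [Finite G]
    {f : τ → MvPolynomial σ k} {δ : τ → ℕ} (hf : ∀ t, (f t).IsHomogeneous (δ t))
    (hδ : ∀ t, 0 < δ t) (hmem : ∀ t, f t ∈ fixedRing G (MvPolynomial σ k))
    (hind : AlgebraicIndependent k f)
    (hex : ∀ a ∈ fixedRing G (MvPolynomial σ k), ∀ d, a.IsHomogeneous d → 0 < d →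
      ∃ c : τ → MvPolynomial σ k, (∀ t, c t ∈ fixedRing G (MvPolynomial σ k) ∧
        (c t).IsHomogeneous (d - δ t)) ∧ a = ∑ t, c t * f t) : HasPolyInv k σ G := by
  have hgen : ∀ a ∈ fixedRing G (MvPolynomial σ k), a ∈ Algebra.adjoin k (Set.range f) :=
    fun a ha => mem_adjoin_of_exists_coeffs hδ hex ha
  have hb : IsTranscendenceBasis k f :=
    hind.isTranscendenceBasis_iff_isAlgebraic.2 (isAlgebraic_of_fixedRing_le hgen)
  have hX : IsTranscendenceBasis k (X : σ → MvPolynomial σ k) := IsTranscendenceBasis.mvPolynomial σ k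
  have hcard := hX.lift_cardinalMk_eq hb
  obtain ⟨e⟩ := Cardinal.lift_mk_eq'.1 hcard
  refine ⟨f ∘ e, fun i => ⟨_, hf (e i)⟩, hind.comp e e.injective, fun i => hmem _, fun a ha => ?_⟩
  rw [Set.range_comp, e.surjective.range_eq, Set.image_univ]
  exact hgen a ha

theorem IsParams.hasPolyInv {G : Subgroup Γ} [Finite G] {κ : Type} [Fintype τ]
    {L : σ → MvPolynomial κ k} {f : τ → MvPolynomial σ k} {δ : τ → ℕ} (h : IsParams G L f δ)
    (hL : ∀ i, L i = 0) : HasPolyInv k σ G := by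
  refine HasPolyInv.of_exists_coeffs h.isHomogeneous h.pos h.mem
    (h.ind.algebraicIndependent h.isHomogeneous h.pos) fun a ha d had hd => ?_
  obtain ⟨c, hc, hac⟩ := h.exists_coeffs a ha d had (by
    rw [show L = 0 from funext hL, MvPolynomial.aeval_zero,
      show constantCoeff a = 0 from had.mem_irrel hd, map_zero])
  exact ⟨c, fun t => ⟨(hc t).1, (hc t).2.1⟩, hac⟩

theorem hasPolyInv_of_charP [Finite σ] (p : ℕ) [Fact p.Prime] [CharP k p] {G : Subgroup Γ}
    [Finite G] (hG : reflSub k σ G = G) (hs : HasSplitting k σ G)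
    (hX : ∀ i, (X i : MvPolynomial σ k) ∈ augIdeal k σ G) : HasPolyInv k σ G := by
  obtain ⟨κ, L, hL, hker⟩ := exists_linear_quotient_augIdeal (k := k) (σ := σ) G
  obtain ⟨τ, _, f, δ, h⟩ := exists_isParams p (Nat.card G) G inferInstance rfl hG hs κ L hL hker
  refine h.hasPolyInv fun i => ?_
  have := hX i
  rw [← hker, RingHom.mem_ker] at this
  simpa using this

theorem hasPolyInv_of_trivial {G : Subgroup Γ} (hG : ∀ g ∈ G, g = 1) : HasPolyInv k σ G := by
  refine ⟨X, fun i => ⟨1, isHomogeneous_X k i⟩, MvPolynomial.algebraicIndependent_X σ k,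
    fun i g hg => ?_, fun a _ => ?_⟩
  · rw [hG g hg, one_smul]
  · rw [MvPolynomial.adjoin_range_X]
    trivial

end Backward

section Irredundant

variable {S τ : Type} [CommRing S]

theorem exists_irredundant [DecidableEq τ] (h : τ → S) (t : Finset τ) :
    ∃ T ⊆ t, Ideal.span (h '' T) = Ideal.span (h '' t) ∧
      ∀ i ∈ T, h i ∉ Ideal.span (h '' (T.erase i : Finset τ)) := by
  obtain ⟨T, hTt, hT⟩ := exists_minimal_le_of_wellFoundedLT
    (fun T : Finset τ => Ideal.span (h '' T) = Ideal.span (h '' t)) t rfl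
  refine ⟨T, hTt, hT.prop, fun i hi hmem => ?_⟩
  have hle : T ≤ T.erase i := by
    refine hT.le_of_le ?_ (Finset.erase_subset i T)
    rw [← hT.prop]
    refine le_antisymm (Ideal.span_mono (Set.image_mono (by simp))) ?_
    rw [Ideal.span_le]
    rintro _ ⟨j, hj, rfl⟩
    by_cases hji : j = i
    · exact hji ▸ hmem
    · exact Ideal.subset_span ⟨j, by simpa [hji] using hj, rfl⟩
  exact absurd (hle hi) (by simp)

end Irredundant

section Chevalley

variable {σ : Type}

theorem MvPolynomial.IsHomogeneous.of_mul_left {l s : MvPolynomial σ k} {d e : ℕ}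
    (hl : l.IsHomogeneous e) (hl0 : l ≠ 0) (h : (s * l).IsHomogeneous (d + e)) :
    s.IsHomogeneous d := by
  have h1 := homogeneousComponent_mul_of_isHomogeneous hl s (d + e)
  rw [homogeneousComponent_of_mem (m := d + e) h, if_pos rfl, if_pos (Nat.le_add_left _ _),
    Nat.add_sub_cancel] at h1
  rw [mul_right_cancel₀ hl0 h1]
  exact homogeneousComponent_isHomogeneous _ _

theorem pderiv_aeval {τ : Type} [Fintype τ] (f : τ → MvPolynomial σ k) (m : σ)
    (h : MvPolynomial τ k) :
    pderiv m (aeval f h) = ∑ t, aeval f (pderiv t h) * pderiv m (f t) := by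
  induction h using MvPolynomial.induction_on with
  | C a => simp [algebraMap_eq]
  | add p q hp hq => simp only [map_add, hp, hq, add_mul, Finset.sum_add_distrib]
  | mul_X p i hp =>
    classical
    simp only [map_mul, aeval_X, pderiv_mul, hp, map_add, add_mul, Finset.sum_add_distrib]
    congr 1
    · rw [Finset.sum_mul]
      exact Finset.sum_congr rfl fun t _ => by ring
    · rw [Finset.sum_eq_single i]
      · simp
      · intro t _ ht
        rw [pderiv_X_of_ne ht.symm]
        simp
      · simp

variable {Γ : Type} [Group Γ] [MulSemiringAction Γ (MvPolynomial σ k)] [LinAct Γ σ k]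

theorem smul_mem_posIdeal {G : Subgroup Γ} {g : Γ} (hg : g ∈ G) {x : MvPolynomial σ k}
    (hx : x ∈ posIdeal k σ G) : g • x ∈ posIdeal k σ G :=
  smul_mem_span_of_fixed (fun _ h => h.1) hg hx

/-- Averaging over the group. -/
theorem exists_average [CharZero k] (G : Subgroup Γ) [Finite G] :
    ∃ R : MvPolynomial σ k →+ MvPolynomial σ k, IsInvLin G R ∧ R 1 = 1 ∧
      (∀ d s, s.IsHomogeneous d → (R s).IsHomogeneous d) ∧
      ∀ (Q : Ideal (MvPolynomial σ k)) (s : MvPolynomial σ k), (∀ g ∈ G, g • s - s ∈ Q) →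
        s - R s ∈ Q := by
  have := Fintype.ofFinite G
  have hN : (Fintype.card G : k) ≠ 0 := Nat.cast_ne_zero.2 Fintype.card_ne_zero
  have hCN : (C (Fintype.card G : k)⁻¹ : MvPolynomial σ k) * (Fintype.card G : MvPolynomial σ k)
      = 1 := by
    rw [← map_natCast (C : k →+* MvPolynomial σ k), ← C_mul, inv_mul_cancel₀ hN, C_1]
  refine ⟨AddMonoidHom.mk' (fun s => C (Fintype.card G : k)⁻¹ * ∑ g : G, (g : Γ) • s)
    fun s t => by simp [smul_add, Finset.sum_add_distrib, mul_add], ⟨fun s => ?_, fun a ha s => ?_⟩,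
    ?_, fun d s hs => ?_, fun Q s hs => ?_⟩
  · intro h hh
    rw [AddMonoidHom.mk'_apply, smul_C_mul, Finset.smul_sum]
    congr 1
    refine Fintype.sum_equiv (Equiv.mulLeft (⟨h, hh⟩ : G)) _ _ fun g => ?_
    simp [mul_smul]
  · simp only [AddMonoidHom.mk'_apply, smul_mul']
    simp only [fun g : G => ha g g.2, ← Finset.mul_sum]
    ring
  · simp [hCN]
  · rw [AddMonoidHom.mk'_apply, ← zero_add d]
    exact (isHomogeneous_C _ _).mul
      (IsHomogeneous.sum _ _ _ fun g _ => LinAct.smul_isHomogeneous _ _ _ hs)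
  · have : s - (AddMonoidHom.mk' (fun s => C (Fintype.card G : k)⁻¹ * ∑ g : G, (g : Γ) • s)
        (fun s t => by simp [smul_add, Finset.sum_add_distrib, mul_add])) s =
        -(C (Fintype.card G : k)⁻¹ * ∑ g : G, ((g : Γ) • s - s)) := by
      rw [AddMonoidHom.mk'_apply, Finset.sum_sub_distrib, mul_sub]
      simp only [Finset.sum_const, Finset.card_univ, nsmul_eq_mul]
      rw [← mul_assoc, hCN, one_mul]
      ring
    rw [this]
    exact neg_mem (Ideal.mul_mem_left _ _ (sum_mem fun g _ => hs g g.2))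

theorem mem_posIdeal_of_sum_eq_zero [CharZero k] {G : Subgroup Γ} [Finite G]
    (hG : reflSub k σ G = G) {τ : Type} [Fintype τ] {a : τ → MvPolynomial σ k}
    (ha : ∀ t, a t ∈ fixedRing G (MvPolynomial σ k)) {t₁ : τ}
    (h1 : a t₁ ∉ Ideal.span (a '' {u | u ≠ t₁})) (d : ℕ) :
    ∀ s : τ → MvPolynomial σ k, ∑ t, a t * s t = 0 → (s t₁).IsHomogeneous d →
      s t₁ ∈ posIdeal k σ G := by
  classical
  induction d with
  | zero =>
    intro s hs hd
    have hC := totalDegree_eq_zero_iff_eq_C.1 (Nat.le_zero.1 hd.totalDegree_le)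
    by_cases hc : coeff 0 (s t₁) = 0
    · rw [hC, hc, C_0]
      exact zero_mem _
    · exfalso
      apply h1
      rw [← Finset.add_sum_erase _ _ (Finset.mem_univ t₁)] at hs
      have hmem : a t₁ * s t₁ ∈ Ideal.span (a '' {u | u ≠ t₁}) := by
        rw [eq_neg_of_add_eq_zero_left hs]
        refine neg_mem (sum_mem fun t ht => Ideal.mul_mem_right _ _ (Ideal.subset_span ⟨t, ?_, rfl⟩))
        exact Finset.ne_of_mem_erase ht
      have := Ideal.mul_mem_right (C (coeff 0 (s t₁))⁻¹) _ hmem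
      rw [hC] at this
      rwa [mul_assoc, ← C_mul, coeff_C, if_pos rfl, mul_inv_cancel₀ hc, C_1, mul_one] at this
  | succ d ih =>
    intro s hs hd
    obtain ⟨R, hR, -, hRh, hRs⟩ := exists_average (k := k) (σ := σ) G
    have hrefl : ∀ g ∈ G, g • s t₁ - s t₁ ∈ posIdeal k σ G := by
      refine smul_sub_mem_of_closure hG.symm (fun g hg x hx => smul_mem_posIdeal hg hx) ?_
      rintro g ⟨hg, l, hl, hdvd⟩
      by_cases hl0 : l = 0
      · have := hdvd (s t₁)
        rw [hl0, zero_dvd_iff] at this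
        rw [this]
        exact zero_mem _
      choose r hr using fun t => hdvd (s t)
      have hsum : ∑ t, a t * r t = 0 := by
        apply mul_left_cancel₀ hl0
        rw [mul_zero, Finset.mul_sum]
        calc ∑ t, l * (a t * r t) = ∑ t, (g • (a t * s t) - a t * s t) :=
              Finset.sum_congr rfl fun t _ => by rw [smul_mul', ha t g hg, ← mul_sub, hr t]; ring
          _ = 0 := by rw [Finset.sum_sub_distrib, ← Finset.smul_sum, hs, smul_zero, sub_zero]
      have hhom : (r t₁).IsHomogeneous d := by
        refine hl.of_mul_left hl0 ?_
        rw [mul_comm, ← hr]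
        exact (LinAct.smul_isHomogeneous g _ _ hd).sub hd
      rw [hr]
      exact Ideal.mul_mem_left _ _ (ih r hsum hhom)
    have hRm : R (s t₁) ∈ posIdeal k σ G :=
      Ideal.subset_span ⟨hR.mem _, _, Nat.succ_pos d, hRh _ _ hd⟩
    have := add_mem (hRs _ _ hrefl) hRm
    rwa [sub_add_cancel] at this

theorem eq_zero_of_sum_mul_pderiv [CharZero k] [Fintype σ] {G : Subgroup Γ} [Finite G]
    (hG : reflSub k σ G = G) {τ : Type} [Fintype τ] {f : τ → MvPolynomial σ k} {δ : τ → ℕ}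
    (hf : ∀ t, (f t).IsHomogeneous (δ t)) (hδ : ∀ t, 0 < δ t)
    (hspan : Ideal.span (Set.range f) = posIdeal k σ G)
    (hirr : ∀ t, f t ∉ Ideal.span (f '' {u | u ≠ t})) {h : τ → MvPolynomial σ k} {D : ℕ}
    (hfix : ∀ t, h t ∈ fixedRing G (MvPolynomial σ k))
    (hh : ∀ t, (h t).IsHomogeneous (D - δ t)) (hD : ∀ t, D < δ t → h t = 0)
    (hsum : ∀ m, ∑ t, h t * pderiv m (f t) = 0) (t : τ) : h t = 0 := by
  classical
  obtain ⟨T, -, hT, hTirr⟩ := exists_irredundant h Finset.univ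
  rw [Finset.coe_univ, Set.image_univ] at hT
  obtain rfl | ⟨i₁, hi₁⟩ := T.eq_empty_or_nonempty
  · have : h t ∈ Ideal.span (h '' (∅ : Finset τ)) := hT ▸ Ideal.subset_span ⟨t, rfl⟩
    simpa using this
  exfalso
  have hTD : ∀ i ∈ T, δ i ≤ D := by
    intro i hi
    by_contra hlt
    apply hTirr i hi
    rw [hD i (by omega)]
    exact zero_mem _
  have hexp : ∀ u, ∃ g : T → MvPolynomial σ k, h u = ∑ i : T, g i * h i ∧
      (∀ i : T, (g i).IsHomogeneous (δ i - δ u) ∧ (δ i < δ u → g i = 0)) ∧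
      (u ∈ T → ∀ i : T, g i = if (i : τ) = u then 1 else 0) := by
    intro u
    by_cases hu : u ∈ T
    · refine ⟨fun i => if (i : τ) = u then 1 else 0, ?_, fun i => ?_, fun _ i => rfl⟩
      · rw [Finset.sum_eq_single ⟨u, hu⟩]
        · simp
        · rintro i - hi
          dsimp only
          rw [if_neg (fun h => hi (Subtype.ext h)), zero_mul]
        · simp
      · dsimp only
        split_ifs with hiu
        · rw [hiu, Nat.sub_self]
          exact ⟨isHomogeneous_one _ _, fun h => absurd h (lt_irrefl _)⟩
        · exact ⟨isHomogeneous_zero _ _ _, fun _ => rfl⟩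
    · by_cases huD : D < δ u
      · refine ⟨0, by simp [hD u huD], fun i => ⟨isHomogeneous_zero _ _ _,
          fun _ => rfl⟩, fun h => absurd h hu⟩
      · have hmem : h u ∈ Ideal.span (Set.range fun i : T => h i) := by
          have : Set.range (fun i : T => h i) = h '' T := by
            ext x; simp
          rw [this, hT]
          exact Ideal.subset_span ⟨u, rfl⟩
        obtain ⟨c, hc, hc'⟩ := exists_homogeneous_coeffs (fun i : T => hh i) hmem (D - δ u)
        rw [homogeneousComponent_of_mem (m := D - δ u) (hh u), if_pos rfl] at hc
        refine ⟨c, hc, fun i => ?_, fun h => absurd h hu⟩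
        have hi := hTD i i.2
        have h0 : δ i < δ u → c i = 0 := fun hlt => (hc' i).2 (by omega)
        refine ⟨?_, h0⟩
        by_cases hlt : δ i < δ u
        · rw [h0 hlt]
          exact isHomogeneous_zero _ _ _
        · have := (hc' i).1
          rwa [show D - δ u - (D - δ i) = δ i - δ u by omega] at this
  choose g hg hghom hgT using hexp
  let s : σ → T → MvPolynomial σ k := fun m i => ∑ u, g u i * pderiv m (f u)
  have hs0 : ∀ m, ∑ i : T, h i * s m i = 0 := by
    intro m
    rw [← hsum m]
    simp only [s, Finset.mul_sum]
    rw [Finset.sum_comm]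
    refine Finset.sum_congr rfl fun u _ => ?_
    conv_rhs => rw [hg u, Finset.sum_mul]
    exact Finset.sum_congr rfl fun i _ => by ring
  have hshom : ∀ m (i : T), (s m i).IsHomogeneous (δ i - 1) := by
    intro m i
    refine IsHomogeneous.sum _ _ _ fun u _ => ?_
    by_cases hlt : δ i < δ u
    · rw [(hghom u i).2 hlt, zero_mul]
      exact isHomogeneous_zero _ _ _
    · have := (hghom u i).1.mul ((hf u).pderiv (i := m))
      have h2 := hδ u
      rwa [show δ i - δ u + (δ u - 1) = δ i - 1 by omega] at this
  have hirrT : (fun i : T => h i) ⟨i₁, hi₁⟩ ∉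
      Ideal.span ((fun i : T => h i) '' {u | u ≠ ⟨i₁, hi₁⟩}) := by
    intro hmem
    apply hTirr i₁ hi₁
    refine Ideal.span_mono ?_ hmem
    rintro _ ⟨u, hu, rfl⟩
    refine ⟨u, ?_, rfl⟩
    simp only [Finset.coe_erase, Set.mem_sdiff, Set.mem_singleton_iff]
    exact ⟨u.2, fun h => hu (Subtype.ext h)⟩
  have hspos : ∀ m, s m ⟨i₁, hi₁⟩ ∈ Ideal.span (f '' {u | u ≠ i₁}) := by
    intro m
    have h1 : s m ⟨i₁, hi₁⟩ ∈ posIdeal k σ G :=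
      mem_posIdeal_of_sum_eq_zero hG (fun i : T => hfix i) hirrT _ (s m) (hs0 m) (hshom m _)
    rw [← hspan] at h1
    have h2 := homogeneousComponent_mem_span_of_lt hf h1 (δ i₁ - 1)
    rw [homogeneousComponent_of_mem (m := δ i₁ - 1) (hshom m ⟨i₁, hi₁⟩), if_pos rfl] at h2
    refine Ideal.span_mono (Set.image_mono fun u hu => ?_) h2
    rintro rfl
    have := hδ u
    have hu' : δ u ≤ δ u - 1 := hu
    omega
  have heuler : ∑ m, X m * s m ⟨i₁, hi₁⟩ = ∑ u, g u ⟨i₁, hi₁⟩ * (δ u • f u) := by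
    simp only [s, Finset.mul_sum]
    rw [Finset.sum_comm]
    refine Finset.sum_congr rfl fun u _ => ?_
    rw [← (hf u).sum_X_mul_pderiv, Finset.mul_sum]
    exact Finset.sum_congr rfl fun i _ => by ring
  have hmem : ∑ u, g u ⟨i₁, hi₁⟩ * (δ u • f u) ∈ Ideal.span (f '' {u | u ≠ i₁}) := by
    rw [← heuler]
    exact sum_mem fun m _ => Ideal.mul_mem_left _ _ (hspos m)
  have hrest : ∑ u ∈ Finset.univ.erase i₁, g u ⟨i₁, hi₁⟩ * (δ u • f u) ∈
      Ideal.span (f '' {u | u ≠ i₁}) :=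
    sum_mem fun u hu => Ideal.mul_mem_left _ _ (nsmul_mem
      (Ideal.subset_span (Set.mem_image_of_mem f (Finset.ne_of_mem_erase hu))) _)
  rw [← Finset.add_sum_erase _ _ (Finset.mem_univ i₁), hgT i₁ hi₁, if_pos rfl, one_mul,
    Ideal.add_mem_iff_left _ hrest] at hmem
  apply hirr i₁
  have h1 := Ideal.mul_mem_left _ (C (δ i₁ : k)⁻¹) hmem
  rwa [nsmul_eq_mul, ← map_natCast (C : k →+* MvPolynomial σ k), ← mul_assoc, ← C_mul,
    inv_mul_cancel₀ (Nat.cast_ne_zero.2 (hδ i₁).ne'), C_1, one_mul] at h1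

theorem eq_zero_of_sum_fixed_mul_pderiv [CharZero k] [Fintype σ] {G : Subgroup Γ} [Finite G]
    (hG : reflSub k σ G = G) {τ : Type} [Fintype τ] {f : τ → MvPolynomial σ k} {δ : τ → ℕ}
    (hf : ∀ t, (f t).IsHomogeneous (δ t)) (hδ : ∀ t, 0 < δ t)
    (hspan : Ideal.span (Set.range f) = posIdeal k σ G)
    (hirr : ∀ t, f t ∉ Ideal.span (f '' {u | u ≠ t})) {p : τ → MvPolynomial σ k}
    (hfix : ∀ t, p t ∈ fixedRing G (MvPolynomial σ k))
    (hsum : ∀ m, ∑ t, p t * pderiv m (f t) = 0) (t : τ) : p t = 0 := by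
  have key : ∀ D, δ t ≤ D → homogeneousComponent (D - δ t) (p t) = 0 := by
    intro D hD
    have := eq_zero_of_sum_mul_pderiv hG hf hδ hspan hirr (D := D)
      (h := fun u => if δ u ≤ D then homogeneousComponent (D - δ u) (p u) else 0)
      (fun u => by
        split_ifs
        exacts [homogeneousComponent_mem_fixedRing (hfix u) _, zero_mem _])
      (fun u => by
        split_ifs
        exacts [homogeneousComponent_isHomogeneous _ _, isHomogeneous_zero _ _ _])
      (fun u hu => if_neg (not_le.2 hu))
      (fun m => by
        have h1 := congrArg (homogeneousComponent (D - 1)) (hsum m)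
        rw [map_sum, map_zero] at h1
        refine (Finset.sum_congr rfl fun u _ => ?_).trans h1
        rw [homogeneousComponent_mul_of_isHomogeneous ((hf u).pderiv (i := m))]
        have hu := hδ u
        have ht := hδ t
        split_ifs with h2 h3 h3
        · rw [show D - 1 - (δ u - 1) = D - δ u by omega]
        · omega
        · omega
        · rw [zero_mul]) t
    simpa only [if_pos hD] using this
  rw [← sum_homogeneousComponent (p t)]
  refine Finset.sum_eq_zero fun e _ => ?_
  simpa using key (e + δ t) (Nat.le_add_left _ _)

theorem algebraicIndependent_of_irredundant [CharZero k] [Fintype σ] {G : Subgroup Γ} [Finite G]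
    (hG : reflSub k σ G = G) {τ : Type} [Fintype τ] {f : τ → MvPolynomial σ k} {δ : τ → ℕ}
    (hf : ∀ t, (f t).IsHomogeneous (δ t)) (hδ : ∀ t, 0 < δ t)
    (hmem : ∀ t, f t ∈ fixedRing G (MvPolynomial σ k))
    (hspan : Ideal.span (Set.range f) = posIdeal k σ G)
    (hirr : ∀ t, f t ∉ Ideal.span (f '' {u | u ≠ t})) : AlgebraicIndependent k f := by
  classical
  have hconst : ∀ h : MvPolynomial τ k, aeval f h = 0 →
      (∀ α, coeff α h ≠ 0 → α = 0) → h = 0 := by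
    intro h h0 hc
    have hC : h = C (coeff 0 h) := by
      ext α
      rw [coeff_C]
      split_ifs with hα
      · rw [hα]
      · by_contra hne
        exact hα (hc α hne).symm
    rw [hC, aeval_C, algebraMap_eq, C_eq_zero] at h0
    rw [hC, h0, C_0]
  have hfixed : ∀ h : MvPolynomial τ k, aeval f h ∈ fixedRing G (MvPolynomial σ k) := by
    intro h
    induction h using MvPolynomial.induction_on with
    | C a => rw [aeval_C]; exact C_mem_fixedRing G a
    | add p q hp hq => rw [map_add]; exact add_mem hp hq
    | mul_X p i hp => rw [map_mul, aeval_X]; exact mul_mem hp (hmem i)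
  have main : ∀ (n : ℕ) (h : MvPolynomial τ k), (∀ α, coeff α h ≠ 0 → α.degree ≤ n) →
      aeval f h = 0 → h = 0 := by
    intro n
    induction n with
    | zero =>
      intro h hd h0
      exact hconst h h0 fun α hα => (Finsupp.degree_eq_zero_iff α).1 (Nat.le_zero.1 (hd α hα))
    | succ n ih =>
      intro h hd h0
      have hp : ∀ t, aeval f (pderiv t h) = 0 := by
        refine eq_zero_of_sum_fixed_mul_pderiv hG hf hδ hspan hirr (fun t => hfixed _) fun m => ?_
        rw [← pderiv_aeval, h0, map_zero]
      have hp' : ∀ t, pderiv t h = 0 := by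
        refine fun t => ih _ (fun α hα => ?_) (hp t)
        rw [coeff_pderiv] at hα
        have := hd _ (left_ne_zero_of_mul hα)
        rw [map_add, Finsupp.degree_single] at this
        omega
      refine hconst h h0 fun α hα => ?_
      by_contra hne
      obtain ⟨t, ht⟩ := Finsupp.ne_iff.1 hne
      have h1 := coeff_pderiv h (i := t) (α - Finsupp.single t 1)
      rw [hp' t, coeff_zero, Finsupp.sub_add_single_one_cancel ht] at h1
      refine (mul_ne_zero hα ?_) h1.symm
      exact Nat.cast_add_one_ne_zero _
  rw [algebraicIndependent_iff]
  intro h h0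
  exact main h.totalDegree h (fun α hα => le_totalDegree (mem_support_iff.2 hα)) h0

theorem hasPolyInv_of_charZero [CharZero k] [Finite σ] {G : Subgroup Γ} [Finite G]
    (hG : reflSub k σ G = G) : HasPolyInv k σ G := by
  classical
  have := Fintype.ofFinite σ
  obtain ⟨A, hA, hAs⟩ := (Submodule.fg_span_iff_fg_span_finset_subset
    {a | a ∈ fixedRing G (MvPolynomial σ k) ∧ ∃ d, 0 < d ∧ a.IsHomogeneous d}).1
    (IsNoetherian.noetherian (posIdeal k σ G))
  obtain ⟨T, hTA, hT, hirr⟩ := exists_irredundant (id : MvPolynomial σ k → MvPolynomial σ k) A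
  have hT' : Ideal.span (Set.range fun t : T => (t : MvPolynomial σ k)) = posIdeal k σ G := by
    simp only [Subtype.range_coe_subtype, Set.image_id] at hT ⊢
    exact hT.trans hAs.symm
  have hTmem : ∀ t : T, (t : MvPolynomial σ k) ∈ fixedRing G (MvPolynomial σ k) ∧
      ∃ d, 0 < d ∧ (t : MvPolynomial σ k).IsHomogeneous d := fun t => hA (hTA t.2)
  choose hmem δ hδ hf using hTmem
  have hirr' : ∀ t : T, (t : MvPolynomial σ k) ∉
      Ideal.span ((fun t : T => (t : MvPolynomial σ k)) '' {u | u ≠ t}) := by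
    intro t ht
    apply hirr t t.2
    refine Ideal.span_mono ?_ ht
    rintro _ ⟨u, hu, rfl⟩
    refine ⟨u, ?_, rfl⟩
    simp only [Finset.coe_erase, Set.mem_sdiff, Set.mem_singleton_iff]
    exact ⟨u.2, fun h => hu (Subtype.ext h)⟩
  refine HasPolyInv.of_exists_coeffs hf hδ hmem
    (algebraicIndependent_of_irredundant hG hf hδ hmem hT' hirr') fun a ha d had hd => ?_
  have haP : a ∈ Ideal.span (Set.range fun t : T => (t : MvPolynomial σ k)) := by
    rw [hT']
    exact Ideal.subset_span ⟨ha, d, hd, had⟩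
  obtain ⟨R, hR, hR1, hRh, -⟩ := exists_average (k := k) (σ := σ) G
  obtain ⟨c, hc, hch⟩ := exists_homogeneous_coeffs hf haP d
  rw [homogeneousComponent_of_mem (m := d) had, if_pos rfl] at hc
  refine ⟨fun t => R (c t), fun t => ⟨hR.mem _, hRh _ _ (hch t).1⟩, ?_⟩
  have h1 : R a = a := by
    have := hR.map_mul a ha 1
    rwa [mul_one, hR1, mul_one] at this
  rw [← h1, hc, map_sum]
  exact Finset.sum_congr rfl fun t _ => by
    rw [mul_comm, hR.map_mul _ (hmem t), mul_comm]

end Chevalley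

section Bridge

variable {n : ℕ}

theorem polySub_X (A : Matrix ι ι k) (i : ι) : polySub A (X i) = ∑ j, C (A i j) * X j :=
  aeval_X _ _

theorem polySub_one : polySub (1 : Matrix ι ι k) = AlgHom.id k _ := by
  refine algHom_ext fun i => ?_
  rw [polySub_X, AlgHom.id_apply, Finset.sum_eq_single i]
  · simp
  · intro j _ hj
    rw [Matrix.one_apply_ne hj.symm, C_0, zero_mul]
  · simp

theorem polySub_comp (A B : Matrix ι ι k) : (polySub A).comp (polySub B) = polySub (B * A) := by
  refine algHom_ext fun i => ?_
  rw [AlgHom.comp_apply, polySub_X, polySub_X, map_sum]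
  simp only [map_mul, polySub_X, Matrix.mul_apply, map_sum, Finset.sum_mul, Finset.mul_sum]
  rw [Finset.sum_comm]
  refine Finset.sum_congr rfl fun l _ => Finset.sum_congr rfl fun j _ => ?_
  rw [← algebraMap_eq, AlgHom.commutes, mul_assoc]

theorem sum_C_mul_X_isHomogeneous (b : ι → k) :
    (∑ j, C (b j) * X j : MvPolynomial ι k).IsHomogeneous 1 :=
  IsHomogeneous.sum _ _ _ fun j _ => by
    simpa using (isHomogeneous_C ι (b j)).mul (isHomogeneous_X k j)

theorem polySub_isHomogeneous (A : Matrix ι ι k) {d : ℕ} {s : MvPolynomial ι k}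
    (hs : s.IsHomogeneous d) : (polySub A s).IsHomogeneous d := by
  have := hs.aeval (fun i => ∑ j, C (A i j) * X j) fun i => sum_C_mul_X_isHomogeneous (A i)
  rwa [one_mul] at this

theorem eval_sum_C_mul_X (b v : ι → k) : eval v (∑ j, C (b j) * X j) = b ⬝ᵥ v := by
  simp [dotProduct]

theorem sum_C_mul_X_injective {b c : ι → k}
    (h : (∑ j, C (b j) * X j : MvPolynomial ι k) = ∑ j, C (c j) * X j) : b = c := by
  funext i
  have := congrArg (eval (Pi.single i 1)) h
  rwa [eval_sum_C_mul_X, eval_sum_C_mul_X, dotProduct_single_one, dotProduct_single_one] at this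

/-- The action of the general linear group on polynomial functions. -/
noncomputable instance : MulSemiringAction (GL (Fin n) k) (MvPolynomial (Fin n) k) where
  smul g s := polyAct (g : Matrix (Fin n) (Fin n) k) s
  one_smul s := by
    change polySub _ s = s
    rw [Units.val_one, inv_one, polySub_one, AlgHom.id_apply]
  mul_smul g h s := by
    change polySub _ s = polySub _ (polySub _ s)
    rw [← AlgHom.comp_apply, polySub_comp, Units.val_mul, Matrix.mul_inv_rev]
  smul_zero g := map_zero _
  smul_add g := map_add _
  smul_one g := map_one _
  smul_mul g := map_mul _

theorem gl_smul_def (g : GL (Fin n) k) (s : MvPolynomial (Fin n) k) :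
    g • s = polySub ((g⁻¹ : GL (Fin n) k) : Matrix (Fin n) (Fin n) k) s := by
  rw [Matrix.coe_units_inv]
  rfl

theorem gl_smul_X_sub (g : GL (Fin n) k) (i : Fin n) :
    g • (X i : MvPolynomial (Fin n) k) - X i = ∑ j, C
      (((g⁻¹ : GL (Fin n) k) : Matrix (Fin n) (Fin n) k) i j -
        (1 : Matrix (Fin n) (Fin n) k) i j) * X j := by
  simp only [C_sub, sub_mul, Finset.sum_sub_distrib]
  rw [gl_smul_def, polySub_X, ← polySub_X 1, polySub_one, AlgHom.id_apply]

theorem gl_eq_one_of_forall_X {g : GL (Fin n) k}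
    (h : ∀ i, g • (X i : MvPolynomial (Fin n) k) = X i) : g = 1 := by
  rw [← inv_eq_one]
  ext i j
  have h1 := gl_smul_X_sub g i
  rw [h i, sub_self] at h1
  have h2 : (∑ j, C ((0 : Fin n → k) j) * X j : MvPolynomial (Fin n) k) = 0 :=
    Finset.sum_eq_zero fun j _ => by rw [Pi.zero_apply, C_0, zero_mul]
  have h3 := congrFun (sum_C_mul_X_injective (h2.trans h1)) j
  exact sub_eq_zero.1 h3.symm

instance : LinAct (GL (Fin n) k) (Fin n) k where
  smul_C g c := by
    rw [gl_smul_def, ← algebraMap_eq, AlgHom.commutes]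
  smul_isHomogeneous g d s hs := by
    rw [gl_smul_def]
    exact polySub_isHomogeneous _ hs
  faithful g h := gl_eq_one_of_forall_X fun i => h _

theorem mem_invariantRing_matSet {G : Subgroup (GL (Fin n) k)} {s : MvPolynomial (Fin n) k} :
    s ∈ invariantRing (matSet G) ↔ s ∈ fixedRing G (MvPolynomial (Fin n) k) := by
  simp only [invariantRing, matSet, Algebra.mem_iInf, Set.forall_mem_image, AlgHom.mem_equalizer,
    AlgHom.id_apply, mem_fixedRing]
  rfl

theorem gl_inv_mulVec_eq_iff (g : GL (Fin n) k) (v : Fin n → k) :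
    ((g⁻¹ : GL (Fin n) k) : Matrix (Fin n) (Fin n) k) *ᵥ v = v ↔
      (g : Matrix (Fin n) (Fin n) k) *ᵥ v = v := by
  constructor <;> intro h
  · conv_lhs => rw [← h]
    rw [Matrix.mulVec_mulVec, Units.mul_inv, Matrix.one_mulVec]
  · conv_lhs => rw [← h]
    rw [Matrix.mulVec_mulVec, Units.inv_mul, Matrix.one_mulVec]

theorem ker_mulVecLin_sub_inv (g : GL (Fin n) k) :
    LinearMap.ker ((g : Matrix (Fin n) (Fin n) k).mulVecLin - LinearMap.id) =
      LinearMap.ker (((g⁻¹ : GL (Fin n) k) : Matrix (Fin n) (Fin n) k).mulVecLin -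
        LinearMap.id) := by
  ext v
  simp only [LinearMap.mem_ker, LinearMap.sub_apply, Matrix.mulVecLin_apply, LinearMap.id_apply,
    sub_eq_zero]
  exact (gl_inv_mulVec_eq_iff g v).symm

theorem IsPseudoReflection.isReflOrOne {g : GL (Fin n) k}
    (h : IsPseudoReflection (g : Matrix (Fin n) (Fin n) k)) : IsReflOrOne k (Fin n) g := by
  unfold IsPseudoReflection at h
  rw [ker_mulVecLin_sub_inv, Fintype.card_fin] at h
  set M := ((g⁻¹ : GL (Fin n) k) : Matrix (Fin n) (Fin n) k).mulVecLin - LinearMap.id with hM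
  have hlt : LinearMap.ker M < ⊤ := by
    rw [lt_top_iff_ne_top]
    intro htop
    rw [htop, finrank_top, Module.finrank_fin_fun] at h
    omega
  obtain ⟨φ, hφ, hle⟩ := Submodule.exists_le_ker_of_lt_top _ hlt
  have hφker : LinearMap.ker M = LinearMap.ker φ := by
    refine Submodule.eq_of_le_of_finrank_le hle ?_
    have := Module.Dual.finrank_ker_add_one_of_ne_zero hφ
    rw [Module.finrank_fin_fun] at this
    omega
  obtain ⟨w, hw⟩ : ∃ w, φ w = 1 := by
    obtain ⟨v, hv⟩ : ∃ v, φ v ≠ 0 := by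
      by_contra hall
      push Not at hall
      exact hφ (LinearMap.ext hall)
    exact ⟨(φ v)⁻¹ • v, by simp [hv]⟩
  have hMv : ∀ v, M v = φ v • M w := by
    intro v
    have hmem : v - φ v • w ∈ LinearMap.ker M := by
      rw [hφker, LinearMap.mem_ker]
      simp [hw]
    rw [LinearMap.mem_ker, map_sub, map_smul, sub_eq_zero] at hmem
    exact hmem
  refine ⟨∑ j, C (φ (Pi.single j 1)) * X j, sum_C_mul_X_isHomogeneous _, fun s => ?_⟩
  rw [← Ideal.mem_span_singleton]
  refine smul_sub_mem_of_X (fun i => ?_) s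
  rw [Ideal.mem_span_singleton, gl_smul_X_sub]
  refine ⟨C (M w i), ?_⟩
  rw [Finset.sum_mul]
  refine Finset.sum_congr rfl fun j _ => ?_
  have h1 := congrFun (hMv (Pi.single j 1)) i
  have h2 : M (Pi.single j 1) i = ((g⁻¹ : GL (Fin n) k) : Matrix (Fin n) (Fin n) k) i j -
      (1 : Matrix (Fin n) (Fin n) k) i j := by
    rw [hM]
    simp [Matrix.one_apply, Pi.single_apply]
  rw [← h2, h1, Pi.smul_apply, smul_eq_mul, C_mul]
  ring

theorem IsReflOrOne.isPseudoReflection {g : GL (Fin n) k} (h : IsReflOrOne k (Fin n) g)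
    (hg : g ≠ 1) : IsPseudoReflection (g : Matrix (Fin n) (Fin n) k) := by
  obtain ⟨l, hl, hdvd⟩ := h
  have hl0 : l ≠ 0 := by
    rintro rfl
    exact hg (gl_eq_one_of_forall_X fun i => sub_eq_zero.1 (zero_dvd_iff.1 (hdvd (X i))))
  choose c hc using fun i => hdvd (X i)
  have hcC : ∀ i, c i = C (coeff 0 (c i)) := by
    intro i
    have h0 : (c i).IsHomogeneous 0 := by
      refine hl.of_mul_left hl0 ?_
      rw [mul_comm, ← hc]
      exact smul_X_sub_X_isHomogeneous g i
    exact totalDegree_eq_zero_iff_eq_C.1 (Nat.le_zero.1 h0.totalDegree_le)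
  unfold IsPseudoReflection
  rw [ker_mulVecLin_sub_inv]
  set M := ((g⁻¹ : GL (Fin n) k) : Matrix (Fin n) (Fin n) k).mulVecLin - LinearMap.id with hM
  have hMv : ∀ v, M v = eval v l • fun i => coeff 0 (c i) := by
    intro v
    funext i
    have h1 := congrArg (eval v) ((gl_smul_X_sub g i).symm.trans (hc i))
    rw [eval_sum_C_mul_X, hcC i, map_mul, eval_C] at h1
    rw [Pi.smul_apply, smul_eq_mul, ← h1, hM]
    simp only [LinearMap.sub_apply, Matrix.mulVecLin_apply, LinearMap.id_apply, Pi.sub_apply]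
    conv_lhs => rw [← Matrix.one_mulVec v, Matrix.mulVec_mulVec, mul_one]
    rw [← Pi.sub_apply, ← Matrix.sub_mulVec]
    rfl
  have hle : LinearMap.range M ≤ Submodule.span k {fun i => coeff 0 (c i)} := by
    rintro _ ⟨v, rfl⟩
    rw [hMv]
    exact Submodule.smul_mem _ _ (Submodule.mem_span_singleton_self _)
  have h1 : Module.finrank k (LinearMap.range M) ≤ 1 :=
    (Submodule.finrank_mono hle).trans ((finrank_span_le_card _).trans (by simp))
  have h2 : 0 < Module.finrank k (LinearMap.range M) := by
    rw [Nat.pos_iff_ne_zero, Ne, Submodule.finrank_eq_zero, LinearMap.range_eq_bot]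
    intro h0
    apply hg
    rw [← inv_eq_one]
    ext i j
    have h3 := congrFun (LinearMap.congr_fun h0 (Pi.single j 1)) i
    rw [hM] at h3
    simpa [Matrix.one_apply, Pi.single_apply, sub_eq_zero] using h3
  have h3 := LinearMap.finrank_range_add_finrank_ker M
  rw [Module.finrank_fin_fun] at h3
  rw [Fintype.card_fin]
  omega

theorem closure_pseudoReflections_eq (G : Subgroup (GL (Fin n) k)) :
    Subgroup.closure {σ : GL (Fin n) k | σ ∈ G ∧
      IsPseudoReflection (σ : Matrix (Fin n) (Fin n) k)} = reflSub k (Fin n) G := by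
  refine le_antisymm (Subgroup.closure_mono fun σ hσ => ⟨hσ.1, hσ.2.isReflOrOne⟩) ?_
  rw [reflSub, Subgroup.closure_le]
  rintro g ⟨hg, hr⟩
  by_cases h1 : g = 1
  · rw [h1]
    exact one_mem _
  · exact Subgroup.subset_closure ⟨hg, hr.isPseudoReflection h1⟩

theorem eq_one_or_X_mem_augIdeal {G : Subgroup (GL (Fin n) k)}
    (hirr : ∀ U : Submodule k (Fin n → k),
      (∀ g ∈ G, ∀ v ∈ U, (g : Matrix (Fin n) (Fin n) k) *ᵥ v ∈ U) → U = ⊥ ∨ U = ⊤) :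
    (∀ g ∈ G, g = 1) ∨ ∀ i, (X i : MvPolynomial (Fin n) k) ∈ augIdeal k (Fin n) G := by
  let U : Submodule k (Fin n → k) :=
    { carrier := {v | ∀ g ∈ G, (g : Matrix (Fin n) (Fin n) k) *ᵥ v = v}
      zero_mem' := fun g _ => Matrix.mulVec_zero _
      add_mem' := fun ha hb g hg => by rw [Matrix.mulVec_add, ha g hg, hb g hg]
      smul_mem' := fun c v hv g hg => by rw [Matrix.mulVec_smul, hv g hg] }
  have hUinv : ∀ g ∈ G, ∀ v ∈ U, (g : Matrix (Fin n) (Fin n) k) *ᵥ v ∈ U := by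
    intro g hg v hv
    rw [hv g hg]
    exact hv
  obtain hU | hU := hirr U hUinv
  · right
    let W : Submodule k (Fin n → k) :=
      { carrier := {w | (∑ j, C (w j) * X j : MvPolynomial (Fin n) k) ∈ augIdeal k (Fin n) G}
        zero_mem' := by simp
        add_mem' := fun {a b} ha hb => by
          have ha' : (∑ j, C (a j) * X j : MvPolynomial (Fin n) k) ∈ augIdeal k (Fin n) G := ha
          have hb' : (∑ j, C (b j) * X j : MvPolynomial (Fin n) k) ∈ augIdeal k (Fin n) G := hb
          simpa [add_mul, Finset.sum_add_distrib] using add_mem ha' hb'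
        smul_mem' := fun c v hv => by
          have hv' : (∑ j, C (v j) * X j : MvPolynomial (Fin n) k) ∈ augIdeal k (Fin n) G := hv
          simpa [Finset.mul_sum, mul_assoc] using Ideal.mul_mem_left _ (C c) hv' }
    have hW : W = ⊤ := by
      by_contra hne
      obtain ⟨φ, hφ, hle⟩ := Submodule.exists_le_ker_of_lt_top W (lt_top_iff_ne_top.2 hne)
      let v : Fin n → k := fun j => φ (Pi.single j 1)
      have hφv : ∀ w, φ w = w ⬝ᵥ v := by
        intro w
        conv_lhs => rw [pi_eq_sum_univ' w]
        simp [dotProduct, v, map_sum]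
      have hvU : v ∈ U := by
        intro g hg
        rw [← gl_inv_mulVec_eq_iff, ← sub_eq_zero]
        funext i
        have hrow : (fun j => ((g⁻¹ : GL (Fin n) k) : Matrix (Fin n) (Fin n) k) i j -
            (1 : Matrix (Fin n) (Fin n) k) i j) ∈ W := by
          change (∑ j, C (_ : k) * X j : MvPolynomial (Fin n) k) ∈ augIdeal k (Fin n) G
          rw [← gl_smul_X_sub]
          exact smul_sub_mem_augIdeal hg _
        have h1 := hle hrow
        rw [LinearMap.mem_ker, hφv] at h1
        conv_lhs => rw [← Matrix.one_mulVec v, Matrix.mulVec_mulVec, mul_one, ← Matrix.sub_mulVec]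
        exact h1
      rw [hU, Submodule.mem_bot] at hvU
      apply hφ
      refine LinearMap.ext fun w => ?_
      rw [hφv, hvU, dotProduct_zero, LinearMap.zero_apply]
    intro i
    have hi : (Pi.single i 1 : Fin n → k) ∈ W := hW ▸ Submodule.mem_top
    have h1 : (∑ j, C ((Pi.single i 1 : Fin n → k) j) * X j : MvPolynomial (Fin n) k) ∈
      augIdeal k (Fin n) G := hi
    rw [Finset.sum_eq_single i] at h1
    · simpa using h1
    · intro j _ hj
      rw [Pi.single_eq_of_ne hj, C_0, zero_mul]
    · simp
  · left
    intro g hg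
    ext i j
    have h1 : (Pi.single j 1 : Fin n → k) ∈ U := hU ▸ Submodule.mem_top
    have h2 := congrFun (h1 g hg) i
    simpa [Matrix.one_apply, Pi.single_apply] using h2

theorem HasPolyInv.coregular {G : Subgroup (GL (Fin n) k)} (h : HasPolyInv k (Fin n) G) :
    Coregular (matSet G) := by
  obtain ⟨f, hf, hind, hmem, hgen⟩ := h
  refine ⟨f, hf, hind, le_antisymm ?_ fun a ha => hgen a (mem_invariantRing_matSet.1 ha)⟩
  rw [Algebra.adjoin_le_iff]
  rintro _ ⟨i, rfl⟩
  exact mem_invariantRing_matSet.2 (hmem i)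

theorem DirectSummand.hasSplitting {G : Subgroup (GL (Fin n) k)} (h : DirectSummand (matSet G)) :
    HasSplitting k (Fin n) G := by
  obtain ⟨π, hsurj, -⟩ := h
  obtain ⟨s, hs⟩ := hsurj 1
  refine ⟨AddMonoidHom.mk' (fun t => (π (t * s) : MvPolynomial (Fin n) k)) fun t u => by
    rw [add_mul, map_add]; rfl, ⟨fun t => mem_invariantRing_matSet.1 (π (t * s)).2,
      fun a ha t => ?_⟩, ?_⟩
  · rw [AddMonoidHom.mk'_apply, mul_assoc]
    have := π.map_smul ⟨a, mem_invariantRing_matSet.2 ha⟩ (t * s)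
    exact congrArg Subtype.val this
  · rw [AddMonoidHom.mk'_apply, one_mul, hs]
    rfl

theorem directSummand_of_isInvLin {G : Subgroup (GL (Fin n) k)}
    {π : MvPolynomial (Fin n) k →+ MvPolynomial (Fin n) k} (hπ : IsInvLin G π) (h1 : π 1 = 1)
    (hhom : ∀ d s, s.IsHomogeneous d → (π s).IsHomogeneous d) : DirectSummand (matSet G) := by
  refine ⟨{ toFun := fun s => ⟨π s, mem_invariantRing_matSet.2 (hπ.mem s)⟩
            map_add' := fun s t => Subtype.ext (map_add π s t)
            map_smul' := fun a s =>
              Subtype.ext (hπ.map_mul a (mem_invariantRing_matSet.1 a.2) s) }, fun a => ?_,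
    fun d s hs => hhom d s hs⟩
  exact ⟨a, Subtype.ext (hπ.map_of_mem h1 (mem_invariantRing_matSet.1 a.2))⟩

theorem Coregular.reflSub_eq_and_directSummand {G : Subgroup (GL (Fin n) k)} [Finite G]
    (h : Coregular (matSet G)) : reflSub k (Fin n) G = G ∧ DirectSummand (matSet G) := by
  obtain ⟨f, hf, hind, hgen⟩ := h
  choose δ hδ using hf
  have hpos : ∀ i, 0 < δ i := by
    intro i
    by_contra h0
    have hdeg := hδ i
    rw [Nat.eq_zero_of_not_pos h0] at hdeg
    apply hind.transcendental i
    rw [totalDegree_eq_zero_iff_eq_C.1 (Nat.le_zero.1 hdeg.totalDegree_le), ← algebraMap_eq]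
    exact isAlgebraic_algebraMap _
  obtain ⟨hrefl, π, hπ, h1, hhom⟩ := reflSub_eq_and_exists_splitting (G := G) hδ hpos
    (fun i => mem_invariantRing_matSet.1 (hgen ▸ Algebra.subset_adjoin ⟨i, rfl⟩))
    (fun a ha => hgen ▸ mem_invariantRing_matSet.2 ha)
  exact ⟨hrefl, directSummand_of_isInvLin hπ h1 hhom⟩

end Bridge

/-- For a finite group `G ≤ GL(V)` acting irreducibly on `V`, the action is
coregular if and only if `G` is generated by pseudo-reflections and the direct
summand property holds. -/
theorem coregular_iff_pseudoReflections_and_directSummand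
    {k : Type} [Field k] {n : ℕ} (hn : 0 < n)
    (G : Subgroup (GL (Fin n) k)) [Finite G]
    (hirr : ∀ U : Submodule k (Fin n → k),
      (∀ g ∈ G, ∀ v ∈ U, ((g : GL (Fin n) k) : Matrix (Fin n) (Fin n) k) *ᵥ v ∈ U) →
        U = ⊥ ∨ U = ⊤) :
    Coregular (matSet G) ↔
      (G = Subgroup.closure
          {σ : GL (Fin n) k | σ ∈ G ∧
            IsPseudoReflection ((σ : GL (Fin n) k) : Matrix (Fin n) (Fin n) k)} ∧
        DirectSummand (matSet G)) := by
  rw [closure_pseudoReflections_eq, eq_comm (a := G)]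
  refine ⟨fun h => h.reflSub_eq_and_directSummand, fun ⟨hG, hs⟩ => ?_⟩
  obtain htriv | hX := eq_one_or_X_mem_augIdeal hirr
  · exact (hasPolyInv_of_trivial htriv).coregular
  obtain ⟨p, hp⟩ := CharP.exists k
  obtain hprime | rfl := CharP.char_is_prime_or_zero k p
  · have := Fact.mk hprime
    exact (hasPolyInv_of_charP p hG hs.hasSplitting hX).coregular
  · have := CharP.charP_to_charZero k
    exact (hasPolyInv_of_charZero hG).coregular
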